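/- Let X be a Borel subset of the Cantor space 2^ω. Then X (with the subspace topology) is homeomorphic to a semifilter on ω if and only if X is homogeneous and not locally compact. -/

import Mathlib

open Set

abbrev Cantor := ℕ → Bool

def UpwardClosed (S : Set Cantor) : Prop :=
  ∀ x ∈ S, ∀ y : Cantor, (∀ n, x n = true → y n = true) → y ∈ S

def DownwardClosed (R : Set Cantor) : Prop :=
  ∀ y ∈ R, ∀ x : Cantor, (∀ n, x n = true → y n = true) → x ∈ R

def ClosedUnderFinMod (S : Set Cantor) : Prop :=
  ∀ x ∈ S, ∀ y : Cantor, {n | x n ≠ y n}.Finite → y ∈ S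

def IsSemifilter (S : Set Cantor) : Prop :=
  (fun _ => false) ∉ S ∧ (fun _ => true) ∈ S ∧ UpwardClosed S ∧ ClosedUnderFinMod S

def IsSemiideal (R : Set Cantor) : Prop :=
  (fun _ => false) ∈ R ∧ (fun _ => true) ∉ R ∧ DownwardClosed R ∧ ClosedUnderFinMod R

def ClosedUnderInter (S : Set Cantor) : Prop :=
  ∀ x ∈ S, ∀ y ∈ S, (fun n => x n && y n) ∈ S

def IsFilterOnOmega (F : Set Cantor) : Prop := IsSemifilter F ∧ ClosedUnderInter F

def IsHomogeneous (X : Type*) [TopologicalSpace X] : Prop :=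
  ∀ x y : X, ∃ h : X ≃ₜ X, h x = y

def IsFsigma (A : Set Cantor) : Prop :=
  ∃ F : ℕ → Set Cantor, (∀ n, IsClosed (F n)) ∧ A = ⋃ n, F n

def DOmegaSigmaTwo (X : Set Cantor) : Prop :=
  ∃ A : ℕ → Set Cantor, (∀ n, IsFsigma (A n)) ∧ Monotone A ∧
    X = ⋃ n ∈ {n : ℕ | Odd n}, (A n \ ⋃ m < n, A m)

def InDelta (X : Set Cantor) : Prop := DOmegaSigmaTwo X ∧ DOmegaSigmaTwo Xᶜ

def WadgeLe (A B : Set Cantor) : Prop :=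
  ∃ f : Cantor → Cantor, Continuous f ∧ A = f ⁻¹' B

def WadgeEquiv (A B : Set Cantor) : Prop := WadgeLe A B ∧ WadgeLe B A

def CompletelyMetrizable (X : Type*) [t : TopologicalSpace X] : Prop :=
  ∃ m : MetricSpace X, m.toUniformSpace.toTopologicalSpace = t ∧
    @CompleteSpace X m.toUniformSpace

def FirstCategory (X : Type*) [TopologicalSpace X] : Prop :=
  ∃ f : ℕ → Set X, (∀ n, interior (closure (f n)) = ∅) ∧ (Set.univ : Set X) = ⋃ n, f n

def CantorFin : Set Cantor := {x | {n | x n = true}.Finite}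

def BorelSet (X : Set Cantor) : Prop := @MeasurableSet Cantor (borel Cantor) X

namespace BD

structure GT where
  N : Type
  len : N → ℕ
  par : N → N
  root : N
  len_root : len root = 0
  par_root : par root = root
  root_uniq : ∀ p, len p = 0 → p = root
  len_par : ∀ p n, len p = n + 1 → len (par p) = n
  child : ∀ p, ∃ q, len q = len p + 1 ∧ par q = p

namespace GT

def IsChild (T : GT) (q p : T.N) : Prop := T.len q = T.len p + 1 ∧ T.par q = p

def IsPlay (T : GT) (x : ℕ → T.N) : Prop := ∀ n, T.len (x n) = n ∧ T.par (x (n+1)) = x n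

def Strat (T : GT) : Type := {s : T.N → T.N // ∀ p, T.IsChild (s p) p}

def Cons (T : GT) (b : ℕ) (s : T.Strat) (x : ℕ → T.N) : Prop :=
  ∀ n, n % 2 = b → x (n+1) = s.1 (x n)

noncomputable def dflt (T : GT) (p : T.N) : T.N := (T.child p).choose

lemma dflt_spec (T : GT) (p : T.N) : T.IsChild (T.dflt p) p := (T.child p).choose_spec

def anc (T : GT) (p : T.N) (i : ℕ) : T.N := T.par^[T.len p - i] p

lemma IsPlay.len {T : GT} {x : ℕ → T.N} (h : T.IsPlay x) (n : ℕ) : T.len (x n) = n := (h n).1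
lemma IsPlay.par {T : GT} {x : ℕ → T.N} (h : T.IsPlay x) (n : ℕ) : T.par (x (n+1)) = x n := (h n).2

lemma IsPlay.child {T : GT} {x : ℕ → T.N} (h : T.IsPlay x) (n : ℕ) :
    T.IsChild (x (n+1)) (x n) := ⟨by rw [h.len, h.len], h.par n⟩

lemma IsPlay.iter {T : GT} {x : ℕ → T.N} (h : T.IsPlay x) (d n : ℕ) :
    T.par^[d] (x (n + d)) = x n := by
  induction d with
  | zero => rfl
  | succ d ih => rw [Function.iterate_succ_apply, ← add_assoc, h.par, ih]

lemma IsPlay.anc {T : GT} {x : ℕ → T.N} (h : T.IsPlay x) {i n : ℕ} (hi : i ≤ n) :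
    T.anc (x n) i = x i := by
  unfold GT.anc
  rw [h.len]
  obtain ⟨d, rfl⟩ := Nat.exists_eq_add_of_le hi
  rw [Nat.add_sub_cancel_left, h.iter]

lemma anc_self (T : GT) (p : T.N) : T.anc p (T.len p) = p := by simp [anc]

lemma anc_child (T : GT) {q p : T.N} (h : T.IsChild q p) {i : ℕ} (hi : i ≤ T.len p) :
    T.anc q i = T.anc p i := by
  unfold anc
  rw [h.1, Nat.succ_sub hi, Function.iterate_succ_apply, h.2]

lemma anc_of_le (T : GT) (p : T.N) {i : ℕ} (hi : T.len p ≤ i) : T.anc p i = p := by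
  simp [anc, Nat.sub_eq_zero_of_le hi]

lemma anc_par (T : GT) (p : T.N) {i : ℕ} (hi : i < T.len p) :
    T.anc p i = T.anc (T.par p) i := by
  obtain ⟨m, hm⟩ : ∃ m, T.len p = m + 1 := ⟨T.len p - 1, by omega⟩
  exact T.anc_child ⟨by rw [hm, T.len_par p m hm], rfl⟩ (by rw [T.len_par p m hm]; omega)

lemma isChild_par (T : GT) (p : T.N) (h : 0 < T.len p) : T.IsChild p (T.par p) := by
  obtain ⟨m, hm⟩ : ∃ m, T.len p = m + 1 := ⟨T.len p - 1, by omega⟩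
  exact ⟨by rw [hm, T.len_par p m hm], rfl⟩

lemma len_anc (T : GT) (p : T.N) {i : ℕ} (hi : i ≤ T.len p) : T.len (T.anc p i) = i := by
  induction h : T.len p generalizing p with
  | zero => rw [T.anc_of_le p (by omega)]; omega
  | succ n ih =>
    rcases Nat.lt_or_ge i (T.len p) with h1 | h1
    · rw [T.anc_par p h1]
      have := T.len_par p n h
      exact ih _ (by omega) this
    · rw [T.anc_of_le p h1]; omega

lemma anc_anc (T : GT) (p : T.N) {i j : ℕ} (hij : i ≤ j) (hj : j ≤ T.len p) :
    T.anc (T.anc p j) i = T.anc p i := by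
  have h := T.len_anc p hj
  have h1 : T.anc (T.anc p j) i = T.par^[j - i] (T.anc p j) := by
    rw [anc, h]
  rw [h1]; unfold anc
  rw [← Function.iterate_add_apply]
  congr 1; omega

instance (T : GT) : Nonempty T.Strat := ⟨⟨T.dflt, T.dflt_spec⟩⟩

/-! Forcing -/
inductive Force (T : GT) (b : ℕ) (Sg O : Set T.N) : T.N → Prop
  | base (q) : q ∈ Sg → q ∈ O → Force T b Sg O q
  | mine (q c) : q ∈ Sg → T.len q % 2 = b → T.IsChild c q → Force T b Sg O c → Force T b Sg O q
  | theirs (q) : q ∈ Sg → T.len q % 2 ≠ b → (∀ c, T.IsChild c q → Force T b Sg O c) →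
      Force T b Sg O q

lemma force_strat (T : GT) (b : ℕ) (Sg O : Set T.N) (q : T.N) (h : Force T b Sg O q) :
    ∃ s : T.Strat, ∀ x, T.IsPlay x → x (T.len q) = q →
      (∀ m, T.len q ≤ m → m % 2 = b → (∀ j, T.len q ≤ j → j ≤ m → x j ∉ O) →
        x (m+1) = s.1 (x m)) →
      ∃ m, T.len q ≤ m ∧ x m ∈ O ∧ ∀ n, T.len q ≤ n → n ≤ m → x n ∈ Sg := by
  classical
  induction h with
  | base q h1 h2 =>
    refine ⟨⟨T.dflt, T.dflt_spec⟩, fun x hx hq _ => ⟨T.len q, le_rfl, by rwa [hq], ?_⟩⟩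
    intro n h3 h4
    have : n = T.len q := by omega
    rw [this, hq]; exact h1
  | mine q c h1 h2 hc _ ih =>
    obtain ⟨s, hs⟩ := ih
    refine ⟨⟨fun r => if r = q then c else s.1 r, fun r => ?_⟩, ?_⟩
    · dsimp only
      split_ifs with h
      · rw [h]; exact hc
      · exact s.2 r
    intro x hx hq hf
    by_cases hO : q ∈ O
    · refine ⟨T.len q, le_rfl, by rwa [hq], ?_⟩
      intro n h3 h4
      have : n = T.len q := by omega
      rw [this, hq]; exact h1
    have hne : ∀ j, T.len q ≤ j → x j = q → j = T.len q := by
      intro j _ hj; rw [← hx.len j, hj]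
    have hxc : x (T.len q + 1) = c := by
      rw [hf _ le_rfl h2 (fun j hj hj' => by
        have : j = T.len q := by omega
        rw [this, hq]; exact hO), hq]; simp
    obtain ⟨m, hm1, hm2, hm3⟩ := hs x hx (by rw [hc.1, hxc]) (by
      intro m hm hb hj
      rw [hc.1] at hm
      have := hf m (by omega) hb (by
        intro j hj1 hj2
        rcases Nat.eq_or_lt_of_le hj1 with h | h
        · rw [← h, hq]; exact hO
        · exact hj j (by rw [hc.1]; omega) hj2)
      rw [this]
      have hn : x m ≠ q := fun h => by have := hne m (by omega) h; omega
      simp [hn])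
    rw [hc.1] at hm1 hm3
    refine ⟨m, by omega, hm2, fun n hn1 hn2 => ?_⟩
    rcases Nat.eq_or_lt_of_le hn1 with h | h
    · rw [← h, hq]; exact h1
    · exact hm3 n (by omega) hn2
  | theirs q h1 h2 _ ih =>
    choose! s hs using ih
    refine ⟨⟨fun r => if T.IsChild (T.anc r (T.len q + 1)) q then
      (s (T.anc r (T.len q + 1))).1 r else T.dflt r, fun r => ?_⟩, ?_⟩
    · dsimp only
      split_ifs with h
      · exact (s _).2 r
      · exact T.dflt_spec r
    intro x hx hq hf
    by_cases hO : q ∈ O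
    · refine ⟨T.len q, le_rfl, by rwa [hq], ?_⟩
      intro n h3 h4
      have : n = T.len q := by omega
      rw [this, hq]; exact h1
    have hc : T.IsChild (x (T.len q + 1)) q := by
      have := hx.child (T.len q); rwa [hq] at this
    obtain ⟨m, hm1, hm2, hm3⟩ := hs _ hc x hx (by rw [hc.1]) (by
      intro m hm hb hj
      rw [hc.1] at hm
      have := hf m (by omega) hb (by
        intro j hj1 hj2
        rcases Nat.eq_or_lt_of_le hj1 with h | h
        · rw [← h, hq]; exact hO
        · exact hj j (by rw [hc.1]; omega) hj2)
      rw [this]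
      simp only [hx.anc hm, hc, if_true])
    rw [hc.1] at hm1 hm3
    refine ⟨m, by omega, hm2, fun n hn1 hn2 => ?_⟩
    rcases Nat.eq_or_lt_of_le hn1 with h | h
    · rw [← h, hq]; exact h1
    · exact hm3 n (by omega) hn2

lemma Force.mem {T : GT} {b : ℕ} {Sg O : Set T.N} {q : T.N} (h : Force T b Sg O q) : q ∈ Sg := by
  cases h <;> assumption

def Opn (T : GT) (B : Set (ℕ → T.N)) : Prop :=
  ∀ x, T.IsPlay x → x ∈ B → ∃ n, ∀ y, T.IsPlay y → y n = x n → y ∈ B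

def Clp (T : GT) (B : Set (ℕ → T.N)) : Prop := T.Opn B ∧ T.Opn Bᶜ

def Det (T : GT) (B : Set (ℕ → T.N)) : Prop :=
  (∃ s, ∀ x, T.IsPlay x → T.Cons 0 s x → x ∈ B) ∨
  (∃ s, ∀ x, T.IsPlay x → T.Cons 1 s x → x ∉ B)

lemma IsPlay.zero {T : GT} {x : ℕ → T.N} (h : T.IsPlay x) : x 0 = T.root :=
  T.root_uniq _ (h.len 0)

lemma det_open (T : GT) (B : Set (ℕ → T.N)) (hB : T.Opn B) : T.Det B := by
  classical
  let O : Set T.N := {u | ∀ y, T.IsPlay y → y (T.len u) = u → y ∈ B}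
  by_cases h : Force T 0 univ O T.root
  · left
    obtain ⟨s, hs⟩ := T.force_strat 0 univ O _ h
    refine ⟨s, fun x hx hc => ?_⟩
    obtain ⟨m, _, hm, _⟩ := hs x hx (by rw [T.len_root, hx.zero]) (fun m _ hm _ => hc m hm)
    exact hm x hx (by rw [hx.len])
  · right
    refine ⟨⟨fun p => if hp : ∃ c, T.IsChild c p ∧ ¬ Force T 0 univ O c then hp.choose
      else T.dflt p, fun p => ?_⟩, ?_⟩
    · dsimp only
      split_ifs with hp
      · exact hp.choose_spec.1
      · exact T.dflt_spec p
    intro x hx hc hxB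
    have key : ∀ n, ¬ Force T 0 univ O (x n) := by
      intro n; induction n with
      | zero => rwa [hx.zero]
      | succ n ih =>
        by_cases hn : n % 2 = 0
        · exact fun hf => ih (Force.mine _ _ trivial (by rw [hx.len, hn]) (hx.child n) hf)
        · have h2 : ∃ c, T.IsChild c (x n) ∧ ¬ Force T 0 univ O c := by
            by_contra hcon
            push Not at hcon
            exact ih (Force.theirs _ trivial (by rwa [hx.len]) hcon)
          rw [hc n (by omega)]
          dsimp only
          rw [dif_pos h2]
          exact h2.choose_spec.2
    obtain ⟨n, hn⟩ := hB x hx hxB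
    exact key n (Force.base _ trivial (fun y hy h => hn y hy (by rwa [hx.len] at h)))

end GT

structure IsHom (S T : GT) (f : S.N → T.N) : Prop where
  len : ∀ p, T.len (f p) = S.len p
  par : ∀ p, T.par (f p) = f (S.par p)

lemma IsHom.play {S T : GT} {f : S.N → T.N} (h : IsHom S T f) {x : ℕ → S.N} (hx : S.IsPlay x) :
    T.IsPlay (fun n => f (x n)) := fun n => ⟨by rw [h.len, hx.len], by rw [h.par, hx.par]⟩

lemma IsHom.comp {S T U : GT} {f : S.N → T.N} {g : T.N → U.N} (h : IsHom S T f) (h' : IsHom T U g) :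
    IsHom S U (fun p => g (f p)) :=
  ⟨fun p => by rw [h'.len, h.len], fun p => by rw [h'.par, h.par]⟩

def pull {S T : GT} (f : S.N → T.N) (B : Set (ℕ → T.N)) : Set (ℕ → S.N) :=
  {y | (fun n => f (y n)) ∈ B}

lemma IsHom.opn {S T : GT} {f : S.N → T.N} (h : IsHom S T f) {B : Set (ℕ → T.N)} (hB : T.Opn B) :
    S.Opn (pull f B) := by
  intro x hx hxB
  obtain ⟨n, hn⟩ := hB _ (h.play hx) hxB
  exact ⟨n, fun y hy hyn => hn _ (h.play hy) (by simp only [hyn])⟩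

lemma IsHom.clp {S T : GT} {f : S.N → T.N} (h : IsHom S T f) {B : Set (ℕ → T.N)} (hB : T.Clp B) :
    S.Clp (pull f B) := ⟨h.opn hB.1, h.opn hB.2⟩

structure Cov (k : ℕ) (S T : GT) where
  π : S.N → T.N
  hom : IsHom S T π
  inj : ∀ p q, S.len p ≤ k → π p = π q → p = q
  surj : ∀ q, T.len q ≤ k → ∃ p, π p = q
  φ : ℕ → S.Strat → T.Strat
  loc : ∀ b, b < 2 → ∀ (s s' : S.Strat) (n : ℕ),
    (∀ p, S.len p < n → S.len p % 2 = b → s.1 p = s'.1 p) →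
    (∀ q, T.len q < n → T.len q % 2 = b → (φ b s).1 q = (φ b s').1 q)
  kid : ∀ b, b < 2 → ∀ (s : S.Strat) (p), S.len p < k → S.len p % 2 = b →
    (φ b s).1 (π p) = π (s.1 p)
  lift : ∀ b, b < 2 → ∀ (s : S.Strat) (x), T.IsPlay x → T.Cons b (φ b s) x →
    ∃ y, S.IsPlay y ∧ S.Cons b s y ∧ ∀ n, π (y n) = x n

namespace Cov

def mono {k k' : ℕ} {S T : GT} (c : Cov k' S T) (h : k ≤ k') : Cov k S T where
  π := c.π
  hom := c.hom
  inj p q hp := c.inj p q (hp.trans h)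
  surj q hq := c.surj q (hq.trans h)
  φ := c.φ
  loc := c.loc
  kid b hb s p hp := c.kid b hb s p (hp.trans_le h)
  lift := c.lift

def comp {k : ℕ} {S T U : GT} (c : Cov k S T) (d : Cov k T U) : Cov k S U where
  π p := d.π (c.π p)
  hom := c.hom.comp d.hom
  inj p q hp h := c.inj p q hp (d.inj _ _ (by rwa [c.hom.len]) h)
  surj q hq := by
    obtain ⟨p, hp⟩ := d.surj q hq
    obtain ⟨r, hr⟩ := c.surj p (by rwa [← d.hom.len, hp])
    exact ⟨r, by rw [hr, hp]⟩
  φ b s := d.φ b (c.φ b s)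
  loc b hb s s' n h := d.loc b hb _ _ n (c.loc b hb s s' n h)
  kid b hb s p hp hpb := by
    rw [d.kid b hb _ _ (by rwa [c.hom.len]) (by rwa [c.hom.len]), c.kid b hb s p hp hpb]
  lift b hb s x hx hc := by
    obtain ⟨y, h1, h2, h3⟩ := d.lift b hb _ x hx hc
    obtain ⟨z, h4, h5, h6⟩ := c.lift b hb _ y h1 h2
    exact ⟨z, h4, h5, fun n => by rw [h6, h3]⟩

lemma det {k : ℕ} {S T : GT} (c : Cov k S T) (B : Set (ℕ → T.N)) (h : S.Det (pull c.π B)) :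
    T.Det B := by
  rcases h with ⟨s, hs⟩ | ⟨s, hs⟩
  · left
    refine ⟨c.φ 0 s, fun x hx hc => ?_⟩
    obtain ⟨y, h1, h2, h3⟩ := c.lift 0 (by norm_num) s x hx hc
    have := hs y h1 h2
    unfold pull at this
    simpa [h3] using this
  · right
    refine ⟨c.φ 1 s, fun x hx hc => ?_⟩
    obtain ⟨y, h1, h2, h3⟩ := c.lift 1 (by norm_num) s x hx hc
    have := hs y h1 h2
    unfold pull at this
    simpa [h3] using this

end Cov

end BD

namespace BD

lemma thread_exists (m : ℕ) : ∀ (N : ℕ → Type) (π : ∀ i, N (i+1) → N i) (P : ∀ i, N i → Prop)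
    (_ : ∀ i, m ≤ i → ∀ p, P i p → ∃ q, π i q = p ∧ P (i+1) q) (p : N m) (_ : P m p),
    ∃ t : ∀ i, N i, (∀ i, π i (t (i+1)) = t i) ∧ t m = p := by
  induction m with
  | zero =>
    intro N π P h p hp
    choose g hg using fun i (q : {q : N i // P i q}) => h i (Nat.zero_le _) q.1 q.2
    let t : ∀ i, {q : N i // P i q} := fun i =>
      Nat.rec ⟨p, hp⟩ (fun i q => ⟨g i q, (hg i q).2⟩) i
    exact ⟨fun i => (t i).1, fun i => (hg i (t i)).1, rfl⟩
  | succ m ih =>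
    intro N π P h p hp
    obtain ⟨t, h1, h2⟩ := ih (fun i => N (i+1)) (fun i => π (i+1)) (fun i => P (i+1))
      (fun i hi q hq => h (i+1) (by omega) q hq) p hp
    refine ⟨fun i => Nat.casesOn i (π 0 (t 0)) t, fun i => ?_, h2⟩
    cases i with
    | zero => rfl
    | succ i => exact h1 i

section limit
variable (k : ℕ) (T : ℕ → GT) (C : ∀ m, Cov (k+m) (T (m+1)) (T m))

def Thr : Type := {t : ∀ m, (T m).N // ∀ m, (C m).π (t (m+1)) = t m}

variable {k T C}

lemma Thr.len (t : Thr k T C) (m : ℕ) : (T m).len (t.1 m) = (T 0).len (t.1 0) := by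
  induction m with
  | zero => rfl
  | succ m ih => rw [← ih, ← t.2 m, (C m).hom.len]

lemma Thr.ext' (t t' : Thr k T C) (m : ℕ) (hl : (T 0).len (t.1 0) ≤ k + m)
    (h : t.1 m = t'.1 m) : t = t' := by
  have up : ∀ d, t.1 (m + d) = t'.1 (m + d) := by
    intro d; induction d with
    | zero => exact h
    | succ d ih =>
      refine (C (m+d)).inj _ _ ?_ ?_
      · have h5 := t.len (m+d+1)
        show (T (m+d+1)).len (t.1 (m+d+1)) ≤ _
        omega
      · have h1 := t.2 (m+d); have h2 := t'.2 (m+d)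
        exact h1.trans (ih.trans h2.symm)
  have down : ∀ d, ∀ i, t.1 (i + d) = t'.1 (i + d) → t.1 i = t'.1 i := by
    intro d; induction d with
    | zero => intro i h; exact h
    | succ d ih =>
      intro i h
      apply ih
      rw [← t.2 (i+d), ← t'.2 (i+d)]
      exact congrArg _ h
  apply Subtype.ext
  funext i
  exact down m i (by have := up i; rwa [add_comm] at this)

lemma Thr.ex (m : ℕ) (p : (T m).N) (hp : (T m).len p ≤ k + m) : ∃ t : Thr k T C, t.1 m = p := by
  obtain ⟨t, h1, h2⟩ := thread_exists m (fun i => (T i).N) (fun i => (C i).π)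
    (fun i q => (T i).len q = (T m).len p) (by
      intro i hi q hq
      obtain ⟨r, hr⟩ := (C i).surj q (by omega)
      exact ⟨r, hr, by rw [← hq, ← hr, (C i).hom.len]⟩) p rfl
  exact ⟨⟨t, h1⟩, h2⟩

variable (k T C)

lemma Thr.root_coh (m : ℕ) : (C m).π (T (m+1)).root = (T m).root :=
  (T m).root_uniq _ (by rw [(C m).hom.len, (T (m+1)).len_root])

def LimT : GT where
  N := Thr k T C
  len t := (T 0).len (t.1 0)
  par t := ⟨fun m => (T m).par (t.1 m), fun m => by rw [← (C m).hom.par, t.2]⟩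
  root := ⟨fun m => (T m).root, fun m => Thr.root_coh k T C m⟩
  len_root := (T 0).len_root
  par_root := Subtype.ext (funext fun m => (T m).par_root)
  root_uniq p hp := Subtype.ext (funext fun m => (T m).root_uniq _ (by rw [p.len, hp]))
  len_par p n h := (T 0).len_par _ n h
  child t := by
    obtain ⟨q, hq⟩ := (T ((T 0).len (t.1 0) + 1)).child (t.1 _)
    have hq1 := t.len ((T 0).len (t.1 0) + 1)
    obtain ⟨t', ht'⟩ := Thr.ex (C := C) _ q (by omega)
    have hl : (T 0).len (t'.1 0) = (T 0).len (t.1 0) + 1 := by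
      rw [← t'.len ((T 0).len (t.1 0) + 1), ht', hq.1, hq1]
    refine ⟨t', hl, ?_⟩
    refine Thr.ext' _ _ ((T 0).len (t.1 0) + 1) ?_ ?_
    · have := (T 0).len_par _ _ hl
      show (T 0).len ((T 0).par (t'.1 0)) ≤ _
      omega
    · show (T _).par (t'.1 _) = _
      rw [ht', hq.2]

lemma lim_hom (m : ℕ) : IsHom (LimT k T C) (T m) (fun t => t.1 m) :=
  ⟨fun t => t.len m, fun _ => rfl⟩

open Classical in
noncomputable def preS (s : (LimT k T C).Strat) (m : ℕ) : (T m).Strat :=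
  ⟨fun p => if h : (T m).len p < k + m then (s.1 (Thr.ex (C := C) m p h.le).choose).1 m
    else (T m).dflt p, fun p => by
      dsimp only
      split_ifs with h
      · have h1 := (Thr.ex (C := C) m p h.le).choose_spec
        have h2 := s.2 (Thr.ex (C := C) m p h.le).choose
        set t := (Thr.ex (C := C) m p h.le).choose
        refine ⟨?_, ?_⟩
        · rw [(s.1 t).len m, ← h1, t.len m]; exact h2.1
        · have := congrArg (fun t : Thr k T C => t.1 m) h2.2
          exact this.trans h1
      · exact (T m).dflt_spec p⟩

lemma preS_eq (s : (LimT k T C).Strat) (m : ℕ) (t : Thr k T C) (h : (T 0).len (t.1 0) < k + m) :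
    (preS k T C s m).1 (t.1 m) = (s.1 t).1 m := by
  have h' : (T m).len (t.1 m) < k + m := by rwa [t.len]
  unfold preS
  dsimp only
  rw [dif_pos h']
  have h1 := (Thr.ex (C := C) m _ h'.le).choose_spec
  have : (Thr.ex (C := C) m _ h'.le).choose = t :=
    Thr.ext' _ _ m (by rw [← Thr.len _ m, h1]; exact h'.le) h1
  rw [this]

noncomputable def GS (b : ℕ) (s : (LimT k T C).Strat) : ℕ → ∀ m, (T m).Strat
  | 0, m => preS k T C s m
  | j+1, m => (C m).φ b (GS b s j (m+1))

lemma GS_succ (b : ℕ) (hb : b < 2) (s : (LimT k T C).Strat) (j : ℕ) : ∀ m p, (T m).len p < k + m + j →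
    (T m).len p % 2 = b → (GS k T C b s j m).1 p = (GS k T C b s (j+1) m).1 p := by
  induction j with
  | zero =>
    intro m p hp hpb
    obtain ⟨t, rfl⟩ := Thr.ex (C := C) m p (by omega)
    have hl := t.len m
    show (preS k T C s m).1 _ = ((C m).φ b (preS k T C s (m+1))).1 _
    rw [preS_eq _ _ _ _ _ _ (by omega)]
    have := (C m).kid b hb (preS k T C s (m+1)) (t.1 (m+1))
      (by rw [t.len]; omega) (by rw [t.len]; omega)
    rw [t.2 m] at this
    rw [this, preS_eq _ _ _ _ _ _ (by omega), (s.1 t).2 m]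
  | succ j ih =>
    intro m p hp hpb
    exact (C m).loc b hb _ _ (k + m + (j+1)) (fun q hq hqb => ih (m+1) q (by omega) hqb) p hp hpb

lemma GS_le (b : ℕ) (hb : b < 2) (s : (LimT k T C).Strat) (j j' : ℕ) (hj : j ≤ j') (m p)
    (hp : (T m).len p < k + m + j)
    (hpb : (T m).len p % 2 = b) : (GS k T C b s j m).1 p = (GS k T C b s j' m).1 p := by
  induction j', hj using Nat.le_induction with
  | base => rfl
  | succ j' hj ih => rw [ih, GS_succ k T C b hb s j' m p (by omega) hpb]

noncomputable def LS (b : ℕ) (s : (LimT k T C).Strat) (m : ℕ) : (T m).Strat :=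
  ⟨fun p => (GS k T C b s ((T m).len p + 1) m).1 p, fun p => (GS k T C b s _ m).2 p⟩

lemma LS_eq (b : ℕ) (hb : b < 2) (s : (LimT k T C).Strat) (j m p) (hp : (T m).len p < k + m + j)
    (hpb : (T m).len p % 2 = b) : (LS k T C b s m).1 p = (GS k T C b s j m).1 p := by
  unfold LS
  dsimp only
  rcases le_total j ((T m).len p + 1) with h | h
  · exact (GS_le k T C b hb s _ _ h m p hp hpb).symm
  · exact GS_le k T C b hb s _ _ h m p (by omega) hpb

lemma LS_step (b : ℕ) (hb : b < 2) (s : (LimT k T C).Strat) (m p)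
    (hpb : (T m).len p % 2 = b) : (LS k T C b s m).1 p = ((C m).φ b (LS k T C b s (m+1))).1 p := by
  rw [LS_eq k T C b hb s ((T m).len p + 1 + 1) m p (by omega) hpb]
  exact (C m).loc b hb _ _ ((T m).len p + 1) (fun q hq hqb =>
    (LS_eq k T C b hb s ((T m).len p + 1) (m+1) q (by omega) hqb).symm) p (by omega) hpb

lemma LS_pre (b : ℕ) (hb : b < 2) (s : (LimT k T C).Strat) (m) (t : Thr k T C)
    (hp : (T 0).len (t.1 0) < k + m)
    (hpb : (T 0).len (t.1 0) % 2 = b) : (LS k T C b s m).1 (t.1 m) = (s.1 t).1 m := by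
  rw [LS_eq k T C b hb s 0 m _ (by rwa [t.len]) (by rwa [t.len])]
  exact preS_eq k T C s m t hp

noncomputable def limCov : Cov k (LimT k T C) (T 0) where
  π t := t.1 0
  hom := lim_hom k T C 0
  inj p q hp h := Thr.ext' p q 0 hp h
  surj q hq := Thr.ex 0 q hq
  φ b s := LS k T C b s 0
  loc b hb s s' n h q hq hqb := by
    have hpre : ∀ m p, (T m).len p < n → (T m).len p % 2 = b →
        (preS k T C s m).1 p = (preS k T C s' m).1 p := by
      intro m p hp hpb
      unfold preS
      dsimp only
      split_ifs with h1
      · have h2 := (Thr.ex (C := C) m p h1.le).choose_spec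
        set t := (Thr.ex (C := C) m p h1.le).choose
        have h3 : (T 0).len (t.1 0) = (T m).len p := by rw [← h2]; exact (t.len m).symm
        rw [h t (by show (T 0).len (t.1 0) < n; omega) (by show (T 0).len (t.1 0) % 2 = b; omega)]
      · rfl
    have hG : ∀ j m p, (T m).len p < n → (T m).len p % 2 = b →
        (GS k T C b s j m).1 p = (GS k T C b s' j m).1 p := by
      intro j; induction j with
      | zero => exact hpre
      | succ j ih => intro m; exact (C m).loc b hb _ _ n (ih (m+1))
    exact hG _ 0 q hq hqb
  kid b hb s p hp hpb := LS_pre k T C b hb s 0 p hp hpb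
  lift b hb s x hx hc := by
    have step : ∀ m (x : ℕ → (T m).N), (T m).IsPlay x ∧ (T m).Cons b (LS k T C b s m) x →
        ∃ y, (∀ n, (C m).π (y n) = x n) ∧ ((T (m+1)).IsPlay y ∧
          (T (m+1)).Cons b (LS k T C b s (m+1)) y) := by
      intro m x ⟨hx, hc⟩
      obtain ⟨y, h1, h2, h3⟩ := (C m).lift b hb (LS k T C b s (m+1)) x hx (by
        intro n hn
        rw [hc n hn]
        exact LS_step k T C b hb s m _ (by rw [hx.len, hn]))
      exact ⟨y, h3, h1, h2⟩
    obtain ⟨Y, h1, h2⟩ : ∃ Y : ∀ m, {y : ℕ → (T m).N // (T m).IsPlay y ∧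
        (T m).Cons b (LS k T C b s m) y}, (∀ m n, (C m).π ((Y (m+1)).1 n) = (Y m).1 n) ∧
        (Y 0).1 = x := by
      choose g hg using fun m (x : {y : ℕ → (T m).N // (T m).IsPlay y ∧
        (T m).Cons b (LS k T C b s m) y}) => step m x.1 x.2
      let Y : ∀ m, {y : ℕ → (T m).N // (T m).IsPlay y ∧
        (T m).Cons b (LS k T C b s m) y} := fun m =>
        Nat.rec ⟨x, hx, hc⟩ (fun m y => ⟨g m y, (hg m y).2⟩) m
      exact ⟨Y, fun m => (hg m (Y m)).1, rfl⟩
    let z : ℕ → Thr k T C := fun n => ⟨fun m => (Y m).1 n, fun m => h1 m n⟩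
    have hzl : ∀ n, (T 0).len ((z n).1 0) = n := fun n => (Y 0).2.1.len n
    refine ⟨z, fun n => ⟨hzl n, Subtype.ext (funext fun m => (Y m).2.1.par n)⟩, ?_, ?_⟩
    · intro n hn
      refine Thr.ext' _ _ (n+1) (by rw [hzl]; omega) ?_
      rw [← LS_pre k T C b hb s (n+1) (z n) (by rw [hzl]; omega) (by rw [hzl, hn])]
      exact (Y (n+1)).2.2 n hn
    · intro n; exact congrFun h2 n

end limit

/-- hereditarily unravellable -/
def HUnr (T : GT) (B : Set (ℕ → T.N)) : Prop :=
  ∀ (T' : GT) (f : T'.N → T.N), IsHom T' T f → ∀ k, ∃ (S : GT) (c : Cov k S T'),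
    S.Clp (pull c.π (pull f B))

lemma HUnr.compl {T : GT} {B : Set (ℕ → T.N)} (h : HUnr T B) : HUnr T Bᶜ := by
  intro T' f hf k
  obtain ⟨S, c, h1, h2⟩ := h T' f hf k
  refine ⟨S, c, h2, ?_⟩
  have : (pull c.π (pull f Bᶜ))ᶜ = pull c.π (pull f B) := by
    ext x; simp [pull]
  rw [this]; exact h1

lemma HUnr.iUnion {T : GT} {B : ℕ → Set (ℕ → T.N)} (h : ∀ n, HUnr T (B n))
    (hop : ∀ (S : GT) (D : Set (ℕ → S.N)), S.Opn D → HUnr S D) : HUnr T (⋃ n, B n) := by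
  intro T' f hf k
  let St := Σ S : GT, {g : S.N → T.N // IsHom S T g}
  choose nx cv hcl using fun (m : ℕ) (s : St) => h m s.1 s.2.1 s.2.2 (k+m)
  let st : ℕ → St := fun m => Nat.rec ⟨T', f, hf⟩ (fun m s =>
    ⟨nx m s, fun p => s.2.1 ((cv m s).π p), (cv m s).hom.comp s.2.2⟩) m
  let TT : ℕ → GT := fun m => (st m).1
  let C : ∀ m, Cov (k+m) (TT (m+1)) (TT m) := fun m => cv m (st m)
  let L := LimT k TT C
  have hc : ∀ m, ∀ t : L.N, (st m).2.1 (t.1 m) = f (t.1 0) := by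
    intro m t; induction m with
    | zero => rfl
    | succ m ih =>
      rw [← ih]
      have : (st m).2.1 ((C m).π (t.1 (m+1))) = (st m).2.1 (t.1 m) := by rw [t.2 m]
      exact this
  have hopen : L.Opn (pull (fun t : L.N => f (t.1 0)) (⋃ n, B n)) := by
    intro x hx hxB
    obtain ⟨m, hm⟩ := mem_iUnion.1 hxB
    have hm2 : L.Opn (pull (fun t : L.N => t.1 (m+1)) (pull (C m).π (pull (st m).2.1 (B m)))) :=
      (lim_hom k TT C (m+1)).opn (hcl m (st m)).1
    have hh : pull (fun t : L.N => t.1 (m+1)) (pull (C m).π (pull (st m).2.1 (B m)))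
        = pull (fun t : L.N => f (t.1 0)) (B m) := by
      ext y
      show (fun n => (st m).2.1 ((C m).π ((y n).1 (m+1)))) ∈ B m ↔ (fun n => f ((y n).1 0)) ∈ B m
      have : (fun n => (st m).2.1 ((C m).π ((y n).1 (m+1)))) = (fun n => f ((y n).1 0)) := by
        funext n; rw [(y n).2 m, hc]
      rw [this]
    rw [hh] at hm2
    obtain ⟨n, hn⟩ := hm2 x hx hm
    exact ⟨n, fun y hy hyn => mem_iUnion.2 ⟨m, hn y hy hyn⟩⟩
  obtain ⟨S, c, hS⟩ := hop L _ hopen L id ⟨fun _ => rfl, fun _ => rfl⟩ k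
  exact ⟨S, c.comp (limCov k TT C), hS⟩

end BD

namespace BD

section unr
variable (T : GT) (O : Set T.N) (K : ℕ)

def QI (p1 : T.N) (Sg : Set T.N) : Prop :=
  p1 ∈ Sg ∧ (∀ q ∈ Sg, q = p1 ∨ (T.len p1 < T.len q ∧ T.par q ∈ Sg)) ∧
  (∀ q ∈ Sg, T.len q % 2 = 1 → ∀ c, T.IsChild c q → c ∈ Sg) ∧
  (∀ q ∈ Sg, T.len q % 2 = 0 → ∃ c, T.IsChild c q ∧ c ∈ Sg)

def QII (p2 : T.N) (Sg Sg' : Set T.N) : Prop :=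
  p2 ∈ Sg' ∧ Sg' ⊆ Sg ∧ (∀ q ∈ Sg', q = p2 ∨ (T.len p2 < T.len q ∧ T.par q ∈ Sg')) ∧
  (∀ q ∈ Sg', T.len q % 2 = 0 → ∀ c, T.IsChild c q → c ∈ Sg → c ∈ Sg') ∧
  (∀ q ∈ Sg', T.len q % 2 = 1 → ∃ c, T.IsChild c q ∧ c ∈ Sg') ∧ (∀ q ∈ Sg', q ∉ O)

variable {T}
lemma tree_anc {p1 : T.N} {Sg : Set T.N}
    (h : ∀ q ∈ Sg, q = p1 ∨ (T.len p1 < T.len q ∧ T.par q ∈ Sg)) :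
    ∀ n q, q ∈ Sg → T.len q = n → T.len p1 ≤ n ∧ T.anc q (T.len p1) = p1 ∧
      ∀ i, T.len p1 ≤ i → T.anc q i ∈ Sg := by
  intro n
  induction n with
  | zero =>
    intro q hq hl
    rcases h q hq with h1 | h1
    · subst h1
      exact ⟨by omega, T.anc_self q, fun i hi => by rwa [T.anc_of_le _ hi]⟩
    · omega
  | succ n ih =>
    intro q hq hl
    rcases h q hq with h1 | ⟨h1, h2⟩
    · subst h1
      exact ⟨by omega, T.anc_self q, fun i hi => by rwa [T.anc_of_le _ hi]⟩
    · obtain ⟨h3, h4, h5⟩ := ih _ h2 (T.len_par q n hl)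
      refine ⟨by omega, by rw [T.anc_par q h1, h4], fun i hi => ?_⟩
      rcases Nat.lt_or_ge i (T.len q) with h6 | h6
      · rw [T.anc_par q h6]; exact h5 i hi
      · rwa [T.anc_of_le _ h6]
variable (T)

abbrev ND : Type := T.N × Option (Set T.N) × Option (T.N ⊕ Set T.N)

def G2 (p : T.N) (Sg : Set T.N) (d : T.N ⊕ Set T.N) : Prop :=
  (∃ u, d = Sum.inl u ∧ u ∈ Sg ∧ u ∈ O ∧ K + 2 ≤ T.len u ∧ T.anc u (T.len p) = T.anc p (T.len u)) ∨
  (∃ Sg', d = Sum.inr Sg' ∧ QII T O (T.anc p (K+2)) Sg Sg' ∧ p ∈ Sg')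

def Good (z : ND T) : Prop :=
  (T.len z.1 ≤ K ∧ z.2.1 = none ∧ z.2.2 = none) ∨
  (T.len z.1 = K + 1 ∧ z.2.2 = none ∧ ∃ Sg, z.2.1 = some Sg ∧ QI T z.1 Sg) ∨
  (K + 2 ≤ T.len z.1 ∧ ∃ Sg d, z.2.1 = some Sg ∧ z.2.2 = some d ∧ QI T (T.anc z.1 (K+1)) Sg ∧
    G2 T O K z.1 Sg d)

variable {T O K}
lemma Good.lo {z : ND T} (h : Good T O K z) (hl : T.len z.1 ≤ K) : z.2.1 = none ∧ z.2.2 = none := by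
  rcases h with h | h | h
  · exact h.2
  · omega
  · omega
lemma Good.mid {z : ND T} (h : Good T O K z) (hl : T.len z.1 = K + 1) :
    z.2.2 = none ∧ ∃ Sg, z.2.1 = some Sg ∧ QI T z.1 Sg := by
  rcases h with h | h | h
  · omega
  · exact h.2
  · omega
lemma Good.hi {z : ND T} (h : Good T O K z) (hl : K + 2 ≤ T.len z.1) :
    ∃ Sg d, z.2.1 = some Sg ∧ z.2.2 = some d ∧ QI T (T.anc z.1 (K+1)) Sg ∧
    G2 T O K z.1 Sg d := by
  rcases h with h | h | h
  · omega
  · omega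
  · exact h.2

lemma cmp_par {u p : T.N} (hp : 0 < T.len p) (h : T.anc u (T.len p) = T.anc p (T.len u)) :
    T.anc u (T.len (T.par p)) = T.anc (T.par p) (T.len u) := by
  obtain ⟨m, hm⟩ : ∃ m, T.len p = m + 1 := ⟨T.len p - 1, by omega⟩
  have h1 := T.len_par p m hm
  rcases Nat.lt_or_ge (T.len u) (T.len p) with h2 | h2
  · rw [T.anc_of_le u (by omega)] at h ⊢
    rw [h, T.anc_par p h2]
    have h3 : T.len (T.anc (T.par p) (T.len u)) = T.len u := T.len_anc _ (by omega)
    rw [h3]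
  · rw [T.anc_of_le p h2] at h
    rw [T.anc_of_le (T.par p) (by omega), h1]
    rw [← T.anc_anc u (i := m) (j := T.len p) (by omega) h2, h, T.anc_par p (by omega),
      T.anc_of_le _ (by omega)]

lemma good_par {z : ND T} (h : Good T O K z) : Good T O K
    (T.par z.1, if T.len z.1 ≤ K + 1 then none else z.2.1,
      if T.len z.1 ≤ K + 2 then none else z.2.2) := by
  obtain ⟨p, s, d⟩ := z
  dsimp only at *
  rcases Nat.eq_zero_or_pos (T.len p) with h0 | h0
  · have := T.root_uniq p h0
    subst this
    left
    simp [T.par_root, h0]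
  obtain ⟨m, hm⟩ : ∃ m, T.len p = m + 1 := ⟨T.len p - 1, by omega⟩
  have h1 := T.len_par p m hm
  rcases Nat.lt_or_ge (T.len p) (K+2) with h2 | h2
  · left
    dsimp only
    rw [if_pos (by omega), if_pos (by omega)]
    exact ⟨by omega, rfl, rfl⟩
  obtain ⟨Sg, δ, e1, e2, hQ, hG⟩ := h.hi h2
  dsimp only at *
  subst e1 e2
  rcases Nat.eq_or_lt_of_le h2 with h3 | h3
  · right; left
    dsimp only
    rw [if_neg (show ¬ T.len p ≤ K + 1 by omega), if_pos (show T.len p ≤ K + 2 by omega)]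
    have h4 : T.anc p (K+1) = T.par p := by
      rw [T.anc_par p (by omega), T.anc_of_le _ (by omega)]
    exact ⟨by omega, rfl, Sg, rfl, by rwa [h4] at hQ⟩
  · right; right
    dsimp only
    rw [if_neg (by omega), if_neg (by omega)]
    have h4 : T.anc (T.par p) (K+1) = T.anc p (K+1) := (T.anc_par p (by omega)).symm
    have h5 : T.anc (T.par p) (K+2) = T.anc p (K+2) := (T.anc_par p (by omega)).symm
    refine ⟨by omega, Sg, δ, rfl, rfl, by rwa [h4], ?_⟩
    rcases hG with ⟨u, g1, g2, g3, g4, g5⟩ | ⟨Sg', g1, g2, g3⟩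
    · exact Or.inl ⟨u, g1, g2, g3, g4, cmp_par h0 g5⟩
    · refine Or.inr ⟨Sg', g1, by rwa [h5], ?_⟩
      rcases g2.2.2.1 p g3 with g4 | g4
      · have := congrArg T.len g4
        rw [T.len_anc p (by omega)] at this
        omega
      · exact g4.2

lemma cmp_child {u p : T.N} (h : T.anc u (T.len p) = T.anc p (T.len u)) :
    ∃ c, T.IsChild c p ∧ T.anc u (T.len c) = T.anc c (T.len u) := by
  rcases Nat.lt_or_ge (T.len p) (T.len u) with h2 | h2
  · refine ⟨T.anc u (T.len p + 1), ⟨by rw [T.len_anc _ (by omega)], ?_⟩, ?_⟩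
    · have h3 := T.len_anc u (i := T.len p + 1) (by omega)
      have h4 := T.len_par _ _ h3
      have h5 := T.anc_par (T.anc u (T.len p + 1)) (i := T.len p) (by omega)
      rw [T.anc_anc u (by omega) (by omega), T.anc_of_le (T.par _) (by omega)] at h5
      rw [← h5, h, T.anc_of_le _ (by omega)]
    · rw [T.len_anc _ (by omega), T.anc_of_le (T.anc u _) (by rw [T.len_anc _ (by omega)]; omega)]
  · have h3 := T.dflt_spec p
    refine ⟨T.dflt p, h3, ?_⟩
    rw [T.anc_child h3 (by omega), ← h, T.anc_of_le u (i := T.len p) (by omega),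
      T.anc_of_le u (by rw [h3.1]; omega)]

lemma qi_odd_anc {p1 : T.N} {Sg : Set T.N} (h : QI T p1 Sg) {q : T.N} (hq : q ∈ Sg) :
    T.anc q (T.len p1) = p1 ∧ ∀ i, T.len p1 ≤ i → T.anc q i ∈ Sg :=
  (tree_anc h.2.1 _ q hq rfl).2

/-- every good node has a good child -/
lemma good_child (hK : K % 2 = 0) {z : ND T} (h : Good T O K z) : ∃ c s d, Good T O K (c, s, d) ∧
    T.IsChild c z.1 ∧ (if T.len c ≤ K + 1 then none else s) = z.2.1 ∧
      (if T.len c ≤ K + 2 then none else d) = z.2.2 := by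
  obtain ⟨p, s, d⟩ := z
  dsimp only at *
  rcases Nat.lt_or_ge (T.len p) K with h1 | h1
  · obtain ⟨c, hc⟩ := T.child p
    obtain ⟨h2, h3⟩ := h.lo (by dsimp only; omega)
    dsimp only at h2 h3
    refine ⟨c, none, none, Or.inl ⟨by dsimp only; omega, rfl, rfl⟩, hc, ?_, ?_⟩
    · rw [h2]; simp
    · rw [h3]; simp
  rcases Nat.lt_or_ge (T.len p) (K+1) with h1' | h1'
  · obtain ⟨c, hc⟩ := T.child p
    obtain ⟨h2, h3⟩ := h.lo (by dsimp only; omega)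
    dsimp only at h2 h3
    have hlc : T.len c = K + 1 := by have := hc.1; omega
    refine ⟨c, some {q | K + 1 ≤ T.len q ∧ T.anc q (K+1) = c}, none,
      Or.inr (Or.inl ⟨hlc, rfl, _, rfl, ?_⟩), hc, ?_, ?_⟩
    · refine ⟨⟨hlc.ge, T.anc_of_le _ hlc.le⟩, ?_, ?_, ?_⟩
      · rintro q ⟨g2, g3⟩
        dsimp only
        rcases Nat.eq_or_lt_of_le g2 with g4 | g4
        · left; rw [← g3, T.anc_of_le _ g4.symm.le]
        · right
          refine ⟨by omega, ?_⟩
          obtain ⟨m, hm⟩ : ∃ m, T.len q = m + 1 := ⟨T.len q - 1, by omega⟩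
          exact ⟨by rw [T.len_par q m hm]; omega, by rw [← T.anc_par q (by omega), g3]⟩
      · rintro q ⟨g2, g3⟩ _ c' hc'
        exact ⟨by rw [hc'.1]; omega, by rw [T.anc_child hc' (by omega), g3]⟩
      · rintro q ⟨g2, g3⟩ _
        obtain ⟨c', hc'⟩ := T.child q
        exact ⟨c', hc', by rw [hc'.1]; omega, by rw [T.anc_child hc' (by omega), g3]⟩
    · rw [h2, if_pos (by omega)]
    · rw [h3]; simp
  rcases Nat.lt_or_ge (T.len p) (K+2) with h2' | h2'
  · obtain ⟨h2, Sg, h3, hQ⟩ := h.mid (by dsimp only; omega)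
    dsimp only at h2 h3 hQ
    have hlp : T.len p = K + 1 := by omega
    by_cases hU : ∃ u ∈ Sg, u ∈ O ∧ K + 2 ≤ T.len u
    · obtain ⟨u, hu1, hu2, hu3⟩ := hU
      have ha := qi_odd_anc hQ hu1
      have hcmp : T.anc u (T.len p) = T.anc p (T.len u) := by
        rw [ha.1, T.anc_of_le _ (by omega)]
      obtain ⟨c, hc, hc2⟩ := cmp_child hcmp
      have hlc : T.len c = K + 2 := by have := hc.1; omega
      refine ⟨c, some Sg, some (Sum.inl u), Or.inr (Or.inr ⟨hlc.ge, Sg, _, rfl, rfl, ?_,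
        Or.inl ⟨u, rfl, hu1, hu2, hu3, hc2⟩⟩), hc, ?_, ?_⟩
      · dsimp only
        rwa [T.anc_child hc (by omega), T.anc_of_le _ (by omega)]
      · rw [h3, if_neg (by omega)]
      · rw [h2, if_pos (by omega)]
    · push Not at hU
      obtain ⟨c, hc⟩ := T.child p
      have hlc : T.len c = K + 2 := by have := hc.1; omega
      have hcS : c ∈ Sg := hQ.2.2.1 p hQ.1 (by omega) c hc
      refine ⟨c, some Sg, some (Sum.inr {q | q ∈ Sg ∧ K + 2 ≤ T.len q ∧ T.anc q (K+2) = c}),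
        Or.inr (Or.inr ⟨hlc.ge, Sg, _, rfl, rfl, ?_,
        Or.inr ⟨_, rfl, ?_, ⟨hcS, hlc.ge, T.anc_of_le _ hlc.le⟩⟩⟩), hc, ?_, ?_⟩
      · dsimp only
        rwa [T.anc_child hc (by omega), T.anc_of_le _ (by omega)]
      · dsimp only
        rw [T.anc_of_le _ hlc.le]
        refine ⟨⟨hcS, hlc.ge, T.anc_of_le _ hlc.le⟩, fun q hq => hq.1, ?_, ?_, ?_, ?_⟩
        · rintro q ⟨g1, g2, g3⟩
          rcases Nat.eq_or_lt_of_le g2 with g4 | g4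
          · left; rw [← g3, T.anc_of_le _ g4.symm.le]
          · right
            refine ⟨by omega, ?_⟩
            obtain ⟨m, hm⟩ : ∃ m, T.len q = m + 1 := ⟨T.len q - 1, by omega⟩
            refine ⟨?_, by rw [T.len_par q m hm]; omega, by rw [← T.anc_par q (by omega), g3]⟩
            rcases hQ.2.1 q g1 with g5 | g5
            · rw [g5] at g4; omega
            · exact g5.2
        · rintro q ⟨g1, g2, g3⟩ _ c' hc' hc''
          exact ⟨hc'', by rw [hc'.1]; omega, by rw [T.anc_child hc' (by omega), g3]⟩
        · rintro q ⟨g1, g2, g3⟩ ho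
          obtain ⟨c', hc'⟩ := T.child q
          exact ⟨c', hc', hQ.2.2.1 q g1 ho c' hc', by rw [hc'.1]; omega,
            by rw [T.anc_child hc' (by omega), g3]⟩
        · rintro q ⟨g1, g2, g3⟩ g4
          have := hU q g1 g4
          omega
      · rw [h3, if_neg (by omega)]
      · rw [h2, if_pos (by omega)]
  · obtain ⟨Sg, δ, e1, e2, hQ, hG⟩ := h.hi (by dsimp only; omega)
    dsimp only at e1 e2 hQ hG
    rcases hG with ⟨u, g1, g2, g3, g4, g5⟩ | ⟨Sg', g1, g2, g3⟩
    · obtain ⟨c, hc, hc2⟩ := cmp_child g5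
      have hlc := hc.1
      refine ⟨c, some Sg, some δ, Or.inr (Or.inr ⟨by dsimp only; omega, Sg, δ, rfl, rfl, ?_,
        Or.inl ⟨u, g1, g2, g3, g4, hc2⟩⟩), hc, ?_, ?_⟩
      · dsimp only
        rwa [T.anc_child hc (by omega)]
      · rw [e1, if_neg (by omega)]
      · rw [e2, if_neg (by omega)]
    · obtain ⟨c, hc, hc2⟩ : ∃ c, T.IsChild c p ∧ c ∈ Sg' := by
        rcases Nat.mod_two_eq_zero_or_one (T.len p) with hp | hp
        · obtain ⟨c, hc, hc2⟩ := hQ.2.2.2 p (g2.2.1 g3) hp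
          exact ⟨c, hc, g2.2.2.2.1 p g3 hp c hc hc2⟩
        · exact g2.2.2.2.2.1 p g3 hp
      have hlc := hc.1
      refine ⟨c, some Sg, some δ, Or.inr (Or.inr ⟨by dsimp only; omega, Sg, δ, rfl, rfl, ?_,
        Or.inr ⟨Sg', g1, ?_, hc2⟩⟩), hc, ?_, ?_⟩
      · dsimp only
        rwa [T.anc_child hc (by omega)]
      · dsimp only
        rwa [T.anc_child hc (by omega)]
      · rw [e1, if_neg (by omega)]
      · rw [e2, if_neg (by omega)]

variable (T O K)
def US (hK : K % 2 = 0) : GT where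
  N := {z : ND T // Good T O K z}
  len z := T.len z.1.1
  par z := ⟨_, good_par z.2⟩
  root := ⟨(T.root, none, none), Or.inl ⟨by simp [T.len_root], rfl, rfl⟩⟩
  len_root := T.len_root
  par_root := by
    apply Subtype.ext
    simp [T.par_root]
  root_uniq z hz := by
    obtain ⟨h1, h2⟩ := z.2.lo (by omega)
    apply Subtype.ext
    refine Prod.ext (T.root_uniq _ hz) (Prod.ext h1 h2)
  len_par z n h := T.len_par _ n h
  child z := by
    obtain ⟨c, s, d, h1, h2, h3, h4⟩ := good_child hK z.2
    exact ⟨⟨(c, s, d), h1⟩, h2.1, Subtype.ext (Prod.ext h2.2 (Prod.ext h3 h4))⟩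

end unr
end BD

namespace BD

section unr2
variable (T : GT) (O : Set T.N) (K : ℕ) (hK : K % 2 = 0)

lemma us_hom : IsHom (US T O K hK) T (fun z => z.1.1) := ⟨fun _ => rfl, fun _ => rfl⟩

open Classical in
noncomputable def ans (s : (US T O K hK).Strat) (q : T.N) (a : Option (Set T.N))
    (d : Option (T.N ⊕ Set T.N)) : T.N :=
  if h : Good T O K (q, a, d) then (s.1 ⟨(q, a, d), h⟩).1.1 else T.dflt q

lemma ans_child (s : (US T O K hK).Strat) (q : T.N) (a : Option (Set T.N))
    (d : Option (T.N ⊕ Set T.N)) : T.IsChild (ans T O K hK s q a d) q := by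
  unfold ans
  split_ifs with h
  · have := s.2 ⟨(q, a, d), h⟩
    exact ⟨this.1, congrArg (fun z => z.1.1) this.2⟩
  · exact T.dflt_spec q

lemma ans_pos (s : (US T O K hK).Strat) (z : (US T O K hK).N) :
    ans T O K hK s z.1.1 z.1.2.1 z.1.2.2 = (s.1 z).1.1 := by
  unfold ans
  rw [dif_pos z.2]
  rfl

open Classical in
noncomputable def fst' (b : ℕ) (Sg O' : Set T.N) (q : T.N) : T.Strat :=
  if h : T.Force b Sg O' q then (T.force_strat b Sg O' q h).choose else ⟨T.dflt, T.dflt_spec⟩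

lemma fst_spec (b : ℕ) (Sg O' : Set T.N) (q : T.N) (h : T.Force b Sg O' q) : ∀ x, T.IsPlay x →
    x (T.len q) = q →
      (∀ m, T.len q ≤ m → m % 2 = b → (∀ j, T.len q ≤ j → j ≤ m → x j ∉ O') →
        x (m+1) = (fst' T b Sg O' q).1 (x m)) →
      ∃ m, T.len q ≤ m ∧ x m ∈ O' ∧ ∀ n, T.len q ≤ n → n ≤ m → x n ∈ Sg := by
  have : fst' T b Sg O' q = (T.force_strat b Sg O' q h).choose := dif_pos h
  rw [this]
  exact (T.force_strat b Sg O' q h).choose_spec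

open Classical in
/-- Sigma from the answer at a node of length K -/
noncomputable def sgOf (s : (US T O K hK).Strat) (p : T.N) : Set T.N :=
  if h : Good T O K (p, none, none) then ((s.1 ⟨(p, none, none), h⟩).1.2.1).getD ∅ else ∅

def S2 (Sg : Set T.N) (p2 : T.N) : Set T.N :=
  {r | r ∈ Sg ∧ K + 2 ≤ T.len r ∧ T.anc r (K+2) = p2 ∧
    ∀ i, K + 2 ≤ i → i ≤ T.len r → ¬ T.Force 0 Sg O (T.anc r i)}

open Classical in
noncomputable def phi1aux (A : Option (Set T.N) → Option (T.N ⊕ Set T.N) → T.N) (Sg : Set T.N)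
    (q : T.N) : T.N :=
  if h : ∃ i, K + 2 ≤ i ∧ i ≤ T.len q ∧ T.anc q i ∈ O then
    A (some Sg) (some (Sum.inl (T.anc q (Nat.find h))))
  else if h : ∃ i, K + 2 ≤ i ∧ i ≤ T.len q ∧ T.Force 0 Sg O (T.anc q i) then
    (fst' T 0 Sg O (T.anc q (Nat.find h))).1 q
  else A (some Sg) (some (Sum.inr (S2 T O K Sg (T.anc q (K+2)))))

open Classical in
noncomputable def phi1 (s : (US T O K hK).Strat) (q : T.N) : T.N :=
  if T.len q ≤ K then ans T O K hK s q none none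
  else phi1aux T O K (ans T O K hK s q) (sgOf T O K hK s (T.anc q K)) q

lemma phi1_child (s : (US T O K hK).Strat) (q : T.N) : T.IsChild (phi1 T O K hK s q) q := by
  unfold phi1 phi1aux
  split_ifs
  · exact ans_child _ _ _ _ _ _ _ _
  · exact ans_child _ _ _ _ _ _ _ _
  · exact (fst' _ _ _ _ _).2 q
  · exact ans_child _ _ _ _ _ _ _ _

lemma ans_loc (s s' : (US T O K hK).Strat) (b n : ℕ)
    (h : ∀ p, (US T O K hK).len p < n → (US T O K hK).len p % 2 = b → s.1 p = s'.1 p)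
    (q : T.N) (hq : T.len q < n) (hb : T.len q % 2 = b) (a d) :
    ans T O K hK s q a d = ans T O K hK s' q a d := by
  unfold ans
  split_ifs with h1
  · rw [h ⟨(q, a, d), h1⟩ hq hb]
  · rfl

lemma phi1_loc (s s' : (US T O K hK).Strat) (n : ℕ)
    (h : ∀ p, (US T O K hK).len p < n → (US T O K hK).len p % 2 = 0 → s.1 p = s'.1 p)
    (q : T.N) (hq : T.len q < n) (hb : T.len q % 2 = 0) :
    phi1 T O K hK s q = phi1 T O K hK s' q := by
  have h1 := ans_loc T O K hK s s' 0 n h q hq hb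
  by_cases hl : T.len q ≤ K
  · unfold phi1; rw [if_pos hl, if_pos hl, h1]
  · have h2 : sgOf T O K hK s (T.anc q K) = sgOf T O K hK s' (T.anc q K) := by
      have h3 : T.len (T.anc q K) = K := T.len_anc q (by omega)
      unfold sgOf
      split_ifs with h4
      · rw [h ⟨_, h4⟩ (by show T.len (T.anc q K) < n; omega)
          (by show T.len (T.anc q K) % 2 = 0; omega)]
      · rfl
    unfold phi1
    have h1' : ans T O K hK s q = ans T O K hK s' q := by funext a d; exact h1 a d
    rw [if_neg hl, if_neg hl, h2, h1']

open Classical in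
noncomputable def ddOf (s : (US T O K hK).Strat) (p : T.N) (Sg : Set T.N) :
    Option (T.N ⊕ Set T.N) :=
  if h : Good T O K (p, some Sg, none) then (s.1 ⟨(p, some Sg, none), h⟩).1.2.2 else none

def UU (D : Set T.N → Option (T.N ⊕ Set T.N)) : Set T.N :=
  {u | K + 2 ≤ T.len u ∧ ∃ Sg, D Sg = some (Sum.inl u)}

def S1 (U : Set T.N) (p1 : T.N) : Set T.N :=
  {r | K + 1 ≤ T.len r ∧ T.anc r (K+1) = p1 ∧
    ∀ i, K + 1 ≤ i → i ≤ T.len r → ¬ T.Force 1 univ U (T.anc r i)}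

open Classical in
noncomputable def phi2aux (A : Option (Set T.N) → Option (T.N ⊕ Set T.N) → T.N) (D : Set T.N → Option (T.N ⊕ Set T.N))
    (q : T.N) : T.N :=
  if h : ∃ i, K + 2 ≤ i ∧ i ≤ T.len q ∧ T.anc q i ∈ UU T K D then
    A (some (Classical.epsilon (fun Sg => D Sg = some (Sum.inl (T.anc q (Nat.find h))))))
      (some (Sum.inl (T.anc q (Nat.find h))))
  else if h : ∃ i, K + 1 ≤ i ∧ i ≤ T.len q ∧ T.Force 1 univ (UU T K D) (T.anc q i) then
    (fst' T 1 univ (UU T K D) (T.anc q (Nat.find h))).1 q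
  else A (some (S1 T K (UU T K D) (T.anc q (K+1))))
    (if T.len q = K + 1 then none else D (S1 T K (UU T K D) (T.anc q (K+1))))

open Classical in
noncomputable def phi2 (s : (US T O K hK).Strat) (q : T.N) : T.N :=
  if T.len q ≤ K then ans T O K hK s q none none
  else phi2aux T K (ans T O K hK s q) (ddOf T O K hK s (T.anc q (K+1))) q

lemma phi2_child (s : (US T O K hK).Strat) (q : T.N) : T.IsChild (phi2 T O K hK s q) q := by
  unfold phi2 phi2aux
  split_ifs
  · exact ans_child _ _ _ _ _ _ _ _
  · exact ans_child _ _ _ _ _ _ _ _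
  · exact (fst' _ _ _ _ _).2 q
  · exact ans_child _ _ _ _ _ _ _ _
  · exact ans_child _ _ _ _ _ _ _ _

lemma phi2_loc (s s' : (US T O K hK).Strat) (n : ℕ)
    (h : ∀ p, (US T O K hK).len p < n → (US T O K hK).len p % 2 = 1 → s.1 p = s'.1 p)
    (q : T.N) (hq : T.len q < n) (hb : T.len q % 2 = 1) :
    phi2 T O K hK s q = phi2 T O K hK s' q := by
  have h1 := ans_loc T O K hK s s' 1 n h q hq hb
  by_cases hl : T.len q ≤ K
  · unfold phi2; rw [if_pos hl, if_pos hl, h1]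
  · have h2 : ddOf T O K hK s (T.anc q (K+1)) = ddOf T O K hK s' (T.anc q (K+1)) := by
      have h3 : T.len (T.anc q (K+1)) = K+1 := T.len_anc q (by omega)
      funext Sg
      unfold ddOf
      split_ifs with h4
      · rw [h ⟨_, h4⟩ (by show T.len (T.anc q (K+1)) < n; omega)
          (by show T.len (T.anc q (K+1)) % 2 = 1; omega)]
      · rfl
    unfold phi2
    have h1' : ans T O K hK s q = ans T O K hK s' q := by funext a d; exact h1 a d
    rw [if_neg hl, if_neg hl, h2, h1']

lemma lift_play (x : ℕ → T.N) (hx : T.IsPlay x) (Sg : Set T.N) (d : T.N ⊕ Set T.N)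
    (hQ : QI T (x (K+1)) Sg) (hG : ∀ n, K + 2 ≤ n → G2 T O K (x n) Sg d) :
    ∃ y : ℕ → (US T O K hK).N, (US T O K hK).IsPlay y ∧ ∀ n, (y n).1 = (x n,
      if n ≤ K then none else some Sg, if n ≤ K + 1 then none else some d) := by
  have hgood : ∀ n, Good T O K (x n, if n ≤ K then none else some Sg,
      if n ≤ K + 1 then none else some d) := by
    intro n
    rcases Nat.lt_or_ge K n with h | h
    · rcases Nat.lt_or_ge (K+1) n with h' | h'
      · right; right
        refine ⟨by dsimp only; rw [hx.len]; omega, Sg, d, if_neg (by omega), if_neg (by omega), ?_,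
          hG n h'⟩
        dsimp only
        rwa [hx.anc (by omega)]
      · right; left
        have : n = K + 1 := by omega
        subst this
        exact ⟨hx.len _, if_pos (by omega), Sg, if_neg (by omega), hQ⟩
    · left; exact ⟨by dsimp only; rw [hx.len]; exact h, if_pos h, if_pos (by omega)⟩
  refine ⟨fun n => ⟨_, hgood n⟩, fun n => ⟨hx.len n, Subtype.ext ?_⟩, fun n => rfl⟩
  show (T.par (x (n+1)), if T.len (x (n+1)) ≤ K + 1 then none else
    (if n + 1 ≤ K then none else some Sg), if T.len (x (n+1)) ≤ K + 2 then none else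
    (if n + 1 ≤ K + 1 then none else some d)) = _
  rw [hx.len, hx.par]
  refine Prod.ext rfl (Prod.ext ?_ ?_)
  · dsimp only
    split_ifs <;> first | rfl | omega
  · dsimp only
    split_ifs <;> first | rfl | omega

/-- consistency at stage n for a lifted play -/
lemma lift_cons (x : ℕ → T.N) (hx : T.IsPlay x) (Sg : Set T.N) (d : T.N ⊕ Set T.N)
    (y : ℕ → (US T O K hK).N) (hy : (US T O K hK).IsPlay y) (hyx : ∀ n, (y n).1 = (x n,
      if n ≤ K then none else some Sg, if n ≤ K + 1 then none else some d))
    (s : (US T O K hK).Strat) (n : ℕ) (h1 : x (n+1) = (s.1 (y n)).1.1)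
    (hs : n = K → (s.1 (y n)).1.2.1 = some Sg) (hd : n = K + 1 → (s.1 (y n)).1.2.2 = some d) :
    y (n+1) = s.1 (y n) := by
  have hc := s.2 (y n)
  have hg := (s.1 (y n)).2
  have hl : T.len (s.1 (y n)).1.1 = n + 1 := by rw [← h1, hx.len]
  have hp := congrArg Subtype.val hc.2
  have hp' : (T.par (s.1 (y n)).1.1, if T.len (s.1 (y n)).1.1 ≤ K + 1 then none else
    (s.1 (y n)).1.2.1, if T.len (s.1 (y n)).1.1 ≤ K + 2 then none else
    (s.1 (y n)).1.2.2) = (y n).1 := hp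
  rw [hl, hyx n] at hp'
  have hp1 := congrArg (fun z => z.2.1) hp'
  have hp2 := congrArg (fun z => z.2.2) hp'
  dsimp only at hp1 hp2
  apply Subtype.ext
  rw [hyx (n+1)]
  refine Prod.ext h1 (Prod.ext ?_ ?_)
  · dsimp only
    by_cases hn : n + 1 ≤ K
    · rw [if_pos hn]; exact (hg.lo (by omega)).1.symm
    · rw [if_neg hn]
      by_cases hn' : n = K
      · exact (hs hn').symm
      · rw [if_neg (by omega), if_neg (by omega)] at hp1; exact hp1.symm
  · dsimp only
    by_cases hn : n + 1 ≤ K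
    · rw [if_pos (by omega)]; exact (hg.lo (by omega)).2.symm
    · by_cases hn' : n = K
      · rw [if_pos (by omega)]; exact (hg.mid (by omega)).1.symm
      · rw [if_neg (by omega)]
        by_cases hn2 : n = K + 1
        · exact (hd hn2).symm
        · rw [if_neg (by omega), if_neg (by omega)] at hp2; exact hp2.symm

/-- below u the move is forced -/
lemma forced (x : ℕ → T.N) (hx : T.IsPlay x) (n : ℕ) (z : (US T O K hK).N) (u : T.N)
    (hz : z.1.2.2 = some (Sum.inl u)) (hl : T.len z.1.1 = n + 1) (hn : K + 2 ≤ n + 1)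
    (hu : x (T.len u) = u) (hnu : n + 1 ≤ T.len u) : x (n+1) = z.1.1 := by
  obtain ⟨Sg, d, e1, e2, hQ, hG⟩ := z.2.hi (by omega)
  rw [hz] at e2
  have e2 := Option.some.inj e2
  rcases hG with ⟨v, g1, g2, g3, g4, g5⟩ | ⟨Sg', g1, g2, g3⟩
  · rw [← e2] at g1
    have := Sum.inl.inj g1
    subst this
    rw [hl, T.anc_of_le z.1.1 (by omega)] at g5
    rw [← g5]
    conv_rhs => rw [← hu]
    rw [hx.anc hnu]
  · rw [← e2] at g1; cases g1

end unr2
end BD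

namespace BD

section unr3
variable (T : GT) (O : Set T.N) (K : ℕ) (hK : K % 2 = 0)

lemma least_above {P : ℕ → Prop} {a : ℕ} (h : ∃ i, a ≤ i ∧ P i) :
    ∃ i, a ≤ i ∧ P i ∧ ∀ j, a ≤ j → j < i → ¬ P j := by
  classical
  exact ⟨Nat.find h, (Nat.find_spec h).1, (Nat.find_spec h).2,
    fun j h1 h2 h3 => Nat.find_min h h2 ⟨h1, h3⟩⟩

lemma phi1_b1 (A) (Sg : Set T.N) (x) (hx : T.IsPlay x) (n i : ℕ) (hi : K + 2 ≤ i) (hin : i ≤ n)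
    (hO : x i ∈ O) (hm : ∀ j, K + 2 ≤ j → j < i → x j ∉ O) :
    phi1aux T O K A Sg (x n) = A (some Sg) (some (Sum.inl (x i))) := by
  classical
  have h : ∃ i, K + 2 ≤ i ∧ i ≤ T.len (x n) ∧ T.anc (x n) i ∈ O :=
    ⟨i, hi, by rwa [hx.len], by rwa [hx.anc hin]⟩
  unfold phi1aux
  rw [dif_pos h]
  have : Nat.find h = i := by
    rw [Nat.find_eq_iff]
    refine ⟨⟨hi, by rwa [hx.len], by rwa [hx.anc hin]⟩, ?_⟩
    rintro j hj ⟨h1, h2, h3⟩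
    rw [hx.anc (by omega)] at h3
    exact hm j h1 hj h3
  rw [this, hx.anc hin]

lemma phi1_b2 (A) (Sg : Set T.N) (x) (hx : T.IsPlay x) (n i : ℕ) (hi : K + 2 ≤ i) (hin : i ≤ n)
    (hno : ∀ j, K + 2 ≤ j → j ≤ n → x j ∉ O)
    (hO : T.Force 0 Sg O (x i)) (hm : ∀ j, K + 2 ≤ j → j < i → ¬ T.Force 0 Sg O (x j)) :
    phi1aux T O K A Sg (x n) = (fst' T 0 Sg O (x i)).1 (x n) := by
  have h0 : ¬ ∃ i, K + 2 ≤ i ∧ i ≤ T.len (x n) ∧ T.anc (x n) i ∈ O := by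
    rintro ⟨j, h1, h2, h3⟩
    rw [hx.len] at h2
    rw [hx.anc h2] at h3
    exact hno j h1 h2 h3
  classical
  have h : ∃ i, K + 2 ≤ i ∧ i ≤ T.len (x n) ∧ T.Force 0 Sg O (T.anc (x n) i) :=
    ⟨i, hi, by rwa [hx.len], by rwa [hx.anc hin]⟩
  unfold phi1aux
  rw [dif_neg h0, dif_pos h]
  have : Nat.find h = i := by
    rw [Nat.find_eq_iff]
    refine ⟨⟨hi, by rwa [hx.len], by rwa [hx.anc hin]⟩, ?_⟩
    rintro j hj ⟨h1, h2, h3⟩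
    rw [hx.anc (by omega)] at h3
    exact hm j h1 hj h3
  rw [this, hx.anc hin]

lemma phi1_b3 (A) (Sg : Set T.N) (x) (hx : T.IsPlay x) (n : ℕ) (hn : K + 2 ≤ n)
    (hno : ∀ j, K + 2 ≤ j → j ≤ n → x j ∉ O)
    (hm : ∀ j, K + 2 ≤ j → j ≤ n → ¬ T.Force 0 Sg O (x j)) :
    phi1aux T O K A Sg (x n) = A (some Sg) (some (Sum.inr (S2 T O K Sg (x (K+2))))) := by
  have h0 : ¬ ∃ i, K + 2 ≤ i ∧ i ≤ T.len (x n) ∧ T.anc (x n) i ∈ O := by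
    rintro ⟨j, h1, h2, h3⟩
    rw [hx.len] at h2
    rw [hx.anc h2] at h3
    exact hno j h1 h2 h3
  have h : ¬ ∃ i, K + 2 ≤ i ∧ i ≤ T.len (x n) ∧ T.Force 0 Sg O (T.anc (x n) i) := by
    rintro ⟨j, h1, h2, h3⟩
    rw [hx.len] at h2
    rw [hx.anc h2] at h3
    exact hm j h1 h2 h3
  unfold phi1aux
  rw [dif_neg h0, dif_neg h, hx.anc hn]

lemma S2_QII (Sg : Set T.N) (p1 p2 : T.N) (hQ : QI T p1 Sg) (hl1 : T.len p1 = K + 1)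
    (hl2 : T.len p2 = K + 2) (hp2 : p2 ∈ Sg)
    (hf : ¬ T.Force 0 Sg O p2) : QII T O p2 Sg (S2 T O K Sg p2) := by
  refine ⟨⟨hp2, hl2.ge, T.anc_of_le _ hl2.le, ?_⟩, fun q hq => hq.1, ?_, ?_, ?_, ?_⟩
  · intro i h1 h2
    rwa [T.anc_of_le _ (by omega)]
  · rintro q ⟨g1, g2, g3, g6⟩
    rcases Nat.eq_or_lt_of_le g2 with g4 | g4
    · left; rw [← g3, T.anc_of_le _ g4.symm.le]
    · right
      refine ⟨by omega, ?_⟩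
      obtain ⟨m, hm⟩ : ∃ m, T.len q = m + 1 := ⟨T.len q - 1, by omega⟩
      have hlp := T.len_par q m hm
      refine ⟨?_, by omega, by rw [← T.anc_par q (by omega), g3], ?_⟩
      · rcases hQ.2.1 q g1 with g5 | g5
        · rw [g5] at g4; omega
        · exact g5.2
      · intro i h1 h2
        rw [← T.anc_par q (by omega)]
        exact g6 i h1 (by omega)
  · rintro q ⟨g1, g2, g3, g6⟩ he c' hc' hc''
    refine ⟨hc'', by rw [hc'.1]; omega, by rw [T.anc_child hc' (by omega), g3], ?_⟩
    intro i h1 h2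
    rcases Nat.lt_or_ge (T.len q) i with h3 | h3
    · rw [T.anc_of_le c' (by have := hc'.1; omega)]
      intro hcon
      apply g6 (T.len q) g2 le_rfl
      rw [T.anc_self]
      exact GT.Force.mine q c' g1 he hc' hcon
    · rw [T.anc_child hc' h3]; exact g6 i h1 h3
  · rintro q ⟨g1, g2, g3, g6⟩ ho
    obtain ⟨c', hc', hcf⟩ : ∃ c, T.IsChild c q ∧ ¬ T.Force 0 Sg O c := by
      by_contra hcon
      push Not at hcon
      apply g6 (T.len q) g2 le_rfl
      rw [T.anc_self]
      exact GT.Force.theirs q g1 (by omega) hcon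
    refine ⟨c', hc', hQ.2.2.1 q g1 ho c' hc', by rw [hc'.1]; omega,
      by rw [T.anc_child hc' (by omega), g3], ?_⟩
    intro i h1 h2
    rcases Nat.lt_or_ge (T.len q) i with h3 | h3
    · rwa [T.anc_of_le c' (by have := hc'.1; omega)]
    · rw [T.anc_child hc' h3]; exact g6 i h1 h3
  · rintro q ⟨g1, g2, g3, g6⟩ hO
    apply g6 (T.len q) g2 le_rfl
    rw [T.anc_self]
    exact GT.Force.base q g1 hO

lemma lift1 (s : (US T O K hK).Strat) (x : ℕ → T.N) (hx : T.IsPlay x)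
    (hc : ∀ n, n % 2 = 0 → x (n+1) = phi1 T O K hK s (x n)) :
    ∃ y, (US T O K hK).IsPlay y ∧ (US T O K hK).Cons 0 s y ∧ ∀ n, (y n).1.1 = x n := by
  have hg0 : ∀ n, n ≤ K → Good T O K (x n, none, none) :=
    fun n hn => Or.inl ⟨by dsimp only; rwa [hx.len], rfl, rfl⟩
  have hlow : ∀ n (hn : n ≤ K), n % 2 = 0 → x (n+1) = (s.1 ⟨_, hg0 n hn⟩).1.1 := by
    intro n hn hn2
    rw [hc n hn2]; unfold phi1
    rw [if_pos (by rwa [hx.len])]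
    exact ans_pos T O K hK s ⟨_, hg0 n hn⟩
  have hxK := hlow K le_rfl hK
  set z := s.1 ⟨_, hg0 K le_rfl⟩ with hz
  obtain ⟨-, Sg, hzs, hQ⟩ := z.2.mid (by rw [← hxK, hx.len])
  rw [← hxK] at hQ
  have hsg : sgOf T O K hK s (x K) = Sg := by
    unfold sgOf
    rw [dif_pos (hg0 K le_rfl), ← hz, hzs]; rfl
  have hhi : ∀ n, K + 2 ≤ n → n % 2 = 0 →
      x (n+1) = phi1aux T O K (ans T O K hK s (x n)) Sg (x n) := by
    intro n hn hn2
    rw [hc n hn2]; unfold phi1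
    rw [if_neg (by rw [hx.len]; omega), hx.anc (by omega), hsg]
  -- forced reach
  have hforce : ∀ i, K + 2 ≤ i → T.Force 0 Sg O (x i) →
      (∀ j, K + 2 ≤ j → j < i → ¬ T.Force 0 Sg O (x j)) → (∀ j, K + 2 ≤ j → j < i → x j ∉ O) →
      ∃ m, i ≤ m ∧ x m ∈ O ∧ ∀ n, i ≤ n → n ≤ m → x n ∈ Sg := by
    intro i hi hf hm hno
    have := fst_spec T 0 Sg O (x i) hf x hx (by rw [hx.len]) (by
      rw [hx.len]
      intro m hm1 hm2 hm3
      rw [hhi m (by omega) hm2]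
      refine phi1_b2 T O K _ Sg x hx m i hi hm1 ?_ hf hm
      intro j h1 h2
      rcases Nat.lt_or_ge j i with h3 | h3
      · exact hno j h1 h3
      · exact hm3 j h3 h2)
    rwa [hx.len] at this
  have hSg : ∀ n, K + 1 ≤ n → (∀ j, K + 2 ≤ j → j < n → x j ∉ O) → x n ∈ Sg := by
    intro n hn
    induction n, hn using Nat.le_induction with
    | base => intro _; exact hQ.1
    | succ n hn ih =>
      intro hno
      have ih := ih (fun j h1 h2 => hno j h1 (by omega))
      by_cases hn2 : n % 2 = 0
      · by_cases hW : ∃ i, K + 2 ≤ i ∧ (i ≤ n ∧ T.Force 0 Sg O (x i))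
        · obtain ⟨i, hi, ⟨hin, hf⟩, hm⟩ := least_above hW
          obtain ⟨m, hm1, hm2, hm3⟩ := hforce i hi hf
            (fun j h1 h2 h3 => hm j h1 h2 ⟨by omega, h3⟩) (fun j h1 h2 => hno j h1 (by omega))
          have : n < m := by
            by_contra hcon
            exact hno m (by omega) (by omega) hm2
          exact hm3 (n+1) (by omega) this
        · push Not at hW
          have hn3 : K + 2 ≤ n := by omega
          have hW' : ∀ j, K + 2 ≤ j → j ≤ n → ¬ T.Force 0 Sg O (x j) := fun j h1 h2 => hW j h1 h2
          have hno' : ∀ j, K + 2 ≤ j → j ≤ n → x j ∉ O := fun j h1 h2 => hno j h1 (by omega)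
          have e := hhi n hn3 hn2
          rw [phi1_b3 T O K _ Sg x hx n hn3 hno' hW'] at e
          have hx2 : x (K+2) ∈ Sg := hQ.2.2.1 _ hQ.1 (by rw [hx.len]; omega) _ (hx.child (K+1))
          have hgood : Good T O K (x n, some Sg, some (Sum.inr (S2 T O K Sg (x (K+2))))) := by
            right; right
            refine ⟨by dsimp only; rw [hx.len]; exact hn3, Sg, _, rfl, rfl, ?_, Or.inr ⟨_, rfl, ?_, ?_⟩⟩
            · dsimp only; rwa [hx.anc (by omega)]
            · dsimp only; rw [hx.anc hn3]
              exact S2_QII T O K Sg _ _ hQ (hx.len _) (hx.len _) hx2 (hW _ le_rfl hn3)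
            · refine ⟨ih, by rw [hx.len]; exact hn3, hx.anc hn3, ?_⟩
              intro i h1 h2
              rw [hx.len] at h2
              rw [hx.anc h2]; exact hW i h1 h2
          have e2 : x (n+1) = (s.1 ⟨_, hgood⟩).1.1 := e.trans (ans_pos T O K hK s ⟨_, hgood⟩)
          have hch := s.2 ⟨_, hgood⟩
          have hp := congrArg Subtype.val hch.2
          have hlen : T.len (s.1 ⟨_, hgood⟩).1.1 = n + 1 := by rw [← e2, hx.len]
          obtain ⟨Sg2, d2, e3, e4, -, hG⟩ := (s.1 ⟨_, hgood⟩).2.hi (by omega)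
          have hp1 := congrArg (fun z => z.2.2) hp
          have hp0 := congrArg (fun z => z.2.1) hp
          change (if T.len (s.1 ⟨_, hgood⟩).1.1 ≤ K + 2 then none else
            (s.1 ⟨_, hgood⟩).1.2.2) = some (Sum.inr (S2 T O K Sg (x (K+2)))) at hp1
          rw [if_neg (by omega), e4] at hp1
          rcases hG with ⟨u, g1, -⟩ | ⟨Sg', g1, g2, g3⟩
          · rw [g1] at hp1; cases hp1
          · rw [g1] at hp1
            have := Sum.inr.inj (Option.some.inj hp1)
            rw [this, ← e2] at g3
            exact g3.1
      · exact hQ.2.2.1 _ ih (by rw [hx.len]; omega) _ (hx.child n)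
  by_cases hO : ∃ i, K + 2 ≤ i ∧ x i ∈ O
  · obtain ⟨i, hi, hiO, him⟩ := least_above hO
    have hu : x i ∈ Sg := hSg i (by omega) him
    obtain ⟨y, hy, hyx⟩ := lift_play T O K hK x hx Sg (Sum.inl (x i)) hQ (fun n hn =>
      Or.inl ⟨x i, rfl, hu, hiO, by rw [hx.len]; exact hi, by
        rw [hx.len, hx.len]
        rcases le_total i n with h | h
        · rw [hx.anc h, T.anc_of_le _ (by rwa [hx.len])]
        · rw [hx.anc h, T.anc_of_le _ (by rwa [hx.len])]⟩)
    refine ⟨y, hy, fun n hn => ?_, fun n => by rw [hyx]⟩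
    have hgetlow : ∀ (h : n ≤ K), y n = ⟨_, hg0 n h⟩ := by
      intro h; apply Subtype.ext; rw [hyx n, if_pos h, if_pos (by omega)]
    refine lift_cons T O K hK x hx Sg _ y hy hyx s n ?_ ?_ (by omega)
    · rcases Nat.lt_or_ge K n with h | h
      · rcases Nat.lt_or_ge n i with h2 | h2
        · have hch := s.2 (y n)
          have hyl : (US T O K hK).len (y n) = n := hy.len n
          have hl : T.len (s.1 (y n)).1.1 = n + 1 := by
            have := hch.1; rw [hyl] at this; exact this
          refine forced T O K hK x hx n _ (x i) ?_ hl (by omega) (by rw [hx.len])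
            (by rw [hx.len]; omega)
          have hp1 := congrArg (fun z => z.1.2.2) hch.2
          change (if T.len (s.1 (y n)).1.1 ≤ K + 2 then none else
            (s.1 (y n)).1.2.2) = (y n).1.2.2 at hp1
          rw [if_neg (by omega), hyx n] at hp1
          rw [hp1]; dsimp only; rw [if_neg (by omega)]
        · rw [hhi n (by omega) hn, phi1_b1 T O K _ Sg x hx n i hi h2 hiO him]
          have := ans_pos T O K hK s (y n)
          rw [hyx n] at this
          dsimp only at this
          rwa [if_neg (by omega), if_neg (by omega)] at this
      · rw [hgetlow h]; exact hlow n h hn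
    · intro h
      rw [hgetlow h.le]
      subst h
      exact hzs
  · push Not at hO
    have hno : ∀ i, K + 2 ≤ i → ¬ T.Force 0 Sg O (x i) := by
      intro i hi hf
      obtain ⟨i', h1, h2, h3⟩ := least_above (P := fun i => T.Force 0 Sg O (x i)) ⟨i, hi, hf⟩
      obtain ⟨m, hm1, hm2, -⟩ := hforce i' h1 h2 h3 (fun j h _ => hO j h)
      exact hO m (by omega) hm2
    have hx2 : x (K+2) ∈ Sg := hSg _ (by omega) (fun j h _ => hO j h)
    obtain ⟨y, hy, hyx⟩ := lift_play T O K hK x hx Sg (Sum.inr (S2 T O K Sg (x (K+2)))) hQ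
      (fun n hn => Or.inr ⟨_, rfl, by
        rw [hx.anc hn]
        exact S2_QII T O K Sg _ _ hQ (hx.len _) (hx.len _) hx2 (hno _ le_rfl),
        hSg n (by omega) (fun j h _ => hO j h), by rw [hx.len]; exact hn, hx.anc hn, by
          intro i h1 h2
          rw [hx.len] at h2
          rw [hx.anc h2]; exact hno i h1⟩)
    refine ⟨y, hy, fun n hn => ?_, fun n => by rw [hyx]⟩
    have hgetlow : ∀ (h : n ≤ K), y n = ⟨_, hg0 n h⟩ := by
      intro h; apply Subtype.ext; rw [hyx n, if_pos h, if_pos (by omega)]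
    refine lift_cons T O K hK x hx Sg _ y hy hyx s n ?_ ?_ (by omega)
    · rcases Nat.lt_or_ge K n with h | h
      · rw [hhi n (by omega) hn, phi1_b3 T O K _ Sg x hx n (by omega) (fun j h _ => hO j h)
          (fun j h _ => hno j h)]
        have := ans_pos T O K hK s (y n)
        rw [hyx n] at this
        dsimp only at this
        rwa [if_neg (by omega), if_neg (by omega)] at this
      · rw [hgetlow h]; exact hlow n h hn
    · intro h
      rw [hgetlow h.le]
      subst h
      exact hzs

end unr3
end BD

namespace BD

section unr4
variable (T : GT) (O : Set T.N) (K : ℕ) (hK : K % 2 = 0)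

lemma phi2_b1 (A D) (x) (hx : T.IsPlay x) (n i : ℕ) (hi : K + 2 ≤ i) (hin : i ≤ n)
    (hO : x i ∈ UU T K D) (hm : ∀ j, K + 2 ≤ j → j < i → x j ∉ UU T K D) :
    phi2aux T K A D (x n) =
      A (some (Classical.epsilon (fun Sg => D Sg = some (Sum.inl (x i))))) (some (Sum.inl (x i))) := by
  classical
  have h : ∃ i, K + 2 ≤ i ∧ i ≤ T.len (x n) ∧ T.anc (x n) i ∈ UU T K D :=
    ⟨i, hi, by rwa [hx.len], by rwa [hx.anc hin]⟩
  unfold phi2aux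
  rw [dif_pos h]
  have : Nat.find h = i := by
    rw [Nat.find_eq_iff]
    refine ⟨⟨hi, by rwa [hx.len], by rwa [hx.anc hin]⟩, ?_⟩
    rintro j hj ⟨h1, h2, h3⟩
    rw [hx.anc (by omega)] at h3
    exact hm j h1 hj h3
  rw [this, hx.anc hin]

lemma phi2_b2 (A D) (x) (hx : T.IsPlay x) (n i : ℕ) (hi : K + 1 ≤ i) (hin : i ≤ n)
    (hno : ∀ j, K + 2 ≤ j → j ≤ n → x j ∉ UU T K D)
    (hO : T.Force 1 univ (UU T K D) (x i))
    (hm : ∀ j, K + 1 ≤ j → j < i → ¬ T.Force 1 univ (UU T K D) (x j)) :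
    phi2aux T K A D (x n) = (fst' T 1 univ (UU T K D) (x i)).1 (x n) := by
  classical
  have h0 : ¬ ∃ i, K + 2 ≤ i ∧ i ≤ T.len (x n) ∧ T.anc (x n) i ∈ UU T K D := by
    rintro ⟨j, h1, h2, h3⟩
    rw [hx.len] at h2
    rw [hx.anc h2] at h3
    exact hno j h1 h2 h3
  have h : ∃ i, K + 1 ≤ i ∧ i ≤ T.len (x n) ∧ T.Force 1 univ (UU T K D) (T.anc (x n) i) :=
    ⟨i, hi, by rwa [hx.len], by rwa [hx.anc hin]⟩
  unfold phi2aux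
  rw [dif_neg h0, dif_pos h]
  have : Nat.find h = i := by
    rw [Nat.find_eq_iff]
    refine ⟨⟨hi, by rwa [hx.len], by rwa [hx.anc hin]⟩, ?_⟩
    rintro j hj ⟨h1, h2, h3⟩
    rw [hx.anc (by omega)] at h3
    exact hm j h1 hj h3
  rw [this, hx.anc hin]

lemma phi2_b3 (A D) (x) (hx : T.IsPlay x) (n : ℕ) (hn : K + 1 ≤ n)
    (hno : ∀ j, K + 2 ≤ j → j ≤ n → x j ∉ UU T K D)
    (hm : ∀ j, K + 1 ≤ j → j ≤ n → ¬ T.Force 1 univ (UU T K D) (x j)) :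
    phi2aux T K A D (x n) = A (some (S1 T K (UU T K D) (x (K+1))))
      (if n = K + 1 then none else D (S1 T K (UU T K D) (x (K+1)))) := by
  have h0 : ¬ ∃ i, K + 2 ≤ i ∧ i ≤ T.len (x n) ∧ T.anc (x n) i ∈ UU T K D := by
    rintro ⟨j, h1, h2, h3⟩
    rw [hx.len] at h2
    rw [hx.anc h2] at h3
    exact hno j h1 h2 h3
  have h : ¬ ∃ i, K + 1 ≤ i ∧ i ≤ T.len (x n) ∧ T.Force 1 univ (UU T K D) (T.anc (x n) i) := by
    rintro ⟨j, h1, h2, h3⟩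
    rw [hx.len] at h2
    rw [hx.anc h2] at h3
    exact hm j h1 h2 h3
  unfold phi2aux
  rw [dif_neg h0, dif_neg h, hx.anc hn, hx.len]

include hK in
lemma S1_QI (U : Set T.N) (p1 : T.N) (hl1 : T.len p1 = K + 1)
    (hf : ¬ T.Force 1 univ U p1) : QI T p1 (S1 T K U p1) := by
  refine ⟨⟨hl1.ge, T.anc_of_le _ hl1.le, ?_⟩, ?_, ?_, ?_⟩
  · intro i h1 h2
    rwa [T.anc_of_le _ (by omega)]
  · rintro q ⟨g2, g3, g6⟩
    rcases Nat.eq_or_lt_of_le g2 with g4 | g4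
    · left; rw [← g3, T.anc_of_le _ g4.symm.le]
    · right
      refine ⟨by omega, ?_⟩
      obtain ⟨m, hm⟩ : ∃ m, T.len q = m + 1 := ⟨T.len q - 1, by omega⟩
      have hlp := T.len_par q m hm
      refine ⟨by omega, by rw [← T.anc_par q (by omega), g3], ?_⟩
      intro i h1 h2
      rw [← T.anc_par q (by omega)]
      exact g6 i h1 (by omega)
  · rintro q ⟨g2, g3, g6⟩ he c' hc'
    refine ⟨by rw [hc'.1]; omega, by rw [T.anc_child hc' (by omega), g3], ?_⟩
    intro i h1 h2
    rcases Nat.lt_or_ge (T.len q) i with h3 | h3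
    · rw [T.anc_of_le c' (by have := hc'.1; omega)]
      intro hcon
      apply g6 (T.len q) g2 le_rfl
      rw [T.anc_self]
      exact GT.Force.mine q c' trivial he hc' hcon
    · rw [T.anc_child hc' h3]; exact g6 i h1 h3
  · rintro q ⟨g2, g3, g6⟩ ho
    obtain ⟨c', hc', hcf⟩ : ∃ c, T.IsChild c q ∧ ¬ T.Force 1 univ U c := by
      by_contra hcon
      push Not at hcon
      apply g6 (T.len q) g2 le_rfl
      rw [T.anc_self]
      exact GT.Force.theirs q trivial (by omega) hcon
    refine ⟨c', hc', by rw [hc'.1]; omega,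
      by rw [T.anc_child hc' (by omega), g3], ?_⟩
    intro i h1 h2
    rcases Nat.lt_or_ge (T.len q) i with h3 | h3
    · rwa [T.anc_of_le c' (by have := hc'.1; omega)]
    · rw [T.anc_child hc' h3]; exact g6 i h1 h3

/-- data of the answer: s-component -/
lemma us_child_s {z w : (US T O K hK).N} (h : (US T O K hK).IsChild z w) (hl : K + 1 ≤ T.len w.1.1) :
    z.1.2.1 = w.1.2.1 := by
  have hp1 := congrArg (fun z => z.1.2.1) h.2
  change (if T.len z.1.1 ≤ K + 1 then none else z.1.2.1) = _ at hp1
  have := h.1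
  change T.len z.1.1 = T.len w.1.1 + 1 at this
  rwa [if_neg (by omega)] at hp1

lemma us_child_d {z w : (US T O K hK).N} (h : (US T O K hK).IsChild z w) (hl : K + 2 ≤ T.len w.1.1) :
    z.1.2.2 = w.1.2.2 := by
  have hp1 := congrArg (fun z => z.1.2.2) h.2
  change (if T.len z.1.1 ≤ K + 2 then none else z.1.2.2) = _ at hp1
  have := h.1
  change T.len z.1.1 = T.len w.1.1 + 1 at this
  rwa [if_neg (by omega)] at hp1

lemma lift2 (s : (US T O K hK).Strat) (x : ℕ → T.N) (hx : T.IsPlay x)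
    (hc : ∀ n, n % 2 = 1 → x (n+1) = phi2 T O K hK s (x n)) :
    ∃ y, (US T O K hK).IsPlay y ∧ (US T O K hK).Cons 1 s y ∧ ∀ n, (y n).1.1 = x n := by
  have hg0 : ∀ n, n ≤ K → Good T O K (x n, none, none) :=
    fun n hn => Or.inl ⟨by dsimp only; rwa [hx.len], rfl, rfl⟩
  have hlow : ∀ n (hn : n ≤ K), n % 2 = 1 → x (n+1) = (s.1 ⟨_, hg0 n hn⟩).1.1 := by
    intro n hn hn2
    rw [hc n hn2]; unfold phi2
    rw [if_pos (by rwa [hx.len])]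
    exact ans_pos T O K hK s ⟨_, hg0 n hn⟩
  set D := ddOf T O K hK s (x (K+1)) with hD
  set U := UU T K D with hU
  have hhi : ∀ n, K + 1 ≤ n → n % 2 = 1 →
      x (n+1) = phi2aux T K (ans T O K hK s (x n)) D (x n) := by
    intro n hn hn2
    rw [hc n hn2]; unfold phi2
    rw [if_neg (by rw [hx.len]; omega), hx.anc (by omega)]
  have hDgood : ∀ Sg d, D Sg = some d → ∃ h : Good T O K (x (K+1), some Sg, none),
      (s.1 ⟨_, h⟩).1.2.2 = some d := by
    intro Sg d h
    rw [hD] at h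
    unfold ddOf at h
    split_ifs at h with h1
    exact ⟨h1, h⟩
  by_cases hex : ∃ i, K + 2 ≤ i ∧ x i ∈ U
  · obtain ⟨i, hi, hiU, him⟩ := least_above hex
    have heps : D (Classical.epsilon (fun Sg => D Sg = some (Sum.inl (x i)))) = some (Sum.inl (x i)) :=
      Classical.epsilon_spec (p := fun Sg => D Sg = some (Sum.inl (x i))) hiU.2
    set Sg := Classical.epsilon (fun Sg => D Sg = some (Sum.inl (x i))) with hSg
    obtain ⟨hgood, hzd⟩ := hDgood _ _ heps
    obtain ⟨-, Sg', e1, hQ⟩ := hgood.mid (hx.len _)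
    dsimp only at e1 hQ
    have := Option.some.inj e1
    subst this
    have hch := s.2 ⟨_, hgood⟩
    have hzl : T.len (s.1 ⟨_, hgood⟩).1.1 = K + 2 := by
      have := hch.1
      change _ = T.len (x (K+1)) + 1 at this
      rw [hx.len] at this; exact this
    have hzs := us_child_s T O K hK hch (by show K + 1 ≤ T.len (x (K+1)); rw [hx.len])
    obtain ⟨Sg', d, e2, e3, -, hG⟩ := (s.1 ⟨_, hgood⟩).2.hi hzl.ge
    rw [hzs] at e2
    have := Option.some.inj e2
    subst this
    rw [hzd] at e3
    have := Option.some.inj e3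
    subst this
    obtain ⟨hu1, hu2⟩ : x i ∈ Sg ∧ x i ∈ O := by
      rcases hG with ⟨u, g1, g2, g3, -⟩ | ⟨_, g1, -⟩
      · rw [Sum.inl.inj g1]; exact ⟨g2, g3⟩
      · cases g1
    obtain ⟨y, hy, hyx⟩ := lift_play T O K hK x hx Sg (Sum.inl (x i)) hQ (fun n hn =>
      Or.inl ⟨x i, rfl, hu1, hu2, by rw [hx.len]; exact hi, by
        rw [hx.len, hx.len]
        rcases le_total i n with h | h
        · rw [hx.anc h, T.anc_of_le _ (by rwa [hx.len])]
        · rw [hx.anc h, T.anc_of_le _ (by rwa [hx.len])]⟩)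
    refine ⟨y, hy, fun n hn => ?_, fun n => by rw [hyx]⟩
    have hgetlow : ∀ (h : n ≤ K), y n = ⟨_, hg0 n h⟩ := by
      intro h; apply Subtype.ext; rw [hyx n, if_pos h, if_pos (by omega)]
    have hgetmid : ∀ (h : n = K + 1), y n = ⟨_, hgood⟩ := by
      intro h; apply Subtype.ext; rw [hyx n, if_neg (by omega), if_pos (by omega), h]
    have hd : n = K + 1 → (s.1 (y n)).1.2.2 = some (Sum.inl (x i)) := by
      intro h; rw [hgetmid h]; exact hzd
    refine lift_cons T O K hK x hx Sg _ y hy hyx s n ?_ (by omega) hd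
    rcases Nat.lt_or_ge K n with h | h
    · rcases Nat.lt_or_ge n i with h2 | h2
      · have hch := s.2 (y n)
        have hyl : (US T O K hK).len (y n) = n := hy.len n
        have hl : T.len (s.1 (y n)).1.1 = n + 1 := by
          have := hch.1; rw [hyl] at this; exact this
        refine forced T O K hK x hx n _ (x i) ?_ hl (by omega) (by rw [hx.len])
          (by rw [hx.len]; omega)
        rcases Nat.eq_or_lt_of_le (show K + 1 ≤ n from h) with h3 | h3
        · exact hd h3.symm
        · rw [us_child_d T O K hK hch (by rw [hyx]; dsimp only; rw [hx.len]; omega), hyx n]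
          dsimp only; rw [if_neg (by omega)]
      · rw [hhi n (by omega) hn, phi2_b1 T K _ D x hx n i hi h2 hiU him]
        have := ans_pos T O K hK s (y n)
        rw [hyx n] at this
        dsimp only at this
        rwa [if_neg (by omega), if_neg (by omega)] at this
    · rw [hgetlow h]; exact hlow n h hn
  · push Not at hex
    have hno : ∀ i, K + 1 ≤ i → ¬ T.Force 1 univ U (x i) := by
      intro i hi hf
      obtain ⟨i', h1, h2, h3⟩ := least_above (P := fun i => T.Force 1 univ U (x i)) ⟨i, hi, hf⟩
      obtain ⟨m, hm1, hm2, -⟩ := fst_spec T 1 univ U (x i') h2 x hx (by rw [hx.len]) (by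
        rw [hx.len]
        intro m hm1 hm2 hm3
        rw [hhi m (by omega) hm2]
        exact phi2_b2 T K _ D x hx m i' h1 hm1 (fun j h _ => hex j h) h2 h3)
      have h5 := hm2.1
      rw [hx.len] at h5
      exact hex m h5 hm2
    set Sg := S1 T K U (x (K+1)) with hSg
    have hQ : QI T (x (K+1)) Sg := S1_QI T K hK U _ (hx.len _) (hno _ le_rfl)
    have hxS : ∀ n, K + 1 ≤ n → x n ∈ Sg := by
      intro n hn
      refine ⟨by rwa [hx.len], hx.anc hn, fun i h1 h2 => ?_⟩
      rw [hx.len] at h2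
      rw [hx.anc h2]; exact hno i h1
    have hgood : Good T O K (x (K+1), some Sg, none) :=
      Or.inr (Or.inl ⟨hx.len _, rfl, Sg, rfl, hQ⟩)
    have hch := s.2 ⟨_, hgood⟩
    have hzl : T.len (s.1 ⟨_, hgood⟩).1.1 = K + 2 := by
      have := hch.1
      change _ = T.len (x (K+1)) + 1 at this
      rw [hx.len] at this; exact this
    have hzs := us_child_s T O K hK hch (by show K + 1 ≤ T.len (x (K+1)); rw [hx.len])
    have hDS : D Sg = (s.1 ⟨_, hgood⟩).1.2.2 := by
      rw [hD]; unfold ddOf; rw [dif_pos hgood]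
    obtain ⟨Sg1, d, e2, e3, -, hG⟩ := (s.1 ⟨_, hgood⟩).2.hi hzl.ge
    rw [hzs] at e2
    have := Option.some.inj e2
    subst this
    have hxK : x (K+2) = (s.1 ⟨_, hgood⟩).1.1 := by
      rw [hhi (K+1) le_rfl (by omega), phi2_b3 T K _ D x hx (K+1) le_rfl (fun j h _ => hex j h)
        (fun j h _ => hno j h), if_pos rfl]
      exact ans_pos T O K hK s ⟨_, hgood⟩
    obtain ⟨Sg', hd, hQ2⟩ : ∃ Sg', d = Sum.inr Sg' ∧ QII T O (x (K+2)) Sg Sg' := by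
      rcases hG with ⟨u, g1, g2, g3, g4, -⟩ | ⟨Sg', g1, g2, -⟩
      · exfalso
        have hUu : u ∈ U := ⟨g4, Sg, by rw [hDS, e3, g1]⟩
        apply g2.2.2 (T.len u) (by omega) le_rfl
        rw [T.anc_self]
        exact GT.Force.base u trivial hUu
      · refine ⟨Sg', g1, ?_⟩
        rw [← hxK, hx.anc le_rfl] at g2
        exact g2
    subst hd
    have hgn : ∀ n, K + 2 ≤ n → x n ∈ Sg' → Good T O K (x n, some Sg, some (Sum.inr Sg')) := by
      intro n hn hxn
      refine Or.inr (Or.inr ⟨by dsimp only; rwa [hx.len], Sg, _, rfl, rfl, ?_,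
        Or.inr ⟨Sg', rfl, ?_, hxn⟩⟩)
      · dsimp only; rwa [hx.anc (by omega)]
      · dsimp only; rwa [hx.anc hn]
    have hstep : ∀ n, K + 2 ≤ n → n % 2 = 1 → ∀ hxn : x n ∈ Sg', ∀ h : K + 2 ≤ n,
        x (n+1) = (s.1 ⟨_, hgn n h hxn⟩).1.1 := by
      intro n hn hn2 hxn h
      rw [hhi n (by omega) hn2, phi2_b3 T K _ D x hx n (by omega) (fun j h _ => hex j h)
        (fun j h _ => hno j h), if_neg (by omega), ← hSg, hDS, e3]
      exact ans_pos T O K hK s ⟨_, hgn n h hxn⟩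
    have hxS' : ∀ n, K + 2 ≤ n → x n ∈ Sg' := by
      intro n hn
      induction n, hn using Nat.le_induction with
      | base => exact hQ2.1
      | succ n hn ih =>
        by_cases hn2 : n % 2 = 1
        · have e := hstep n hn hn2 ih hn
          have hch2 := s.2 ⟨_, hgn n hn ih⟩
          have h5 := us_child_d T O K hK hch2 (by show K + 2 ≤ T.len (x n); rwa [hx.len])
          obtain ⟨Sg2, d2, e5, e6, -, hG2⟩ := (s.1 ⟨_, hgn n hn ih⟩).2.hi
            (by rw [← e, hx.len]; omega)
          rw [h5] at e6
          have := Option.some.inj e6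
          subst this
          rcases hG2 with ⟨u, g1, -⟩ | ⟨Sg3, g1, -, g3⟩
          · cases g1
          · rw [← Sum.inr.inj g1, ← e] at g3; exact g3
        · exact hQ2.2.2.2.1 _ ih (by rw [hx.len]; omega) _ (hx.child n) (hxS _ (by omega))
    obtain ⟨y, hy, hyx⟩ := lift_play T O K hK x hx Sg (Sum.inr Sg') hQ
      (fun n hn => Or.inr ⟨_, rfl, by rwa [hx.anc hn], hxS' n hn⟩)
    refine ⟨y, hy, fun n hn => ?_, fun n => by rw [hyx]⟩
    have hgetlow : ∀ (h : n ≤ K), y n = ⟨_, hg0 n h⟩ := by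
      intro h; apply Subtype.ext; rw [hyx n, if_pos h, if_pos (by omega)]
    have hgetmid : ∀ (h : n = K + 1), y n = ⟨_, hgood⟩ := by
      intro h; apply Subtype.ext; rw [hyx n, if_neg (by omega), if_pos (by omega), h]
    refine lift_cons T O K hK x hx Sg _ y hy hyx s n ?_ (by omega) ?_
    · rcases Nat.lt_or_ge K n with h | h
      · rcases Nat.eq_or_lt_of_le (show K + 1 ≤ n from h) with h3 | h3
        · rw [hgetmid h3.symm, ← h3]; exact hxK
        · have : y n = ⟨_, hgn n h3 (hxS' n h3)⟩ := by
            apply Subtype.ext; rw [hyx n, if_neg (by omega), if_neg (by omega)]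
          rw [this]; exact hstep n h3 hn (hxS' n h3) h3
      · rw [hgetlow h]; exact hlow n h hn
    · intro h; rw [hgetmid h]; exact e3

noncomputable def usCov : Cov K (US T O K hK) T where
  π z := z.1.1
  hom := us_hom T O K hK
  inj p q hp h := by
    change p.1.1 = q.1.1 at h
    change T.len p.1.1 ≤ K at hp
    have h1 := p.2.lo hp
    have h2 := q.2.lo (by rwa [← h])
    exact Subtype.ext (Prod.ext h (Prod.ext (h1.1.trans h2.1.symm) (h1.2.trans h2.2.symm)))
  surj q hq := ⟨⟨(q, none, none), Or.inl ⟨hq, rfl, rfl⟩⟩, rfl⟩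
  φ b s := if b = 0 then ⟨phi1 T O K hK s, phi1_child T O K hK s⟩
    else ⟨phi2 T O K hK s, phi2_child T O K hK s⟩
  loc b hb s s' n h q hq hqb := by
    rcases (show b = 0 ∨ b = 1 by omega) with rfl | rfl
    · exact phi1_loc T O K hK s s' n h q hq hqb
    · exact phi2_loc T O K hK s s' n h q hq hqb
  kid b hb s p hp hpb := by
    change T.len p.1.1 < K at hp
    have h1 := p.2.lo hp.le
    have h2 := ans_pos T O K hK s p
    rw [h1.1, h1.2] at h2
    rcases (show b = 0 ∨ b = 1 by omega) with rfl | rfl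
    · show phi1 T O K hK s p.1.1 = _
      unfold phi1; rw [if_pos hp.le]; exact h2
    · show phi2 T O K hK s p.1.1 = _
      unfold phi2; rw [if_pos hp.le]; exact h2
  lift b hb s x hx hc := by
    rcases (show b = 0 ∨ b = 1 by omega) with rfl | rfl
    · exact lift1 T O K hK s x hx hc
    · exact lift2 T O K hK s x hx hc

lemma us_clp (hO : ∀ q p, T.IsChild q p → p ∈ O → q ∈ O) :
    (US T O K hK).Clp (pull (usCov T O K hK).π {x | ∃ n, x n ∈ O}) := by
  have hup : ∀ (x : ℕ → T.N), T.IsPlay x → ∀ m n, m ≤ n → x m ∈ O → x n ∈ O := by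
    intro x hx m n hmn
    induction n, hmn using Nat.le_induction with
    | base => exact id
    | succ n _ ih => exact fun h => hO _ _ (hx.child n) (ih h)
  have key : ∀ y, (US T O K hK).IsPlay y → ((∃ n, (y n).1.1 ∈ O) ↔
      ∃ u, (y (K+2)).1.2.2 = some (Sum.inl u)) := by
    intro y hy
    have hx := (us_hom T O K hK).play hy
    have hd : ∀ n, K + 2 ≤ n → (y n).1.2.2 = (y (K+2)).1.2.2 := by
      intro n hn
      induction n, hn using Nat.le_induction with
      | base => rfl
      | succ n hn ih =>
        rw [← ih]
        exact us_child_d T O K hK (hy.child n) (by rw [show T.len (y n).1.1 = n from hx.len n]; exact hn)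
    have hl : ∀ n, T.len (y n).1.1 = n := fun n => hx.len n
    obtain ⟨Sg, d, e1, e2, -, hG⟩ := (y (K+2)).2.hi (hl _).ge
    rcases hG with ⟨u, g1, g2, g3, g4, g5⟩ | ⟨Sg', g1, g2, g3⟩
    · refine ⟨fun _ => ⟨u, by rw [e2, g1]⟩, fun _ => ⟨T.len u, ?_⟩⟩
      obtain ⟨Sg1, d1, e3, e4, -, hG1⟩ := (y (T.len u)).2.hi (by rwa [hl])
      rw [hd _ g4, e2] at e4
      have := Option.some.inj e4
      subst this
      rcases hG1 with ⟨v, k1, k2, k3, k4, k5⟩ | ⟨Sg', k1, -⟩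
      · rw [g1] at k1
        have := Sum.inl.inj k1
        subst this
        rw [hl, T.anc_self, T.anc_of_le _ (by rw [hl])] at k5
        rwa [← k5]
      · rw [g1] at k1; cases k1
    · refine ⟨?_, fun ⟨u, hu⟩ => ?_⟩
      · rintro ⟨n, hn⟩
        exfalso
        have h1 := hup _ hx n (n + (K + 2)) (by omega) hn
        obtain ⟨Sg1, d1, e3, e4, -, hG1⟩ := (y (n + (K+2))).2.hi (by rw [hl]; omega)
        rw [hd _ (by omega), e2] at e4
        have := Option.some.inj e4
        subst this
        rcases hG1 with ⟨v, k1, -⟩ | ⟨Sg'', k1, k2, k3⟩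
        · rw [g1] at k1; cases k1
        · exact k2.2.2.2.2.2 _ k3 h1
      · rw [e2, g1] at hu; cases hu
  constructor
  · intro x hx hxB
    refine ⟨K+2, fun y hy h => ?_⟩
    apply (key y hy).2
    rw [h]
    exact (key x hx).1 hxB
  · intro x hx hxB
    refine ⟨K+2, fun y hy h hyB => hxB ?_⟩
    apply (key x hx).2
    rw [← h]
    exact (key y hy).1 hyB

end unr4

lemma hunr_open (T : GT) (B : Set (ℕ → T.N)) (hB : T.Opn B) : HUnr T B := by
  intro T' f hf k
  have hk2 : 2 * k % 2 = 0 := by omega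
  have h1 := hf.opn hB
  set B' := pull f B
  let O : Set T'.N := {u | ∀ y, T'.IsPlay y → y (T'.len u) = u → y ∈ B'}
  have hO : ∀ q p, T'.IsChild q p → p ∈ O → q ∈ O := by
    intro q p hc hp y hy hyq
    refine hp y hy ?_
    rw [← hy.par, ← hc.1, hyq, hc.2]
  refine ⟨_, (usCov T' O (2*k) hk2).mono (by omega), ?_⟩
  have h2 := us_clp T' O (2*k) hk2 hO
  have heq : ∀ y, (US T' O (2*k) hk2).IsPlay y →
      (y ∈ pull (usCov T' O (2*k) hk2).π {x | ∃ n, x n ∈ O} ↔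
       y ∈ pull (usCov T' O (2*k) hk2).π B') := by
    intro y hy
    have hx := (usCov T' O (2*k) hk2).hom.play hy
    constructor
    · rintro ⟨n, hn⟩
      exact hn _ hx (by rw [show T'.len ((usCov T' O (2*k) hk2).π (y n)) = n from hx.len n])
    · intro h
      obtain ⟨n, hn⟩ := h1 _ hx h
      exact ⟨n, fun z hz hzn => hn z hz (by
        rw [show T'.len ((usCov T' O (2*k) hk2).π (y n)) = n from hx.len n] at hzn
        exact hzn)⟩
  constructor
  · intro x hx hxB
    obtain ⟨n, hn⟩ := h2.1 x hx ((heq x hx).2 hxB)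
    exact ⟨n, fun y hy h => (heq y hy).1 (hn y hy h)⟩
  · intro x hx hxB
    obtain ⟨n, hn⟩ := h2.2 x hx (fun h => hxB ((heq x hx).1 h))
    exact ⟨n, fun y hy h h' => (hn y hy h) ((heq y hy).2 h')⟩

theorem det_of_gen (T : GT) (B : Set (ℕ → T.N))
    (hB : MeasurableSpace.GenerateMeasurable {D | T.Opn D} B) : T.Det B := by
  have h : HUnr T B := by
    induction hB with
    | basic u hu => exact hunr_open T u hu
    | empty => exact hunr_open T _ (fun x _ h => h.elim)
    | compl t _ ih => exact ih.compl
    | iUnion f _ ih => exact HUnr.iUnion ih hunr_open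
  obtain ⟨S, c, hS⟩ := h T id ⟨fun _ => rfl, fun _ => rfl⟩ 0
  exact c.det B (S.det_open _ hS.1)

end BD


namespace BD

/-- the full tree of finite sequences (latest first) -/
def fullT (A : Type) [Nonempty A] : GT where
  N := List A
  len := List.length
  par := List.tail
  root := []
  len_root := rfl
  par_root := rfl
  root_uniq := fun p h => List.length_eq_zero_iff.1 h
  len_par := fun p n h => by rw [List.length_tail, h]; rfl
  child := fun p => ⟨Classical.arbitrary A :: p, rfl, rfl⟩

section lip
variable {α γ : Type} [Nonempty α] [Nonempty γ]

noncomputable def hdd {A : Type} [Nonempty A] (l : List A) : A := l.headD (Classical.arbitrary A)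

lemma fullT_child {A : Type} [Nonempty A] {q p : List A} (h : (fullT A).IsChild q p) :
    q = hdd q :: p := by
  obtain ⟨h1, h2⟩ := h
  cases q with
  | nil => exact absurd h1 (by simp [fullT])
  | cons a l => exact congrArg (a :: ·) h2

lemma fullT_child' {A : Type} [Nonempty A] (a : A) (p : List A) : (fullT A).IsChild (a :: p) p :=
  ⟨rfl, rfl⟩

noncomputable def lipI (s : (fullT (α × γ)).Strat) : List γ → List (α × γ)
  | [] => []
  | c :: l => (Classical.arbitrary α, c) :: (show List (α × γ) from s.1 (lipI s l))

noncomputable def lipII (s : (fullT (α × γ)).Strat) : List α → List (α × γ)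
  | [] => []
  | a :: l => s.1 ((a, Classical.arbitrary γ) :: lipII s l)

noncomputable def lipx (p : ℕ → List (α × γ)) : ℕ → α := fun n => (hdd (p (2*n+1))).1
noncomputable def lipy (p : ℕ → List (α × γ)) : ℕ → γ := fun n => (hdd (p (2*n+2))).2

/-- alternate two sequences of nodes -/
lemma alt_play {A : Type} [Nonempty A] (e o : ℕ → List A) (h0 : e 0 = [])
    (h1 : ∀ n, (fullT A).IsChild (o n) (e n)) (h2 : ∀ n, (fullT A).IsChild (e (n+1)) (o n)) :
    ∃ p : ℕ → List A, (fullT A).IsPlay p ∧ (∀ n, p (2*n) = e n) ∧ (∀ n, p (2*n+1) = o n) := by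
  refine ⟨fun n => if n % 2 = 0 then e (n/2) else o (n/2), ?_, ?_, ?_⟩
  · have hl : ∀ n, (fullT A).len (e n) = 2 * n := by
      intro n
      induction n with
      | zero => rw [h0]; rfl
      | succ n ih => rw [(h2 n).1, (h1 n).1, ih]; ring
    intro n
    rcases Nat.even_or_odd' n with ⟨k, rfl | rfl⟩
    · have e1 : (2*k)/2 = k := by omega
      have e2 : (2*k+1)/2 = k := by omega
      have e3 : (2*k) % 2 = 0 := by omega
      have e4 : (2*k+1) % 2 ≠ 0 := by omega
      simp only [e1, e2, e3, e4, if_true, if_false]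
      exact ⟨hl k, (h1 k).2⟩
    · have e1 : (2*k+1+1)/2 = k+1 := by omega
      have e2 : (2*k+1)/2 = k := by omega
      have e3 : (2*k+1+1) % 2 = 0 := by omega
      have e4 : (2*k+1) % 2 ≠ 0 := by omega
      simp only [e1, e2, e3, e4, if_true, if_false]
      exact ⟨by rw [(h1 k).1, hl k], (h2 k).2⟩
  · intro n
    have e1 : (2*n)/2 = n := by omega
    have e3 : (2*n) % 2 = 0 := by omega
    simp only [e1, e3, if_true]
  · intro n
    have e1 : (2*n+1)/2 = n := by omega
    have e3 : (2*n+1) % 2 ≠ 0 := by omega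
    simp only [e1, e3, if_false]

variable [TopologicalSpace α] [DiscreteTopology α] [TopologicalSpace γ] [DiscreteTopology γ]

lemma play_eq {A : Type} [Nonempty A] {x y : ℕ → List A} (hx : (fullT A).IsPlay x)
    (hy : (fullT A).IsPlay y) {n : ℕ} (h : y n = x n) {m : ℕ} (hm : m ≤ n) : y m = x m := by
  rw [← hx.anc hm, ← hy.anc hm, h]

lemma lip_opn (U : Set ((ℕ → α) × (ℕ → γ))) (hU : IsOpen U) :
    (fullT (α × γ)).Opn {p | (lipx p, lipy p) ∈ U} := by
  intro p hp hpU
  rw [isOpen_prod_iff] at hU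
  obtain ⟨u, v, hu, hv, hpu, hpv, huv⟩ := hU _ _ hpU
  have key : ∀ {δ : Type} [TopologicalSpace δ] [DiscreteTopology δ] (w : ℕ → δ) (u : Set (ℕ → δ)),
      IsOpen u → w ∈ u → ∃ n, ∀ z, (∀ i < n, z i = w i) → z ∈ u := by
    intro δ _ _ w u hu hw
    obtain ⟨n, hn⟩ := (PiNat.isTopologicalBasis_cylinders (E := fun _ : ℕ => δ)).exists_subset_of_mem_open hw hu
    obtain ⟨⟨y, k, rfl⟩, h1, h2⟩ := hn
    refine ⟨k, fun z hz => h2 ?_⟩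
    rw [PiNat.mem_cylinder_iff] at *
    intro i hi
    rw [hz i hi, h1 i hi]
  obtain ⟨n, hn⟩ := key _ _ hu hpu
  obtain ⟨m, hm⟩ := key _ _ hv hpv
  refine ⟨2*n + 2*m + 2, fun q hq hqp => ?_⟩
  refine huv ⟨hn _ fun i hi => ?_, hm _ fun i hi => ?_⟩
  · simp only [lipx]; rw [play_eq hp hq hqp (by omega)]
  · simp only [lipy]; rw [play_eq hp hq hqp (by omega)]

lemma lip_gen (P : Set ((ℕ → α) × (ℕ → γ)))
    (hP : MeasurableSpace.GenerateMeasurable {s | IsOpen s} P) :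
    MeasurableSpace.GenerateMeasurable {D | (fullT (α × γ)).Opn D}
      {p : ℕ → List (α × γ) | (lipx p, lipy p) ∈ P} := by
  induction hP with
  | basic u hu => exact .basic _ (lip_opn u hu)
  | empty => exact .empty
  | compl t _ ih => exact .compl _ ih
  | iUnion f _ ih =>
    have := MeasurableSpace.GenerateMeasurable.iUnion _ ih
    convert this using 1
    ext p; simp only [mem_iUnion]; exact Iff.rfl

/-- Borel determinacy for the Lipschitz game -/
theorem lip_game (P : Set ((ℕ → α) × (ℕ → γ))) (hP : @MeasurableSet _ (borel _) P) :
    (∃ τ : List α → γ, ∀ x : ℕ → α, (x, fun n => τ (PiNat.res x (n+1))) ∈ P) ∨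
    (∃ σ : List γ → α, ∀ y : ℕ → γ, (fun n => σ (PiNat.res y n), y) ∉ P) := by
  rcases det_of_gen _ _ (lip_gen Pᶜ (.compl _ hP)) with ⟨s, hs⟩ | ⟨s, hs⟩
  · right
    refine ⟨fun l => (hdd (A := α × γ) (s.1 (lipI s l))).1, fun y => ?_⟩
    obtain ⟨p, hp, he, ho⟩ := alt_play (fun n => lipI s (PiNat.res y n))
      (fun n => s.1 (lipI s (PiNat.res y n))) rfl (fun n => s.2 _)
      (fun n => fullT_child' (A := α × γ) _ _)
    have : (lipx p, lipy p) ∈ Pᶜ := hs p hp (by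
      intro n hn
      obtain ⟨k, rfl⟩ : ∃ k, n = 2 * k := ⟨n/2, by omega⟩
      rw [ho, he])
    have h1 : lipx p = fun n => (hdd (A := α × γ) (s.1 (lipI s (PiNat.res y n)))).1 := by
      funext n; simp only [lipx]; rw [ho]
    have h2 : lipy p = y := by
      funext n; simp only [lipy]; rw [show 2*n+2 = 2*(n+1) by ring, he]; rfl
    rw [h1, h2] at this
    exact this
  · left
    refine ⟨fun l => (hdd (lipII s l)).2, fun x => ?_⟩
    obtain ⟨p, hp, he, ho⟩ := alt_play (fun n => lipII s (PiNat.res x n))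
      (fun n => (x n, Classical.arbitrary γ) :: lipII s (PiNat.res x n)) rfl
      (fun n => fullT_child' (A := α × γ) _ _)
      (fun n => s.2 _)
    have : ¬ (lipx p, lipy p) ∈ Pᶜ := hs p hp (by
      intro n hn
      obtain ⟨k, rfl⟩ : ∃ k, n = 2 * k + 1 := ⟨n/2, by omega⟩
      rw [ho, show 2*k+1+1 = 2*(k+1) by ring, he]; rfl)
    have h1 : lipx p = x := by
      funext n; simp only [lipx]; rw [ho]; rfl
    have h2 : lipy p = fun n => (hdd (lipII s (PiNat.res x (n+1)))).2 := by
      funext n; simp only [lipy]; rw [show 2*n+2 = 2*(n+1) by ring, he]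
    rw [h1, h2] at this
    exact not_not.1 this

end lip

end BD


namespace BD

/-! Sequences, prefixes -/

def EqU {α : Type} (n : ℕ) (x y : ℕ → α) : Prop := ∀ i < n, x i = y i

lemma EqU.refl {α : Type} (n : ℕ) (x : ℕ → α) : EqU n x x := fun _ _ => rfl
lemma EqU.symm {α : Type} {n : ℕ} {x y : ℕ → α} (h : EqU n x y) : EqU n y x :=
  fun i hi => (h i hi).symm
lemma EqU.trans {α : Type} {n : ℕ} {x y z : ℕ → α} (h : EqU n x y) (h' : EqU n y z) : EqU n x z :=
  fun i hi => (h i hi).trans (h' i hi)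
lemma EqU.mono {α : Type} {m n : ℕ} {x y : ℕ → α} (h : EqU n x y) (hm : m ≤ n) : EqU m x y :=
  fun i hi => h i (hi.trans_le hm)
lemma EqU.eq {α : Type} {x y : ℕ → α} (h : ∀ n, EqU n x y) : x = y :=
  funext fun n => h (n+1) n (Nat.lt_succ_self n)
lemma EqU.res {α : Type} {n : ℕ} {x y : ℕ → α} (h : EqU n x y) : PiNat.res x n = PiNat.res y n :=
  PiNat.res_eq_res.2 fun _ hm => h _ hm

section top
variable {α β : Type} [TopologicalSpace α] [DiscreteTopology α]
  [TopologicalSpace β] [DiscreteTopology β]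

lemma cyl_open (x : ℕ → α) (n : ℕ) : IsOpen {z | EqU n z x} := by
  have := PiNat.isOpen_cylinder (E := fun _ : ℕ => α) x n
  convert this using 1
  ext z; rw [PiNat.mem_cylinder_iff]; rfl

lemma open_pre {U : Set (ℕ → α)} (hU : IsOpen U) {x : ℕ → α} (hx : x ∈ U) :
    ∃ n, ∀ z, EqU n z x → z ∈ U := by
  obtain ⟨_, ⟨y, k, rfl⟩, h1, h2⟩ :=
    (PiNat.isTopologicalBasis_cylinders (E := fun _ : ℕ => α)).exists_subset_of_mem_open hx hU
  refine ⟨k, fun z hz => h2 ?_⟩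
  rw [PiNat.mem_cylinder_iff] at *
  intro i hi
  rw [hz i hi, h1 i hi]

lemma isOpen_pre {U : Set (ℕ → α)} (h : ∀ x ∈ U, ∃ n, ∀ z, EqU n z x → z ∈ U) : IsOpen U := by
  rw [isOpen_iff_forall_mem_open]
  intro x hx
  obtain ⟨n, hn⟩ := h x hx
  exact ⟨_, hn, cyl_open x n, EqU.refl _ _⟩

lemma cyl_clopen (x : ℕ → α) (n : ℕ) : IsClopen {z | EqU n z x} := by
  refine ⟨⟨isOpen_pre fun y hy => ⟨n, fun z hz h => hy (hz.symm.trans h)⟩⟩, cyl_open x n⟩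

lemma co_iff {f : (ℕ → α) → (ℕ → β)} {D : Set (ℕ → α)} :
    ContinuousOn f D ↔ ∀ x ∈ D, ∀ k, ∃ n, ∀ z ∈ D, EqU n z x → EqU k (f z) (f x) := by
  constructor
  · intro h x hx k
    have h1 := (h x hx).eventually (IsOpen.mem_nhds (cyl_open (f x) k) (EqU.refl _ _))
    rw [eventually_nhdsWithin_iff] at h1
    obtain ⟨U, hU, hUo, hxU⟩ := eventually_nhds_iff.1 h1
    obtain ⟨n, hn⟩ := open_pre hUo hxU
    exact ⟨n, fun z hz hzx => hU z (hn z hzx) hz⟩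
  · intro h x hx
    rw [ContinuousWithinAt, Filter.tendsto_def]
    intro s hs
    obtain ⟨t, hts, hto, hxt⟩ := mem_nhds_iff.1 hs
    obtain ⟨k, hk⟩ := open_pre hto hxt
    obtain ⟨n, hn⟩ := h x hx k
    rw [mem_nhdsWithin]
    exact ⟨_, cyl_open x n, EqU.refl _ _, fun z hz => hts (hk _ (hn z hz.2 hz.1))⟩

lemma cont_iff {f : (ℕ → α) → (ℕ → β)} :
    Continuous f ↔ ∀ x, ∀ k, ∃ n, ∀ z, EqU n z x → EqU k (f z) (f x) := by
  rw [← continuousOn_univ, co_iff]; simp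

lemma strat_cont (σ : List α → β) : Continuous fun (y : ℕ → α) (n : ℕ) => σ (PiNat.res y n) := by
  rw [cont_iff]
  exact fun x k => ⟨k, fun z hz i hi => by simp only; rw [(hz.mono hi.le).res]⟩

lemma strat_cont' (σ : List α → β) :
    Continuous fun (y : ℕ → α) (n : ℕ) => σ (PiNat.res y (n+1)) := by
  rw [cont_iff]
  exact fun x k => ⟨k, fun z hz i hi => by simp only; rw [(hz.mono (Nat.succ_le_of_lt hi)).res]⟩

end top

/-! removing blanks -/

lemma nth_local (p p' : ℕ → Prop) (hp : {n | p n}.Infinite) (k : ℕ)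
    (h : ∀ i ≤ Nat.nth p k, (p i ↔ p' i)) : Nat.nth p' k = Nat.nth p k := by
  classical
  have h1 : p (Nat.nth p k) := Nat.nth_mem_of_infinite hp k
  have hc : ∀ n ≤ Nat.nth p k, Nat.count p' n = Nat.count p n := by
    intro n
    induction n with
    | zero => simp
    | succ n ih =>
      intro hn
      rw [Nat.count_succ, Nat.count_succ, ih (by omega)]
      simp only [h n (by omega)]
  have h2 := Nat.nth_count ((h _ le_rfl).1 h1)
  rw [hc _ le_rfl, Nat.count_nth_of_infinite hp] at h2
  exact h2

noncomputable def dep {β : Type} [Nonempty β] (w : ℕ → Option β) : ℕ → β :=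
  fun k => (w (Nat.nth (fun n => (w n).isSome = true) k)).getD (Classical.arbitrary β)

def InfD {β : Type} (w : ℕ → Option β) : Prop := {n | (w n).isSome = true}.Infinite

lemma dep_local {β : Type} [Nonempty β] {w w' : ℕ → Option β} (hw : InfD w) (k : ℕ)
    (h : EqU (Nat.nth (fun n => (w n).isSome = true) k + 1) w' w) : dep w' k = dep w k := by
  unfold dep
  rw [nth_local (fun n => (w n).isSome = true) (fun n => (w' n).isSome = true) hw k
    (fun i hi => by rw [h i (by omega)]), h _ (by omega)]

lemma dep_cont {β : Type} [Nonempty β] [TopologicalSpace β] [DiscreteTopology β]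
    [TopologicalSpace (Option β)] [DiscreteTopology (Option β)] :
    ContinuousOn (dep : (ℕ → Option β) → (ℕ → β)) {w | InfD w} := by
  rw [co_iff]
  intro w hw k
  refine ⟨Nat.nth (fun n => (w n).isSome = true) k + 1, fun z _ hz i hi => dep_local hw i ?_⟩
  refine hz.mono ?_
  have := Nat.nth_monotone hw hi.le
  omega

lemma dep_some {β : Type} [Nonempty β] (y : ℕ → β) : dep (fun n => some (y n)) = y := by
  funext k
  have h : Nat.nth (fun n => (some (y n)).isSome = true) k = k := by
    have h2 := Nat.nth_count (p := fun n => (some (y n)).isSome = true) (n := k) rfl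
    have h3 : Nat.count (fun n => (some (y n)).isSome = true) k = k :=
      Nat.count_of_forall (fun _ _ => rfl)
    rwa [h3] at h2
  simp only [dep, h, Option.getD_some]

lemma infD_some {β : Type} (y : ℕ → β) : InfD (fun n => some (y n)) := by
  unfold InfD
  simp only [Option.isSome_some]
  exact Set.infinite_univ

lemma infD_iff {β : Type} (w : ℕ → Option β) : InfD w ↔ ∀ n, ∃ m, n ≤ m ∧ (w m).isSome = true := by
  unfold InfD
  rw [Set.infinite_iff_exists_gt]
  constructor
  · intro h n; obtain ⟨m, h1, h2⟩ := h n; exact ⟨m, h2.le, h1⟩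
  · intro h n; obtain ⟨m, h1, h2⟩ := h (n+1); exact ⟨m, h2, h1⟩

abbrev Bor {T : Type} [TopologicalSpace T] (B : Set T) : Prop := @MeasurableSet T (borel T) B

lemma bor_open {T : Type} [TopologicalSpace T] {B : Set T} (h : IsOpen B) : Bor B := by
  let := borel T; have : BorelSpace T := ⟨rfl⟩; exact h.measurableSet

lemma bor_closed {T : Type} [TopologicalSpace T] {B : Set T} (h : IsClosed B) : Bor B := by
  let := borel T; have : BorelSpace T := ⟨rfl⟩; exact h.measurableSet

lemma bor_gd {T : Type} [TopologicalSpace T] {B : Set T} (h : IsGδ B) : Bor B := by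
  let := borel T; have : BorelSpace T := ⟨rfl⟩; exact h.measurableSet

lemma bor_compl {T : Type} [TopologicalSpace T] {B : Set T} (h : Bor B) : Bor Bᶜ :=
  @MeasurableSet.compl T _ (borel T) h

lemma bor_inter {T : Type} [TopologicalSpace T] {B C : Set T} (h : Bor B) (h' : Bor C) :
    Bor (B ∩ C) := @MeasurableSet.inter T (borel T) _ _ h h'

lemma bor_union {T : Type} [TopologicalSpace T] {B C : Set T} (h : Bor B) (h' : Bor C) :
    Bor (B ∪ C) := @MeasurableSet.union T (borel T) _ _ h h'

lemma bor_pre {S T : Type} [TopologicalSpace S] [TopologicalSpace T] {f : S → T} {D : Set S}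
    (hf : ContinuousOn f D) (hD : Bor D) {B : Set T} (hB : Bor B) : Bor (D ∩ f ⁻¹' B) := by
  let := borel S; have : BorelSpace S := ⟨rfl⟩
  let := borel T; have : BorelSpace T := ⟨rfl⟩
  have h1 : Measurable (D.domRestrict f) := (continuousOn_iff_continuous_domRestrict.1 hf).measurable
  have h2 := MeasurableSet.subtype_image hD (h1 hB)
  convert h2 using 1
  ext x
  constructor
  · rintro ⟨h, h'⟩; exact ⟨⟨x, h⟩, h', rfl⟩
  · rintro ⟨⟨y, h⟩, h', rfl⟩; exact ⟨h, h'⟩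

lemma bor_pre' {S T : Type} [TopologicalSpace S] [TopologicalSpace T] {f : S → T}
    (hf : Continuous f) {B : Set T} (hB : Bor B) : Bor (f ⁻¹' B) := by
  have := bor_pre (D := univ) hf.continuousOn (bor_open isOpen_univ) hB
  rwa [univ_inter] at this

lemma infD_gd {β : Type} [TopologicalSpace (Option β)] [DiscreteTopology (Option β)] :
    IsGδ {w : ℕ → Option β | InfD w} := by
  have : {w : ℕ → Option β | InfD w} = ⋂ n : ℕ, {w | ∃ m, n ≤ m ∧ (w m).isSome = true} := by
    ext w; simp only [mem_iInter]; exact infD_iff w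
  rw [this]
  refine IsGδ.iInter_of_isOpen fun n => isOpen_pre ?_
  rintro w ⟨m, h1, h2⟩
  exact ⟨m+1, fun z hz => ⟨m, h1, by rw [hz m (by omega)]; exact h2⟩⟩

/-- Wadge's lemma for relativized pairs -/
theorem wadge {α β : Type} [Nonempty α] [Nonempty β] [TopologicalSpace α] [DiscreteTopology α]
    [TopologicalSpace β] [DiscreteTopology β] 
    {D A : Set (ℕ → α)} {D' A' : Set (ℕ → β)} (hD : Bor D) (hA : Bor A) (hD' : Bor D')
    (hA' : Bor A') :
    (∃ f : (ℕ → α) → (ℕ → β), ContinuousOn f D ∧ ∀ x ∈ D, f x ∈ D' ∧ (x ∈ A ↔ f x ∈ A')) ∨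
    (∃ σ : List β → α, ∀ y : ℕ → β, (fun n => σ (PiNat.res y n)) ∈ D ∧
      (y ∈ D' → ((fun n => σ (PiNat.res y n)) ∈ A ↔ y ∉ A'))) := by
  let : TopologicalSpace (Option β) := ⊥
  have : DiscreteTopology (Option β) := ⟨rfl⟩
  let P : Set ((ℕ → α) × (ℕ → Option β)) :=
    (Prod.fst ⁻¹' D)ᶜ ∪ ((Prod.snd ⁻¹' ({w | InfD w} ∩ dep ⁻¹' D')) ∩
      (((Prod.fst ⁻¹' A) ∩ (Prod.snd ⁻¹' ({w | InfD w} ∩ dep ⁻¹' A'))) ∪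
       ((Prod.fst ⁻¹' A)ᶜ ∩ (Prod.snd ⁻¹' ({w | InfD w} ∩ dep ⁻¹' A'))ᶜ)))
  have hI : Bor {w : ℕ → Option β | InfD w} := bor_gd infD_gd
  have b1 := bor_pre dep_cont hI hD'
  have b2 := bor_pre dep_cont hI hA'
  have hP : Bor P := by
    refine bor_union (bor_compl (bor_pre' continuous_fst hD)) (bor_inter (bor_pre' continuous_snd b1)
      (bor_union (bor_inter (bor_pre' continuous_fst hA) (bor_pre' continuous_snd b2))
        (bor_inter (bor_compl (bor_pre' continuous_fst hA))
          (bor_compl (bor_pre' continuous_snd b2)))))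
  have hPm : ∀ x w, (x, w) ∈ P ↔ (x ∈ D → InfD w ∧ dep w ∈ D' ∧ (x ∈ A ↔ dep w ∈ A')) := by
    intro x w
    simp only [P, mem_union, mem_inter_iff, mem_compl_iff, mem_preimage, mem_ofPred_eq]
    tauto
  rcases lip_game P hP with ⟨τ, hτ⟩ | ⟨σ, hσ⟩
  · left
    refine ⟨fun x => dep fun n => τ (PiNat.res x (n+1)), ?_, fun x hx => ((hPm _ _).1 (hτ x) hx).2⟩
    exact dep_cont.comp (strat_cont' τ).continuousOn (fun x hx => ((hPm _ _).1 (hτ x) hx).1)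
  · right
    refine ⟨fun l => σ (l.map some), fun y => ?_⟩
    have hm : ∀ n, (PiNat.res y n).map some = PiNat.res (fun n => some (y n)) n := by
      intro n
      induction n with
      | zero => rfl
      | succ n ih => simp only [PiNat.res_succ, List.map_cons, ih]
    simp only [hm]
    have := hσ (fun n => some (y n))
    rw [hPm, dep_some] at this
    have h2 := infD_some y
    tauto

end BD


namespace BD

/-! cones -/

def cn (l : List Bool) : Set Cantor := {z | PiNat.res z l.length = l}

abbrev cyl (x : Cantor) (n : ℕ) : Set Cantor := cn (PiNat.res x n)

lemma mem_cyl {z x : Cantor} {n : ℕ} : z ∈ cyl x n ↔ EqU n z x := by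
  show PiNat.res z (PiNat.res x n).length = _ ↔ _
  rw [PiNat.res_length]
  exact ⟨fun h i hi => PiNat.res_eq_res.1 h hi, fun h => h.res⟩

lemma self_cyl (x : Cantor) (n : ℕ) : x ∈ cyl x n := mem_cyl.2 (EqU.refl _ _)

lemma cn_eq {l : List Bool} {z : Cantor} (h : z ∈ cn l) : l = PiNat.res z l.length := h.symm

lemma cn_cyl {l : List Bool} {z : Cantor} (h : z ∈ cn l) : cn l = cyl z l.length := by
  unfold cyl; rw [← cn_eq h]

lemma cn_open (l : List Bool) : IsOpen (cn l) := by
  refine isOpen_pre fun x hx => ⟨l.length, fun z hz => ?_⟩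
  rw [cn_cyl hx]; exact mem_cyl.2 hz

lemma cn_closed (l : List Bool) : IsClosed (cn l) := by
  refine ⟨isOpen_pre fun x hx => ⟨l.length, fun z hz hzl => hx ?_⟩⟩
  rw [cn_cyl hzl]; exact mem_cyl.2 hz.symm

lemma cn_sub {l l' : List Bool} {z : Cantor} (h : z ∈ cn l) (h' : z ∈ cn l')
    (hl : l.length ≤ l'.length) : cn l' ⊆ cn l := by
  rw [cn_cyl h, cn_cyl h']
  intro w hw
  exact mem_cyl.2 ((mem_cyl.1 hw).mono hl)

lemma cn_uniq {l l' : List Bool} {z : Cantor} (h : z ∈ cn l) (h' : z ∈ cn l')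
    (hl : l.length = l'.length) : l = l' := by
  rw [cn_eq h, cn_eq h', hl]

lemma cn_nil : cn [] = univ := by
  ext z; simp [cn]

lemma cyl_mono {x : Cantor} {m n : ℕ} (h : m ≤ n) : cyl x n ⊆ cyl x m :=
  fun _ hz => mem_cyl.2 ((mem_cyl.1 hz).mono h)

lemma open_cyl {U : Set Cantor} (hU : IsOpen U) {x : Cantor} (hx : x ∈ U) : ∃ n, cyl x n ⊆ U := by
  obtain ⟨n, hn⟩ := open_pre hU hx
  exact ⟨n, fun z hz => hn z (mem_cyl.1 hz)⟩

lemma mem_closure_cyl {S : Set Cantor} {x : Cantor} :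
    x ∈ closure S ↔ ∀ n, ∃ y ∈ S, y ∈ cyl x n := by
  rw [mem_closure_iff]
  constructor
  · intro h n
    obtain ⟨y, h1, h2⟩ := h _ (cn_open _) (self_cyl x n)
    exact ⟨y, h2, h1⟩
  · intro h o ho hx
    obtain ⟨n, hn⟩ := open_cyl ho hx
    obtain ⟨y, h1, h2⟩ := h n
    exact ⟨y, hn h2, h1⟩

/-- minimal cones inside an open set -/
def MC (O : Set Cantor) (n : ℕ) : Set (List Bool) :=
  {l | n ≤ l.length ∧ cn l ⊆ O ∧ ∀ z ∈ cn l, ∀ k, n ≤ k → k < l.length → ¬ cyl z k ⊆ O}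

lemma mc_ex {O : Set Cantor} (hO : IsOpen O) (n : ℕ) {z : Cantor} (hz : z ∈ O) :
    ∃ l ∈ MC O n, z ∈ cn l := by
  classical
  have h : ∃ k, n ≤ k ∧ cyl z k ⊆ O := by
    obtain ⟨k, hk⟩ := open_cyl hO hz
    exact ⟨max n k, le_max_left _ _, (cyl_mono (le_max_right _ _)).trans hk⟩
  have h1 := Nat.find_spec h
  refine ⟨PiNat.res z (Nat.find h), ⟨by rw [PiNat.res_length]; exact h1.1, h1.2, ?_⟩, self_cyl _ _⟩
  intro w hw k hk hkl hsub
  rw [PiNat.res_length] at hkl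
  refine Nat.find_min h hkl ⟨hk, ?_⟩
  intro v hv
  refine hsub (mem_cyl.2 ((mem_cyl.1 hv).trans ?_))
  exact ((mem_cyl.1 hw).mono hkl.le).symm

lemma mc_uniq {O : Set Cantor} {n : ℕ} {l l' : List Bool} (h : l ∈ MC O n) (h' : l' ∈ MC O n)
    {z : Cantor} (hz : z ∈ cn l) (hz' : z ∈ cn l') : l = l' := by
  rcases lt_trichotomy l.length l'.length with hl | hl | hl
  · exact absurd (by rw [← cn_cyl hz]; exact h.2.1) (h'.2.2 z hz' l.length h.1 hl)
  · exact cn_uniq hz hz' hl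
  · exact absurd (by rw [← cn_cyl hz']; exact h'.2.1) (h.2.2 z hz l'.length h'.1 hl)

def NowC (X : Set Cantor) : Prop := ∀ x ∈ X, ∀ n, ¬ IsCompact (X ∩ cyl x n)

lemma inf_part {X : Set Cantor} (hX : NowC X) {U : Set Cantor} (hU : IsOpen U)
    (hne : (X ∩ U).Nonempty) (n : ℕ) (ι : Type) [Countable ι] [Infinite ι] :
    ∃ d : ι → List Bool, (∀ i, n ≤ (d i).length ∧ cn (d i) ⊆ U ∧ (X ∩ cn (d i)).Nonempty) ∧
      (∀ i j z, z ∈ cn (d i) → z ∈ cn (d j) → i = j) ∧ ∀ z ∈ X ∩ U, ∃ i, z ∈ cn (d i) := by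
  obtain ⟨x, hx, hxU⟩ := hne
  obtain ⟨m, hm⟩ := open_cyl hU hxU
  have h1 : ¬ IsClosed (X ∩ cyl x m) := fun h => hX x hx m h.isCompact
  obtain ⟨p, hp, hpX⟩ : ∃ p, p ∈ closure (X ∩ cyl x m) ∧ p ∉ X ∩ cyl x m := by
    by_contra hcon
    push Not at hcon
    exact h1 (isClosed_of_closure_subset hcon)
  have hpc : p ∈ cyl x m := (cn_closed _).closure_subset_iff.2 inter_subset_right hp
  have hpX' : p ∉ X := fun h => hpX ⟨h, hpc⟩
  let O := U \ {p}
  have hO : IsOpen O := hU.sdiff isClosed_singleton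
  let P : Set (List Bool) := {l | l ∈ MC O n ∧ (X ∩ cn l).Nonempty}
  have hcov : ∀ z ∈ X ∩ U, ∃ l ∈ P, z ∈ cn l := by
    rintro z ⟨h1, h2⟩
    obtain ⟨l, h3, h4⟩ := mc_ex hO n (z := z) ⟨h2, fun h => hpX' (by rw [← mem_singleton_iff.1 h]; exact h1)⟩
    exact ⟨l, ⟨h3, z, h1, h4⟩, h4⟩
  have hinf : P.Infinite := by
    intro hfin
    have hcl : IsClosed (⋃ l ∈ P, cn l) := hfin.isClosed_biUnion fun l _ => cn_closed l
    have hsub : closure (X ∩ cyl x m) ⊆ ⋃ l ∈ P, cn l := by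
      refine closure_minimal ?_ hcl
      rintro z ⟨h1, h2⟩
      obtain ⟨l, h3, h4⟩ := hcov z ⟨h1, hm h2⟩
      exact mem_biUnion h3 h4
    obtain ⟨l, hl, hpl⟩ := mem_iUnion₂.1 (hsub hp)
    exact (hl.1.2.1 hpl).2 rfl
  haveI : Infinite P := hinf.to_subtype
  obtain ⟨e⟩ := nonempty_equiv_of_countable (α := ι) (β := P)
  refine ⟨fun i => (e i).1, fun i => ⟨(e i).2.1.1, (e i).2.1.2.1.trans diff_subset, (e i).2.2⟩, ?_, ?_⟩
  · intro i j z h1 h2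
    exact e.injective (Subtype.ext (mc_uniq (e i).2.1 (e j).2.1 h1 h2))
  · intro z hz
    obtain ⟨l, h1, h2⟩ := hcov z hz
    exact ⟨e.symm ⟨l, h1⟩, by simp only [e.apply_symm_apply]; exact h2⟩

/-- one half of a Knaster-Reichbach step -/
structure Half (X Y : Set Cantor) (c c' : List Bool) (n : ℕ) (H : Cantor → Cantor → Prop)
    (P : List Bool → List Bool → Prop) : Prop where
  cov : ∀ x ∈ X, x ∈ cn c → (∃ y, H x y) ∨ ∃ d d', P d d' ∧ x ∈ cn d
  mem : ∀ x y, H x y → x ∈ X ∧ x ∈ cn c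
  uniq : ∀ x y y', H x y → H x y' → y = y'
  sub : ∀ d d', P d d' → cn d ⊆ cn c ∧ (X ∩ cn d).Nonempty ∧ n ≤ d.length
  off : ∀ d d' x y, P d d' → H x y → x ∉ cn d
  disj : ∀ d d' e e' z, P d d' → P e e' → z ∈ cn d → z ∈ cn e → d = e ∧ d' = e'
  conv : ∀ a b, H a b → ∀ k, ∃ m, ∀ d d', P d d' → (cn d ∩ cyl a m).Nonempty → cn d' ⊆ cyl b k
  cts : ∀ a b, H a b → ∀ k, ∃ m, ∀ a' b', H a' b' → a' ∈ cyl a m → b' ∈ cyl b k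

def Step (X Y : Set Cantor) (c c' : List Bool) (n : ℕ) (H : Cantor → Cantor → Prop)
    (P : List Bool → List Bool → Prop) : Prop :=
  Half X Y c c' n H P ∧ Half Y X c' c n (fun y x => H x y) (fun d' d => P d d')

end BD


namespace BD

/-- homeomorphism between subsets of the Cantor space -/
def SH (X Y : Set Cantor) : Prop :=
  ∃ f g : Cantor → Cantor, ContinuousOn f X ∧ ContinuousOn g Y ∧
    (∀ x ∈ X, f x ∈ Y ∧ g (f x) = x) ∧ (∀ y ∈ Y, g y ∈ X ∧ f (g y) = y)

section asm

variable (P : ℕ → List Bool → List Bool → List Bool → List Bool → Prop)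
  (H : ℕ → List Bool → List Bool → Cantor → Cantor → Prop)

def Node : ℕ → List Bool → List Bool → Prop
  | 0, c, c' => c = [] ∧ c' = []
  | n+1, d, d' => ∃ c c', Node n c c' ∧ P n c c' d d'

def sw {A B : Type} (P : ℕ → A → A → B → B → Prop) : ℕ → A → A → B → B → Prop :=
  fun n c c' d d' => P n c' c d' d

lemma node_sw (n : ℕ) : ∀ c c', Node (sw P) n c' c ↔ Node P n c c' := by
  induction n with
  | zero => exact fun c c' => and_comm
  | succ n ih =>
    intro d d'
    constructor
    · rintro ⟨c, c', h1, h2⟩; exact ⟨c', c, (ih _ _).1 h1, h2⟩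
    · rintro ⟨c, c', h1, h2⟩; exact ⟨c', c, (ih _ _).2 h1, h2⟩

def TT (x y : Cantor) : Prop :=
  (∃ n c c', Node P n c c' ∧ H n c c' x y) ∨ (∀ n, ∃ c c', Node P n c c' ∧ x ∈ cn c ∧ y ∈ cn c')

lemma tt_sw (x y : Cantor) : TT (sw P) (sw H) y x ↔ TT P H x y := by
  unfold TT
  constructor
  · rintro (⟨n, c, c', h1, h2⟩ | h)
    · exact Or.inl ⟨n, c', c, (node_sw P _ _ _).1 h1, h2⟩
    · right; intro n; obtain ⟨c, c', h1, h2, h3⟩ := h n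
      exact ⟨c', c, (node_sw P _ _ _).1 h1, h3, h2⟩
  · rintro (⟨n, c, c', h1, h2⟩ | h)
    · exact Or.inl ⟨n, c', c, (node_sw P _ _ _).2 h1, h2⟩
    · right; intro n; obtain ⟨c, c', h1, h2, h3⟩ := h n
      exact ⟨c', c, (node_sw P _ _ _).2 h1, h3, h2⟩

variable {P H} {X Y : Set Cantor}
  (hst : ∀ n c c', Node P n c c' → Step X Y c c' (n+1) (H n c c') (P n c c'))
include hst

lemma node_uniq (n : ℕ) : ∀ c c' e e' z, Node P n c c' → Node P n e e' → z ∈ cn c → z ∈ cn e →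
    c = e ∧ c' = e' := by
  induction n with
  | zero => rintro c c' e e' z ⟨rfl, rfl⟩ ⟨rfl, rfl⟩ _ _; exact ⟨rfl, rfl⟩
  | succ n ih =>
    rintro d d' e e' z ⟨c, c', h1, h2⟩ ⟨b, b', h3, h4⟩ hd he
    obtain ⟨rfl, rfl⟩ := ih c c' b b' z h1 h3 (((hst _ _ _ h1).1.sub _ _ h2).1 hd)
      (((hst _ _ _ h3).1.sub _ _ h4).1 he)
    exact (hst _ _ _ h1).1.disj _ _ _ _ z h2 h4 hd he

lemma node_len (n : ℕ) (c c' : List Bool) (h : Node P n c c') : n ≤ c.length ∧ n ≤ c'.length := by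
  cases n with
  | zero => exact ⟨Nat.zero_le _, Nat.zero_le _⟩
  | succ n =>
    obtain ⟨b, b', h1, h2⟩ := h
    exact ⟨((hst _ _ _ h1).1.sub _ _ h2).2.2, ((hst _ _ _ h1).2.sub _ _ h2).2.2⟩

lemma node_anc (n j : ℕ) : ∀ d d', Node P (n+1+j) d d' → ∃ c c' e e', Node P n c c' ∧
    P n c c' e e' ∧ cn d ⊆ cn e ∧ cn d' ⊆ cn e' := by
  induction j with
  | zero =>
    rintro d d' ⟨c, c', h1, h2⟩
    exact ⟨c, c', d, d', h1, h2, Subset.rfl, Subset.rfl⟩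
  | succ j ih =>
    rintro d d' ⟨c, c', h1, h2⟩
    obtain ⟨b, b', e, e', h3, h4, h5, h6⟩ := ih c c' h1
    exact ⟨b, b', e, e', h3, h4, ((hst _ _ _ h1).1.sub _ _ h2).1.trans h5,
      ((hst _ _ _ h1).2.sub _ _ h2).1.trans h6⟩

lemma tt_mem {x y : Cantor} (hT : TT P H x y) {n : ℕ} {c c' : List Bool} (hN : Node P n c c')
    (hx : x ∈ cn c) : H n c c' x y ∨ ∃ e e', P n c c' e e' ∧ x ∈ cn e ∧ y ∈ cn e' := by
  rcases hT with ⟨m, d, d', h1, h2⟩ | h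
  · have hxd := ((hst _ _ _ h1).1.mem _ _ h2).2
    have hyd := ((hst _ _ _ h1).2.mem _ _ h2).2
    rcases lt_trichotomy m n with hmn | rfl | hmn
    · obtain ⟨j, rfl⟩ := Nat.exists_eq_add_of_le (Nat.succ_le_of_lt hmn)
      obtain ⟨b, b', e, e', h3, h4, h5, h6⟩ := node_anc hst m j c c' hN
      obtain ⟨rfl, rfl⟩ := node_uniq hst m b b' d d' x h3 h1
        (((hst _ _ _ h3).1.sub _ _ h4).1 (h5 hx)) hxd
      exact absurd (h5 hx) ((hst _ _ _ h3).1.off _ _ _ _ h4 h2)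
    · obtain ⟨rfl, rfl⟩ := node_uniq hst m _ _ _ _ x hN h1 hx hxd
      exact Or.inl h2
    · obtain ⟨j, rfl⟩ := Nat.exists_eq_add_of_le (Nat.succ_le_of_lt hmn)
      obtain ⟨b, b', e, e', h3, h4, h5, h6⟩ := node_anc hst n j d d' h1
      obtain ⟨rfl, rfl⟩ := node_uniq hst n b b' c c' x h3 hN
        (((hst _ _ _ h3).1.sub _ _ h4).1 (h5 hxd)) hx
      exact Or.inr ⟨e, e', h4, h5 hxd, h6 hyd⟩
  · obtain ⟨d, d', ⟨b, b', h1, h2⟩, h3, h4⟩ := h (n+1)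
    obtain ⟨rfl, rfl⟩ := node_uniq hst n b b' c c' x h1 hN (((hst _ _ _ h1).1.sub _ _ h2).1 h3) hx
    exact Or.inr ⟨d, d', h2, h3, h4⟩

lemma tt_mem' {x y : Cantor} (hT : TT P H x y) {n : ℕ} {c c' : List Bool} (hN : Node P n c c')
    (hx : x ∈ cn c) : y ∈ cn c' := by
  rcases tt_mem hst hT hN hx with h | ⟨e, e', h1, h2, h3⟩
  · exact ((hst _ _ _ hN).2.mem _ _ h).2
  · exact ((hst _ _ _ hN).2.sub _ _ h1).1 h3

lemma tt_cont {x y : Cantor} (hT : TT P H x y) (k : ℕ) :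
    ∃ m, ∀ z w, TT P H z w → EqU m z x → EqU k w y := by
  rcases hT with ⟨n, c, c', h1, h2⟩ | h
  · obtain ⟨m1, hm1⟩ := (hst _ _ _ h1).1.conv _ _ h2 k
    obtain ⟨m2, hm2⟩ := (hst _ _ _ h1).1.cts _ _ h2 k
    have hxc := ((hst _ _ _ h1).1.mem _ _ h2).2
    refine ⟨c.length + m1 + m2, fun z w hT' hz => ?_⟩
    have hzc : z ∈ cn c := by rw [cn_cyl hxc]; exact mem_cyl.2 (hz.mono (by omega))
    rcases tt_mem hst hT' h1 hzc with h | ⟨e, e', h3, h4, h5⟩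
    · exact mem_cyl.1 (hm2 _ _ h (mem_cyl.2 (hz.mono (by omega))))
    · exact mem_cyl.1 (hm1 _ _ h3 ⟨z, h4, mem_cyl.2 (hz.mono (by omega))⟩ h5)
  · obtain ⟨c, c', h1, h2, h3⟩ := h k
    refine ⟨c.length, fun z w hT' hz => ?_⟩
    have hzc : z ∈ cn c := by rw [cn_cyl h2]; exact mem_cyl.2 hz
    have := tt_mem' hst hT' h1 hzc
    rw [cn_cyl h3] at this
    exact (mem_cyl.1 this).mono (node_len hst _ _ _ h1).2

lemma tt_uniq {x y y' : Cantor} (hT : TT P H x y) (hT' : TT P H x y') : y' = y := by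
  apply EqU.eq
  intro k
  obtain ⟨m, hm⟩ := tt_cont hst hT k
  exact hm x y' hT' (EqU.refl _ _)

lemma tt_total {F F' : ℕ → Set Cantor} {ε : Prop} (h1 : ∀ p, (∀ k, p ∉ F k) → p ∈ X → ε)
    (h2 : ∀ p, (∀ k, p ∉ F' k) → ε → p ∈ Y)
    (hF : ∀ k, ∃ n, ∀ c c', Node P n c c' → Disjoint (cn c) (F k))
    (hF' : ∀ k, ∃ n, ∀ c c', Node P n c c' → Disjoint (cn c') (F' k))
    {x : Cantor} (hx : x ∈ X) : ∃ y ∈ Y, TT P H x y := by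
  by_cases hex : ∃ n c c' y, Node P n c c' ∧ H n c c' x y
  · obtain ⟨n, c, c', y, h3, h4⟩ := hex
    exact ⟨y, ((hst _ _ _ h3).2.mem _ _ h4).1, Or.inl ⟨n, c, c', h3, h4⟩⟩
  · have hn : ∀ n, ∃ c c', Node P n c c' ∧ x ∈ cn c := by
      intro n
      induction n with
      | zero => exact ⟨[], [], ⟨rfl, rfl⟩, by rw [cn_nil]; trivial⟩
      | succ n ih =>
        obtain ⟨c, c', h3, h4⟩ := ih
        rcases (hst _ _ _ h3).1.cov x hx h4 with ⟨y, hy⟩ | ⟨d, d', h5, h6⟩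
        · exact absurd ⟨n, c, c', y, h3, hy⟩ hex
        · exact ⟨d, d', ⟨c, c', h3, h5⟩, h6⟩
    choose c c' hN hxc using hn
    have hP : ∀ n, P n (c n) (c' n) (c (n+1)) (c' (n+1)) := by
      intro n
      obtain ⟨b, b', h3, h4⟩ := hN (n+1)
      obtain ⟨rfl, rfl⟩ := node_uniq hst n _ _ _ _ x h3 (hN n)
        (((hst _ _ _ h3).1.sub _ _ h4).1 (hxc (n+1))) (hxc n)
      exact h4
    have hmono : ∀ m n, m ≤ n → cn (c' n) ⊆ cn (c' m) := by
      intro m n hmn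
      induction n, hmn using Nat.le_induction with
      | base => exact Subset.rfl
      | succ n _ ih => exact ((hst _ _ _ (hN n)).2.sub _ _ (hP n)).1.trans ih
    have hne : ∀ n, ∃ y, y ∈ cn (c' n) := by
      intro n
      obtain ⟨y, hy⟩ := ((hst _ _ _ (hN n)).2.sub _ _ (hP n)).2.1
      exact ⟨y, hmono n (n+1) (Nat.le_succ n) hy.2⟩
    choose w hw using hne
    have hy : ∀ n, (fun i => w (i+1) i) ∈ cn (c' n) := by
      intro n
      rw [cn_cyl (hw n)]
      refine mem_cyl.2 fun i hi => ?_
      have a1 := hw (max n (i+1))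
      have a2 := hmono n _ (le_max_left _ _) a1
      have a3 := hmono (i+1) _ (le_max_right n _) a1
      rw [cn_cyl (hw n)] at a2
      rw [cn_cyl (hw (i+1))] at a3
      show w (i+1) i = w n i
      rw [← mem_cyl.1 a2 i hi, mem_cyl.1 a3 i]
      have := (node_len hst _ _ _ (hN (i+1))).2
      omega
    refine ⟨_, h2 _ (fun k => ?_) (h1 x (fun k => ?_) hx), Or.inr fun n => ⟨_, _, hN n, hxc n, hy n⟩⟩
    · obtain ⟨n, hn⟩ := hF' k
      exact disjoint_left.1 (hn _ _ (hN n)) (hy n)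
    · obtain ⟨n, hn⟩ := hF k
      exact disjoint_left.1 (hn _ _ (hN n)) (hxc n)

end asm

lemma step_sw {X Y : Set Cantor} {c c' : List Bool} {n : ℕ} {H : Cantor → Cantor → Prop}
    {P : List Bool → List Bool → Prop} (h : Step X Y c c' n H P) :
    Step Y X c' c n (fun y x => H x y) (fun d' d => P d d') := ⟨h.2, h.1⟩

lemma assemble {X Y : Set Cantor} (F F' : ℕ → Set Cantor) (ε : Prop) (hX : X.Nonempty)
    (hY : Y.Nonempty)
    (h1 : ∀ p, (∀ k, p ∉ F k) → (p ∈ X ↔ ε)) (h2 : ∀ p, (∀ k, p ∉ F' k) → (p ∈ Y ↔ ε))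
    (hs : ∀ n c c', (X ∩ cn c).Nonempty → (Y ∩ cn c').Nonempty → ∃ H P,
      Step X Y c c' (n+1) H P ∧ ∀ d d', P d d' → (∀ k, n = 2*k → Disjoint (cn d) (F k)) ∧
        (∀ k, n = 2*k+1 → Disjoint (cn d') (F' k))) : SH X Y := by
  have hs' : ∀ n c c', ∃ H P, (X ∩ cn c).Nonempty → (Y ∩ cn c').Nonempty →
      Step X Y c c' (n+1) H P ∧ ∀ d d', P d d' → (∀ k, n = 2*k → Disjoint (cn d) (F k)) ∧
        (∀ k, n = 2*k+1 → Disjoint (cn d') (F' k)) := by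
    intro n c c'
    by_cases h : (X ∩ cn c).Nonempty ∧ (Y ∩ cn c').Nonempty
    · obtain ⟨H, P, hh⟩ := hs n c c' h.1 h.2
      exact ⟨H, P, fun _ _ => hh⟩
    · exact ⟨fun _ _ => True, fun _ _ => True, fun a b => absurd ⟨a, b⟩ h⟩
  choose H P hHP using hs'
  have hst0 : ∀ n c c', Node P n c c' → (X ∩ cn c).Nonempty ∧ (Y ∩ cn c').Nonempty := by
    intro n
    induction n with
    | zero =>
      rintro c c' ⟨rfl, rfl⟩
      rw [cn_nil, inter_univ, inter_univ]; exact ⟨hX, hY⟩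
    | succ n ih =>
      rintro d d' ⟨c, c', h3, h4⟩
      obtain ⟨h5, h6⟩ := ih _ _ h3
      have := (hHP n c c' h5 h6).1
      exact ⟨(this.1.sub _ _ h4).2.1, (this.2.sub _ _ h4).2.1⟩
  have hst : ∀ n c c', Node P n c c' → Step X Y c c' (n+1) (H n c c') (P n c c') :=
    fun n c c' h => (hHP n c c' (hst0 _ _ _ h).1 (hst0 _ _ _ h).2).1
  have hst' : ∀ n c c', Node (sw P) n c c' → Step Y X c c' (n+1) (sw H n c c') (sw P n c c') :=
    fun n c c' h => step_sw (hst n c' c ((node_sw P _ _ _).1 h))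
  have hF : ∀ k, ∃ n, ∀ c c', Node P n c c' → Disjoint (cn c) (F k) := by
    refine fun k => ⟨2*k+1, ?_⟩
    rintro d d' ⟨c, c', h3, h4⟩
    exact ((hHP _ c c' (hst0 _ _ _ h3).1 (hst0 _ _ _ h3).2).2 _ _ h4).1 k rfl
  have hF' : ∀ k, ∃ n, ∀ c c', Node P n c c' → Disjoint (cn c') (F' k) := by
    refine fun k => ⟨2*k+1+1, ?_⟩
    rintro d d' ⟨c, c', h3, h4⟩
    exact ((hHP _ c c' (hst0 _ _ _ h3).1 (hst0 _ _ _ h3).2).2 _ _ h4).2 k rfl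
  have t1 : ∀ x ∈ X, ∃ y, y ∈ Y ∧ TT P H x y := fun x hx =>
    tt_total hst (fun p hp => (h1 p hp).1) (fun p hp => (h2 p hp).2) hF hF' hx
  have t2 : ∀ y ∈ Y, ∃ x, x ∈ X ∧ TT P H x y := by
    intro y hy
    obtain ⟨x, hx, hT⟩ := tt_total hst' (fun p hp => (h2 p hp).1) (fun p hp => (h1 p hp).2)
      (fun k => (hF' k).imp fun n hn c c' h => hn _ _ ((node_sw P _ _ _).1 h))
      (fun k => (hF k).imp fun n hn c c' h => hn _ _ ((node_sw P _ _ _).1 h)) hy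
    exact ⟨x, hx, (tt_sw P H _ _).1 hT⟩
  choose! f hf using t1
  choose! g hg using t2
  refine ⟨f, g, ?_, ?_, fun x hx => ⟨(hf x hx).1, ?_⟩, fun y hy => ⟨(hg y hy).1, ?_⟩⟩
  · rw [co_iff]
    intro x hx k
    obtain ⟨m, hm⟩ := tt_cont hst (hf x hx).2 k
    exact ⟨m, fun z hz hzx => hm _ _ (hf z hz).2 hzx⟩
  · rw [co_iff]
    intro y hy k
    obtain ⟨m, hm⟩ := tt_cont hst' ((tt_sw P H _ _).2 (hg y hy).2) k
    exact ⟨m, fun z hz hzx => hm _ _ ((tt_sw P H _ _).2 (hg z hz).2) hzx⟩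
  · exact tt_uniq hst' ((tt_sw P H _ _).2 (hf x hx).2) ((tt_sw P H _ _).2 (hg _ (hf x hx).1).2)
  · exact tt_uniq hst (hg y hy).2 (hf _ (hg y hy).1).2

end BD


namespace BD

def VV (X A : Set Cantor) (c : List Bool) : Set (List Bool) :=
  {l | l ∈ MC (cn c \ closure A) c.length ∧ (X ∩ cn l).Nonempty}

def Nwd (X A : Set Cantor) : Prop := ∀ a ∈ A, ∀ m, ∃ x ∈ X ∩ cyl a m, x ∉ A

lemma vv_cov {X A : Set Cantor} {c : List Bool} (clA : X ∩ closure A ⊆ A) {x : Cantor}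
    (hx : x ∈ X ∩ cn c) (hxA : x ∉ A) : ∃ l ∈ VV X A c, x ∈ cn l := by
  obtain ⟨l, h1, h2⟩ := mc_ex ((cn_open c).sdiff (isClosed_closure (s := A))) c.length
    (z := x) ⟨hx.2, fun h => hxA (clA ⟨hx.1, h⟩)⟩
  exact ⟨l, ⟨h1, x, hx.1, h2⟩, h2⟩

lemma vv_par {X A : Set Cantor} {c : List Bool} (hAc : A ⊆ cn c) (hA : A.Nonempty) {l : List Bool}
    (hl : l ∈ VV X A c) : ∃ a ∈ A, cn l ⊆ cyl a (l.length - 1) := by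
  obtain ⟨⟨h1, h2, h3⟩, z, hzX, hz⟩ := hl
  obtain ⟨a0, ha0⟩ := hA
  have hzc := (h2 hz).1
  have hlt : c.length < l.length := by
    rcases Nat.eq_or_lt_of_le h1 with h | h
    · have := cn_uniq hzc hz h
      subst this
      exact absurd (subset_closure ha0) (h2 (hAc ha0)).2
    · exact h
  have h4 := h3 z hz (l.length - 1) (by omega) (by omega)
  rw [not_subset] at h4
  obtain ⟨p, hp, hpn⟩ := h4
  have hpc : p ∈ cn c := by
    rw [cn_cyl hzc]; exact cyl_mono (by omega) hp
  have hpA : p ∈ closure A := by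
    by_contra h; exact hpn ⟨hpc, h⟩
  obtain ⟨a, ha, hap⟩ := mem_closure_cyl.1 hpA (l.length - 1)
  refine ⟨a, ha, ?_⟩
  intro w hw
  rw [cn_cyl hz] at hw
  refine mem_cyl.2 (((mem_cyl.1 hw).mono (by omega)).trans ?_)
  exact (mem_cyl.1 hp).symm.trans (mem_cyl.1 hap).symm

lemma vv_near {Y B : Set Cantor} {c : List Bool} (clB : Y ∩ closure B ⊆ B) (hBc : B ⊆ cn c)
    (nwB : Nwd Y B) {b : Cantor} (hb : b ∈ B) (m : ℕ) : ∃ l ∈ VV Y B c, cn l ⊆ cyl b m := by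
  obtain ⟨y, ⟨hy, hyb⟩, hyB⟩ := nwB b hb (max m c.length)
  have hyc : y ∈ cn c := by
    rw [cn_cyl (hBc hb)]; exact cyl_mono (le_max_right _ _) hyb
  obtain ⟨l, hl, hyl⟩ := vv_cov clB ⟨hy, hyc⟩ hyB
  refine ⟨l, hl, ?_⟩
  have hyb' := cyl_mono (le_max_left m c.length) hyb
  rcases le_total m l.length with h | h
  · exact cn_sub hyb' hyl (by rwa [PiNat.res_length])
  · have := cn_sub hyl hyb' (by rwa [PiNat.res_length])
    exact absurd (subset_closure hb) (hl.1.2.1 (this (self_cyl b m))).2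

lemma vv_match {X A Y B : Set Cantor} {c c' : List Bool} (hAc : A ⊆ cn c)
    (clB : Y ∩ closure B ⊆ B) (hBc : B ⊆ cn c') (hY : (Y ∩ cn c').Nonempty)
    (nwB : Nwd Y B) {f : Cantor → Cantor} (hf : ∀ a ∈ A, f a ∈ B) (hBA : B.Nonempty → A.Nonempty)
    {l : List Bool} (hl : l ∈ VV X A c) :
    ∃ l' ∈ VV Y B c', A.Nonempty → ∃ a ∈ A, cn l ⊆ cyl a (l.length - 1) ∧
      cn l' ⊆ cyl (f a) l.length := by
  by_cases hA : A.Nonempty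
  · obtain ⟨a, ha, h1⟩ := vv_par hAc hA hl
    obtain ⟨l', h2, h3⟩ := vv_near clB hBc nwB (hf a ha) l.length
    exact ⟨l', h2, fun _ => ⟨a, ha, h1, h3⟩⟩
  · obtain ⟨y, hy⟩ := hY
    have : y ∉ B := fun h => hA (hBA ⟨y, h⟩)
    obtain ⟨l', h1, h2⟩ := vv_cov clB hy this
    exact ⟨l', h1, fun h => absurd h hA⟩

lemma vv_conv {X A Y B : Set Cantor} {c c' : List Bool} {f g : Cantor → Cantor}
    (fA : ContinuousOn f A) (hgf : ∀ b ∈ B, g b ∈ A ∧ f (g b) = b) (hAB : A.Nonempty → B.Nonempty)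
    (ww : VV X A c → VV Y B c') (vv : VV Y B c' → VV X A c)
    (hw : ∀ l : VV X A c, A.Nonempty → ∃ a ∈ A, cn l.1 ⊆ cyl a (l.1.length - 1) ∧
      cn (ww l).1 ⊆ cyl (f a) l.1.length)
    (hv : ∀ l : VV Y B c', B.Nonempty → ∃ b ∈ B, cn l.1 ⊆ cyl b (l.1.length - 1) ∧
      cn (vv l).1 ⊆ cyl (g b) l.1.length) {a : Cantor} (ha : a ∈ A) (k : ℕ) :
    ∃ m, (∀ l : VV X A c, (cn l.1 ∩ cyl a m).Nonempty → cn (ww l).1 ⊆ cyl (f a) k) ∧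
      (∀ l : VV Y B c', (cn (vv l).1 ∩ cyl a m).Nonempty → cn l.1 ⊆ cyl (f a) k) := by
  obtain ⟨m1, hm1⟩ := co_iff.1 fA a ha k
  have hlen : ∀ l : VV X A c, ∀ m, (cn l.1 ∩ cyl a m).Nonempty → m < l.1.length := by
    rintro l m ⟨z, hz, hza⟩
    by_contra hcon
    have : a ∈ cn l.1 := by
      rw [cn_cyl hz]; exact mem_cyl.2 ((mem_cyl.1 hza).symm.mono (by omega))
    exact (l.2.1.2.1 this).2 (subset_closure ha)
  have hfin : {l : VV Y B c' | l.1.length ≤ m1 + k + 1}.Finite :=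
    Set.Finite.preimage (Subtype.val_injective.injOn) (List.finite_length_le Bool (m1 + k + 1))
  obtain ⟨M, hM⟩ := (hfin.image fun l => (vv l).1.length).bddAbove
  have hM' : ∀ l : VV Y B c', l.1.length ≤ m1 + k + 1 → (vv l).1.length ≤ M :=
    fun l hl => hM (mem_image_of_mem _ hl)
  refine ⟨m1 + k + M, ?_, ?_⟩
  · rintro l ⟨z, hz, hza⟩
    have h1 := hlen l _ ⟨z, hz, hza⟩
    obtain ⟨a', ha', h2, h3⟩ := hw l ⟨a, ha⟩
    have h4 : EqU m1 a' a := ((mem_cyl.1 (h2 hz)).mono (by omega)).symm.trans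
      ((mem_cyl.1 hza).mono (by omega))
    have h5 := hm1 a' ha' h4
    intro w hw
    exact mem_cyl.2 (((mem_cyl.1 (h3 hw)).mono (by omega)).trans h5)
  · rintro l ⟨z, hz, hza⟩
    have h1 := hlen (vv l) _ ⟨z, hz, hza⟩
    have h2 : m1 + k + 1 < l.1.length := by
      by_contra hcon
      have := hM' l (by omega)
      omega
    obtain ⟨b, hb, h3, h4⟩ := hv l (hAB ⟨a, ha⟩)
    have h5 : EqU m1 (g b) a := ((mem_cyl.1 (h4 hz)).mono (by omega)).symm.trans
      ((mem_cyl.1 hza).mono (by omega))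
    have h6 := hm1 _ (hgf b hb).1 h5
    rw [(hgf b hb).2] at h6
    intro w hw
    exact mem_cyl.2 (((mem_cyl.1 (h3 hw)).mono (by omega)).trans h6)

lemma subdiv {X A : Set Cantor} (hX : NowC X) {c : List Bool} (clA : X ∩ closure A ⊆ A)
    {U : Set Cantor} (hU : IsOpen U) (hUX : ∀ x ∈ X ∩ cn c, x ∉ A → x ∈ U) (n : ℕ) {E : Type}
    [Countable E] (v : E → VV X A c) (hv : Function.Surjective v) :
    ∃ d : E → ℕ → List Bool, (∀ e j, n ≤ (d e j).length ∧ cn (d e j) ⊆ cn (v e).1 ∩ U ∧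
      (X ∩ cn (d e j)).Nonempty) ∧
      (∀ e j e' j' z, z ∈ cn (d e j) → z ∈ cn (d e' j') → e = e' ∧ j = j') ∧
      ∀ x ∈ X ∩ cn c, x ∉ A → ∃ e j, x ∈ cn (d e j) := by
  have h1 : ∀ l : VV X A c, ∃ d : {e // v e = l} × ℕ → List Bool,
      (∀ i, n ≤ (d i).length ∧ cn (d i) ⊆ cn l.1 ∩ U ∧ (X ∩ cn (d i)).Nonempty) ∧
      (∀ i j z, z ∈ cn (d i) → z ∈ cn (d j) → i = j) ∧ ∀ z ∈ X ∩ (cn l.1 ∩ U), ∃ i, z ∈ cn (d i) := by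
    intro l
    obtain ⟨e, he⟩ := hv l
    have : Nonempty {e // v e = l} := ⟨⟨e, he⟩⟩
    obtain ⟨x, hx, hxl⟩ := l.2.2
    have hh := l.2.1.2.1 hxl
    refine inf_part hX ((cn_open _).inter hU) ⟨x, hx, hxl, ?_⟩ n _
    exact hUX x ⟨hx, hh.1⟩ fun h => hh.2 (subset_closure h)
  choose d hd1 hd2 hd3 using h1
  refine ⟨fun e j => d (v e) (⟨e, rfl⟩, j), fun e j => hd1 _ _, ?_, ?_⟩
  · intro e j e' j' z hz hz'
    have hve : v e = v e' := by
      apply Subtype.ext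
      exact mc_uniq (v e).2.1 (v e').2.1 ((hd1 _ _).2.1 hz).1 ((hd1 _ _).2.1 hz').1
    have key : ∀ l (h : v e' = l), z ∈ cn (d l (⟨e', h⟩, j')) := by
      rintro _ rfl; exact hz'
    have := hd2 _ _ _ z hz (key _ hve.symm)
    simp only [Prod.mk.injEq, Subtype.mk.injEq] at this
    exact this
  · intro x hx hxA
    obtain ⟨l, hl, hxl⟩ := vv_cov clA hx hxA
    obtain ⟨⟨⟨e, he⟩, j⟩, hi⟩ := hd3 ⟨l, hl⟩ x ⟨hx.1, hxl, hUX x hx hxA⟩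
    refine ⟨e, j, ?_⟩
    have key : ∀ l' (h : v e = l'), x ∈ cn (d l' (⟨e, h⟩, j)) → x ∈ cn (d (v e) (⟨e, rfl⟩, j)) := by
      rintro _ rfl h; exact h
    exact key _ he hi

lemma mk_half {X A Y B : Set Cantor} {c c' : List Bool} {n : ℕ} {f : Cantor → Cantor} {E : Type}
    {U U' : Set Cantor}
    (hA : A ⊆ X ∩ cn c) (fA : ContinuousOn f A)
    (v : E → VV X A c) (w : E → VV Y B c') (d d' : E → ℕ → List Bool)
    (hd1 : ∀ e j, n ≤ (d e j).length ∧ cn (d e j) ⊆ cn (v e).1 ∩ U ∧ (X ∩ cn (d e j)).Nonempty)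
    (hd2 : ∀ e j e' j' z, z ∈ cn (d e j) → z ∈ cn (d e' j') → e = e' ∧ j = j')
    (hd3 : ∀ x ∈ X ∩ cn c, x ∉ A → ∃ e j, x ∈ cn (d e j))
    (hd1' : ∀ e j, n ≤ (d' e j).length ∧ cn (d' e j) ⊆ cn (w e).1 ∩ U' ∧
      (Y ∩ cn (d' e j)).Nonempty)
    (hcv : ∀ a ∈ A, ∀ k, ∃ m, ∀ e, (cn (v e).1 ∩ cyl a m).Nonempty → cn (w e).1 ⊆ cyl (f a) k) :
    Half X Y c c' n (fun x y => x ∈ A ∧ y = f x) (fun p p' => ∃ e j, p = d e j ∧ p' = d' e j) where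
  cov := by
    intro x hx hxc
    by_cases h : x ∈ A
    · exact Or.inl ⟨f x, h, rfl⟩
    · obtain ⟨e, j, h⟩ := hd3 x ⟨hx, hxc⟩ h
      exact Or.inr ⟨_, _, ⟨e, j, rfl, rfl⟩, h⟩
  mem := fun x y h => hA h.1
  uniq := fun x y y' h h' => h.2.trans h'.2.symm
  sub := by
    rintro _ _ ⟨e, j, rfl, rfl⟩
    exact ⟨fun z hz => ((v e).2.1.2.1 ((hd1 e j).2.1 hz).1).1, (hd1 e j).2.2, (hd1 e j).1⟩
  off := by
    rintro _ _ x y ⟨e, j, rfl, rfl⟩ ⟨h1, -⟩ h2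
    exact ((v e).2.1.2.1 ((hd1 e j).2.1 h2).1).2 (subset_closure h1)
  disj := by
    rintro _ _ _ _ z ⟨e, j, rfl, rfl⟩ ⟨e', j', rfl, rfl⟩ h1 h2
    obtain ⟨rfl, rfl⟩ := hd2 _ _ _ _ _ h1 h2
    exact ⟨rfl, rfl⟩
  conv := by
    rintro a b ⟨ha, rfl⟩ k
    obtain ⟨m, hm⟩ := hcv a ha k
    refine ⟨m, ?_⟩
    rintro _ _ ⟨e, j, rfl, rfl⟩ ⟨z, hz, hza⟩
    exact fun w hw => hm e ⟨z, ((hd1 e j).2.1 hz).1, hza⟩ ((hd1' e j).2.1 hw).1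
  cts := by
    rintro a b ⟨ha, rfl⟩ k
    obtain ⟨m, hm⟩ := co_iff.1 fA a ha k
    refine ⟨m, ?_⟩
    rintro a' b' ⟨ha', rfl⟩ h
    exact mem_cyl.2 (hm a' ha' (mem_cyl.1 h))

lemma kr_step {X Y A B : Set Cantor} (hX : NowC X) (hY : NowC Y) {c c' : List Bool}
    (hc : (X ∩ cn c).Nonempty) (hc' : (Y ∩ cn c').Nonempty) {f g : Cantor → Cantor}
    (hA : A ⊆ X ∩ cn c) (hB : B ⊆ Y ∩ cn c') (fA : ContinuousOn f A) (gB : ContinuousOn g B)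
    (hfg : ∀ a ∈ A, f a ∈ B ∧ g (f a) = a) (hgf : ∀ b ∈ B, g b ∈ A ∧ f (g b) = b)
    (clA : X ∩ closure A ⊆ A) (clB : Y ∩ closure B ⊆ B) (nwA : Nwd X A) (nwB : Nwd Y B)
    {U U' : Set Cantor} (hU : IsOpen U) (hU' : IsOpen U') (hUX : ∀ x ∈ X ∩ cn c, x ∉ A → x ∈ U)
    (hUY : ∀ x ∈ Y ∩ cn c', x ∉ B → x ∈ U') (n : ℕ) :
    ∃ H P, Step X Y c c' n H P ∧ ∀ d d', P d d' → cn d ⊆ U ∧ cn d' ⊆ U' := by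
  have hAc : A ⊆ cn c := fun x hx => (hA hx).2
  have hBc : B ⊆ cn c' := fun x hx => (hB hx).2
  have hAB : A.Nonempty → B.Nonempty := fun ⟨a, ha⟩ => ⟨f a, (hfg a ha).1⟩
  have hBA : B.Nonempty → A.Nonempty := fun ⟨a, ha⟩ => ⟨g a, (hgf a ha).1⟩
  have m1 : ∀ l : VV X A c, ∃ l' : VV Y B c', A.Nonempty → ∃ a ∈ A,
      cn l.1 ⊆ cyl a (l.1.length - 1) ∧ cn l'.1 ⊆ cyl (f a) l.1.length := by
    intro l
    obtain ⟨l', h1, h2⟩ := vv_match hAc clB hBc hc' nwB (fun a ha => (hfg a ha).1) hBA l.2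
    exact ⟨⟨l', h1⟩, h2⟩
  have m2 : ∀ l : VV Y B c', ∃ l' : VV X A c, B.Nonempty → ∃ a ∈ B,
      cn l.1 ⊆ cyl a (l.1.length - 1) ∧ cn l'.1 ⊆ cyl (g a) l.1.length := by
    intro l
    obtain ⟨l', h1, h2⟩ := vv_match hBc clA hAc hc nwA (fun a ha => (hgf a ha).1) hAB l.2
    exact ⟨⟨l', h1⟩, h2⟩
  choose ww hww using m1
  choose vv hvv using m2
  let v : VV X A c ⊕ VV Y B c' → VV X A c := Sum.elim id vv
  let w : VV X A c ⊕ VV Y B c' → VV Y B c' := Sum.elim ww id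
  obtain ⟨d, d1, d2, d3⟩ := subdiv hX clA hU hUX n v (fun l => ⟨Sum.inl l, rfl⟩)
  obtain ⟨d', d1', d2', d3'⟩ := subdiv hY clB hU' hUY n w (fun l => ⟨Sum.inr l, rfl⟩)
  refine ⟨_, _, ⟨mk_half hA fA v w d d' d1 d2 d3 d1' ?_, ?_⟩, ?_⟩
  · intro a ha k
    obtain ⟨m, h1, h2⟩ := vv_conv fA hgf hAB ww vv hww hvv ha k
    exact ⟨m, fun e => Sum.recOn e h1 h2⟩
  · have := mk_half hB gB w v d' d d1' d2' d3' d1 (by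
      intro b hb k
      obtain ⟨m, h1, h2⟩ := vv_conv gB hfg hBA vv ww hvv hww hb k
      exact ⟨m, fun e => Sum.recOn e h2 h1⟩)
    convert this using 1
    · funext y x
      apply propext
      constructor
      · rintro ⟨h, rfl⟩; exact ⟨(hfg x h).1, (hfg x h).2.symm⟩
      · rintro ⟨h, rfl⟩; exact ⟨(hgf y h).1, (hgf y h).2.symm⟩
    · funext p' p
      apply propext
      exact ⟨fun ⟨e, j, h1, h2⟩ => ⟨e, j, h2, h1⟩, fun ⟨e, j, h1, h2⟩ => ⟨e, j, h2, h1⟩⟩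
  · rintro _ _ ⟨e, j, rfl, rfl⟩
    exact ⟨fun z hz => ((d1 e j).2.1 hz).2, fun z hz => ((d1' e j).2.1 hz).2⟩

/-- closed nowhere dense copies of `Z` in every nonempty open part of `Y` -/
def Emb (Z Y : Set Cantor) : Prop := ∀ c, (Y ∩ cn c).Nonempty → ∃ f g : Cantor → Cantor,
  ContinuousOn f Z ∧ (∀ z ∈ Z, f z ∈ Y ∩ cn c ∧ g (f z) = z) ∧ ContinuousOn g (f '' Z) ∧
  Y ∩ closure (f '' Z) ⊆ f '' Z ∧ Nwd Y (f '' Z)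

lemma bf_aux {X Y F : Set Cantor} (hX : NowC X) (hY : NowC Y) (hF : IsClosed F)
    (nw : Nwd X (X ∩ F)) (hE : Emb (X ∩ F) Y) (n : ℕ) {c c' : List Bool}
    (hc : (X ∩ cn c).Nonempty) (hc' : (Y ∩ cn c').Nonempty) :
    ∃ H P, Step X Y c c' n H P ∧ ∀ d d', P d d' → Disjoint (cn d) F := by
  obtain ⟨f, g, hf, hfg, hg, hcl, hnw⟩ := hE c' hc'
  have hsub : X ∩ F ∩ cn c ⊆ X ∩ F := inter_subset_left
  have hsub' : f '' (X ∩ F ∩ cn c) ⊆ f '' (X ∩ F) := image_mono hsub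
  obtain ⟨H, P, h1, h2⟩ := kr_step (A := X ∩ F ∩ cn c) (B := f '' (X ∩ F ∩ cn c)) (f := f) (g := g)
    (U := Fᶜ) (U' := univ) hX hY hc hc'
    (fun x hx => ⟨hx.1.1, hx.2⟩) (by rintro _ ⟨x, hx, rfl⟩; exact (hfg x hx.1).1)
    (hf.mono hsub) (hg.mono hsub') (fun a ha => ⟨mem_image_of_mem _ ha, (hfg a ha.1).2⟩)
    (by rintro _ ⟨a, ha, rfl⟩; rw [(hfg a ha.1).2]; exact ⟨ha, rfl⟩)
    (by
      rintro x ⟨hx, hxc⟩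
      have : closure (X ∩ F ∩ cn c) ⊆ F ∩ cn c :=
        closure_minimal (fun y hy => ⟨hy.1.2, hy.2⟩) (hF.inter (cn_closed c))
      exact ⟨⟨hx, (this hxc).1⟩, (this hxc).2⟩)
    (by
      rintro y ⟨hy, hyc⟩
      obtain ⟨x, hx, rfl⟩ := hcl ⟨hy, closure_mono hsub' hyc⟩
      refine ⟨x, ⟨hx, ?_⟩, rfl⟩
      obtain ⟨m, hm⟩ := co_iff.1 hg (f x) (mem_image_of_mem _ hx) c.length
      obtain ⟨_, ⟨x', hx', rfl⟩, h⟩ := mem_closure_cyl.1 hyc m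
      have := hm _ (mem_image_of_mem _ hx'.1) (mem_cyl.1 h)
      rw [(hfg x hx).2, (hfg x' hx'.1).2] at this
      rw [cn_cyl hx'.2]
      exact mem_cyl.2 this.symm)
    (by
      intro a ha m
      obtain ⟨x, hx, h⟩ := nw a ha.1 m
      exact ⟨x, hx, fun h' => h h'.1⟩)
    (by
      intro a ha m
      obtain ⟨x, hx, h⟩ := hnw a (hsub' ha) m
      exact ⟨x, hx, fun h' => h (hsub' h')⟩)
    hF.isOpen_compl isOpen_univ
    (fun x hx hxA hxF => hxA ⟨⟨hx.1, hxF⟩, hx.2⟩) (fun _ _ _ => trivial) n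
  exact ⟨H, P, h1, fun d d' h => disjoint_left.2 fun z hz => (h2 d d' h).1 hz⟩

/-- back and forth -/
theorem bf {X Y : Set Cantor} (hX : NowC X) (hY : NowC Y) (hX0 : X.Nonempty) (hY0 : Y.Nonempty)
    (F F' : ℕ → Set Cantor) (ε : Prop) (hF : ∀ k, IsClosed (F k)) (hF' : ∀ k, IsClosed (F' k))
    (h1 : ∀ p, (∀ k, p ∉ F k) → (p ∈ X ↔ ε)) (h2 : ∀ p, (∀ k, p ∉ F' k) → (p ∈ Y ↔ ε))
    (n1 : ∀ k, Nwd X (X ∩ F k)) (n2 : ∀ k, Nwd Y (Y ∩ F' k))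
    (e1 : ∀ k, Emb (X ∩ F k) Y) (e2 : ∀ k, Emb (Y ∩ F' k) X) : SH X Y := by
  refine assemble F F' ε hX0 hY0 h1 h2 fun n c c' hc hc' => ?_
  rcases Nat.even_or_odd' n with ⟨k, rfl | rfl⟩
  · obtain ⟨H, P, h3, h4⟩ := bf_aux hX hY (hF k) (n1 k) (e1 k) (2*k+1) hc hc'
    refine ⟨H, P, h3, fun d d' h => ⟨fun k' hk => ?_, fun k' hk => by omega⟩⟩
    obtain rfl : k = k' := by omega
    exact h4 d d' h
  · obtain ⟨H, P, h3, h4⟩ := bf_aux hY hX (hF' k) (n2 k) (e2 k) (2*k+1+1) hc' hc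
    refine ⟨_, _, step_sw h3, fun d d' h => ⟨fun k' hk => by omega, fun k' hk => ?_⟩⟩
    obtain rfl : k = k' := by omega
    exact h4 d' d h

end BD


namespace BD

/-! homeomorphisms between subsets of the Cantor space, in terms of total functions -/

structure SHw (f g : Cantor → Cantor) (X Y : Set Cantor) : Prop where
  cf : ContinuousOn f X
  cg : ContinuousOn g Y
  fx : ∀ x ∈ X, f x ∈ Y ∧ g (f x) = x
  gy : ∀ y ∈ Y, g y ∈ X ∧ f (g y) = y

lemma SHw.sh {f g : Cantor → Cantor} {X Y : Set Cantor} (h : SHw f g X Y) : SH X Y :=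
  ⟨f, g, h.cf, h.cg, h.fx, h.gy⟩

lemma SH.ex {X Y : Set Cantor} (h : SH X Y) : ∃ f g, SHw f g X Y := by
  obtain ⟨f, g, h1, h2, h3, h4⟩ := h
  exact ⟨f, g, h1, h2, h3, h4⟩

lemma SHw.symm {f g : Cantor → Cantor} {X Y : Set Cantor} (h : SHw f g X Y) : SHw g f Y X :=
  ⟨h.cg, h.cf, h.gy, h.fx⟩

lemma SHw.refl (X : Set Cantor) : SHw id id X X :=
  ⟨continuousOn_id, continuousOn_id, fun x h => ⟨h, rfl⟩, fun x h => ⟨h, rfl⟩⟩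

lemma SHw.trans {f g f' g' : Cantor → Cantor} {X Y Z : Set Cantor} (h : SHw f g X Y)
    (h' : SHw f' g' Y Z) : SHw (f' ∘ f) (g ∘ g') X Z := by
  refine ⟨h'.cf.comp h.cf fun x hx => (h.fx x hx).1, h.cg.comp h'.cg fun x hx => (h'.gy x hx).1,
    fun x hx => ?_, fun x hx => ?_⟩
  · have h1 := h.fx x hx
    have h2 := h'.fx _ h1.1
    exact ⟨h2.1, by simp [h2.2, h1.2]⟩
  · have h1 := h'.gy x hx
    have h2 := h.gy _ h1.1
    exact ⟨h2.1, by simp [h2.2, h1.2]⟩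

lemma SH.refl (X : Set Cantor) : SH X X := (SHw.refl X).sh

lemma SH.symm {X Y : Set Cantor} (h : SH X Y) : SH Y X := by
  obtain ⟨f, g, h⟩ := h.ex
  exact h.symm.sh

lemma SH.trans {X Y Z : Set Cantor} (h : SH X Y) (h' : SH Y Z) : SH X Z := by
  obtain ⟨f, g, h⟩ := h.ex
  obtain ⟨f', g', h'⟩ := h'.ex
  exact (h.trans h').sh

lemma SHw.restrict {f g : Cantor → Cantor} {X Y A : Set Cantor} (h : SHw f g X Y) (hA : A ⊆ X) :
    SHw f g A (f '' A) := by
  refine ⟨h.cf.mono hA, h.cg.mono ?_, fun x hx => ⟨mem_image_of_mem _ hx, (h.fx x (hA hx)).2⟩, ?_⟩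
  · rintro _ ⟨x, hx, rfl⟩; exact (h.fx x (hA hx)).1
  · rintro _ ⟨x, hx, rfl⟩
    rw [(h.fx x (hA hx)).2]; exact ⟨hx, rfl⟩

lemma SHw.image {f g : Cantor → Cantor} {X Y : Set Cantor} (h : SHw f g X Y) : f '' X = Y := by
  ext y; constructor
  · rintro ⟨x, hx, rfl⟩; exact (h.fx x hx).1
  · intro hy; exact ⟨g y, (h.gy y hy).1, (h.gy y hy).2⟩

/-- relatively closed subsets -/
def RC (X A : Set Cantor) : Prop := A ⊆ X ∧ X ∩ closure A ⊆ A

lemma rc_inter (X : Set Cantor) {F : Set Cantor} (hF : IsClosed F) : RC X (X ∩ F) :=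
  ⟨inter_subset_left, fun x hx => ⟨hx.1, by
    have := closure_mono (inter_subset_right (s := X) (t := F)) hx.2
    rwa [hF.closure_eq] at this⟩⟩

lemma RC.eq {X A : Set Cantor} (h : RC X A) : A = X ∩ closure A :=
  Subset.antisymm (fun x hx => ⟨h.1 hx, subset_closure hx⟩) h.2

lemma RC.trans {X A B : Set Cantor} (h : RC X A) (h' : RC A B) : RC X B :=
  ⟨h'.1.trans h.1, fun _ hx => h'.2 ⟨h.2 ⟨hx.1, closure_mono h'.1 hx.2⟩, hx.2⟩⟩

lemma SHw.rc {f g : Cantor → Cantor} {X Y A : Set Cantor} (h : SHw f g X Y) (hA : RC X A) :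
    RC Y (f '' A) := by
  refine ⟨by rintro _ ⟨x, hx, rfl⟩; exact (h.fx x (hA.1 hx)).1, ?_⟩
  rintro y ⟨hy, hyc⟩
  refine ⟨g y, hA.2 ⟨(h.gy y hy).1, mem_closure_cyl.2 fun k => ?_⟩, (h.gy y hy).2⟩
  obtain ⟨n, hn⟩ := co_iff.1 h.cg y hy k
  obtain ⟨_, ⟨a, ha, rfl⟩, hay⟩ := mem_closure_cyl.1 hyc n
  have h1 := h.fx a (hA.1 ha)
  have := hn _ h1.1 (mem_cyl.1 hay)
  rw [h1.2] at this
  exact ⟨a, ha, mem_cyl.2 this⟩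

lemma SHw.rc_pre {f g : Cantor → Cantor} {X Y A : Set Cantor} (h : SHw f g X Y) (hA : RC Y A) :
    RC X {x ∈ X | f x ∈ A} := by
  have h1 := h.symm.rc hA
  have : g '' A = {x ∈ X | f x ∈ A} := by
    ext x; constructor
    · rintro ⟨y, hy, rfl⟩
      have := h.gy y (hA.1 hy)
      exact ⟨this.1, by rw [this.2]; exact hy⟩
    · rintro ⟨h1, h2⟩
      exact ⟨f x, h2, (h.fx x h1).2⟩
  rwa [this] at h1

/-! Gδ sets and extensions -/

lemma gd_pre {A B : Type} [TopologicalSpace A] [TopologicalSpace B] {D : Set A} {E : Set B}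
    {k : A → B} (hD : IsGδ D) (hk : ContinuousOn k D) (hE : IsGδ E) : IsGδ (D ∩ k ⁻¹' E) := by
  obtain ⟨O, hO, rfl⟩ := isGδ_iff_eq_iInter_nat.1 hE
  have : ∀ n, ∃ u, IsOpen u ∧ k ⁻¹' O n ∩ D = u ∩ D := fun n => continuousOn_iff'.1 hk _ (hO n)
  choose u hu hu' using this
  have : D ∩ k ⁻¹' (⋂ n, O n) = D ∩ ⋂ n, u n := by
    ext x
    simp only [mem_inter_iff, mem_preimage, mem_iInter]
    refine and_congr_right fun hx => forall_congr' fun n => ?_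
    have := Set.ext_iff.1 (hu' n) x
    simp only [mem_inter_iff, mem_preimage, hx, and_true] at this
    exact this
  rw [this]
  exact hD.inter (IsGδ.iInter_of_isOpen hu)

lemma gd_eq {D : Set Cantor} {k j : Cantor → Cantor} (hD : IsGδ D) (hk : ContinuousOn k D)
    (hj : ContinuousOn j D) : IsGδ {x ∈ D | k x = j x} := by
  have hc : IsClosed {p : Cantor × Cantor | p.1 = p.2} := isClosed_eq continuous_fst continuous_snd
  exact gd_pre (k := fun x => (k x, j x)) hD (hk.prodMk hj) hc.isGδ

lemma gd_closed {F : Set Cantor} (h : IsClosed F) : IsGδ F := h.isGδ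

lemma ext {X : Set Cantor} {f : Cantor → Cantor} (hf : ContinuousOn f X) :
    ∃ (D : Set Cantor) (k : Cantor → Cantor), IsGδ D ∧ X ⊆ D ∧ ContinuousOn k D ∧
      ∀ x ∈ X, k x = f x := by
  classical
  let U : ℕ → Bool → Set Cantor := fun n i => ⋃ l ∈ {l : List Bool | ∀ z ∈ X ∩ cn l, f z n = i}, cn l
  have hU : ∀ n i, IsOpen (U n i) := fun n i => isOpen_biUnion fun l _ => cn_open l
  have hUX : ∀ n i, ∀ z ∈ X, z ∈ U n i → f z n = i := by
    intro n i z hz hzU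
    obtain ⟨l, hl, hzl⟩ := mem_iUnion₂.1 hzU
    exact hl z ⟨hz, hzl⟩
  have hXU : ∀ n, ∀ z ∈ X, z ∈ U n (f z n) := by
    intro n z hz
    obtain ⟨m, hm⟩ := co_iff.1 hf z hz (n+1)
    refine mem_iUnion₂.2 ⟨PiNat.res z m, ?_, self_cyl z m⟩
    rintro w ⟨hw, hwc⟩
    exact hm w hw (mem_cyl.1 hwc) n (Nat.lt_succ_self n)
  have hex : ∀ z ∈ closure X, ∀ n, z ∈ U n true → z ∈ U n false → False := by
    intro z hz n h1 h2
    obtain ⟨m, hm⟩ := open_cyl ((hU n true).inter (hU n false)) ⟨h1, h2⟩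
    obtain ⟨y, hy, hyc⟩ := mem_closure_cyl.1 hz m
    have h3 := hUX n true y hy (hm hyc).1
    have h4 := hUX n false y hy (hm hyc).2
    rw [h3] at h4; exact absurd h4 (by simp)
  let D := closure X ∩ ⋂ n, (U n true ∪ U n false)
  have hD : IsGδ D := isClosed_closure.isGδ.inter
    (IsGδ.iInter_of_isOpen fun n => (hU n true).union (hU n false))
  have hDU : ∀ x ∈ D, ∀ n, x ∈ U n (decide (x ∈ U n true)) := by
    intro x hx n
    by_cases h : x ∈ U n true
    · simp [h]
    · rcases mem_iInter.1 hx.2 n with h' | h'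
      · exact absurd h' h
      · simpa [h] using h'
  have hDu : ∀ x ∈ D, ∀ n i, x ∈ U n i → decide (x ∈ U n true) = i := by
    intro x hx n i hi
    cases i
    · simpa using fun h => hex x hx.1 n h hi
    · simpa using hi
  refine ⟨D, fun x n => decide (x ∈ U n true), hD, ?_, ?_, ?_⟩
  · intro x hx
    refine ⟨subset_closure hx, mem_iInter.2 fun n => ?_⟩
    have := hXU n x hx
    cases h : f x n <;> rw [h] at this
    · exact Or.inr this
    · exact Or.inl this
  · refine continuousOn_pi.2 fun n x hx => ?_
    have : (fun x => decide (x ∈ U n true)) =ᶠ[nhdsWithin x D] fun _ => decide (x ∈ U n true) := by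
      have h1 := (hU n _).mem_nhds (hDU x hx n)
      filter_upwards [mem_nhdsWithin_of_mem_nhds h1, self_mem_nhdsWithin] with z h2 h3
      exact hDu z h3 n _ h2
    exact (continuousWithinAt_const).congr_of_eventuallyEq this rfl
  · intro x hx
    funext n
    have hxD : x ∈ D := by
      refine ⟨subset_closure hx, mem_iInter.2 fun n => ?_⟩
      have := hXU n x hx
      cases h : f x n <;> rw [h] at this
      · exact Or.inr this
      · exact Or.inl this
    exact hDu x hxD n _ (hXU n x hx)

lemma sh_gd {X Y : Set Cantor} (h : SH X Y) (hX : IsGδ X) : IsGδ Y := by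
  obtain ⟨f, g, h⟩ := h.ex
  obtain ⟨D, k, hD, hYD, hk, hkg⟩ := ext h.cg
  have h1 := gd_pre hD hk hX
  have hf : ContinuousOn (f ∘ k) (D ∩ k ⁻¹' X) :=
    h.cf.comp (hk.mono inter_subset_left) fun x hx => hx.2
  have h2 := gd_eq h1 hf continuousOn_id
  convert h2 using 1
  ext y; constructor
  · intro hy
    have := h.gy y hy
    refine ⟨⟨hYD hy, ?_⟩, ?_⟩
    · show k y ∈ X
      rw [hkg y hy]; exact this.1
    · simp [hkg y hy, this.2]
  · rintro ⟨⟨_, h3⟩, h4⟩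
    have := (h.fx _ h3).1
    simp only [Function.comp, id] at h4
    rwa [h4] at this

lemma lav {X : Set Cantor} {f g : Cantor → Cantor} {Y : Set Cantor} (h : SHw f g X Y) :
    ∃ (D : Set Cantor) (k : Cantor → Cantor), IsGδ D ∧ X ⊆ D ∧ ContinuousOn k D ∧
      (∀ x ∈ X, k x = f x) ∧ ∀ x ∈ D, (x ∈ X ↔ k x ∈ Y) := by
  obtain ⟨D, k, hD, hXD, hk, hkf⟩ := ext h.cf
  obtain ⟨E, j, hE, hYE, hj, hjg⟩ := ext h.cg
  have h1 := gd_pre hD hk hE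
  have h2 := gd_eq h1 (hj.comp (hk.mono inter_subset_left) fun x hx => hx.2) continuousOn_id
  refine ⟨_, k, h2, ?_, hk.mono fun x hx => hx.1.1, hkf, ?_⟩
  · intro x hx
    have := h.fx x hx
    refine ⟨⟨hXD hx, ?_⟩, ?_⟩
    · show k x ∈ E
      rw [hkf x hx]; exact hYE this.1
    · simp [hkf x hx, hjg _ this.1, this.2]
  · rintro x ⟨⟨h3, h4⟩, h5⟩
    refine ⟨fun hx => by rw [hkf x hx]; exact (h.fx x hx).1, fun hx => ?_⟩
    simp only [Function.comp, id, hjg _ hx] at h5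
    rw [← h5]; exact (h.gy _ hx).1

/-! relation with Mathlib homeomorphisms -/

lemma sh_of_homeo {X Y : Set Cantor} (h : X ≃ₜ Y) :
    ∃ f g, SHw f g X Y ∧ ∀ x : X, f x = h x := by
  classical
  let f : Cantor → Cantor := fun x => if hx : x ∈ X then h ⟨x, hx⟩ else x
  let g : Cantor → Cantor := fun x => if hx : x ∈ Y then h.symm ⟨x, hx⟩ else x
  have hf : ∀ x (hx : x ∈ X), f x = h ⟨x, hx⟩ := fun x hx => dif_pos hx
  have hg : ∀ x (hx : x ∈ Y), g x = h.symm ⟨x, hx⟩ := fun x hx => dif_pos hx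
  refine ⟨f, g, ⟨?_, ?_, ?_, ?_⟩, fun x => hf x.1 x.2⟩
  · rw [continuousOn_iff_continuous_restrict]
    have : X.domRestrict f = fun x => (h x : Cantor) := funext fun x => hf x.1 x.2
    rw [this]; exact continuous_subtype_val.comp h.continuous
  · rw [continuousOn_iff_continuous_restrict]
    have : Y.domRestrict g = fun x => (h.symm x : Cantor) := funext fun x => hg x.1 x.2
    rw [this]; exact continuous_subtype_val.comp h.symm.continuous
  · intro x hx
    rw [hf x hx]
    refine ⟨(h ⟨x, hx⟩).2, ?_⟩
    rw [hg _ (h ⟨x, hx⟩).2]; simp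
  · intro x hx
    rw [hg x hx]
    refine ⟨(h.symm ⟨x, hx⟩).2, ?_⟩
    rw [hf _ (h.symm ⟨x, hx⟩).2]; simp

lemma homeo_of_sh {X Y : Set Cantor} {f g : Cantor → Cantor} (h : SHw f g X Y) :
    ∃ e : X ≃ₜ Y, ∀ x : X, (e x : Cantor) = f x :=
  ⟨{ toFun := fun x => ⟨f x, (h.fx x.1 x.2).1⟩
     invFun := fun y => ⟨g y, (h.gy y.1 y.2).1⟩
     left_inv := fun x => Subtype.ext (h.fx x.1 x.2).2
     right_inv := fun y => Subtype.ext (h.gy y.1 y.2).2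
     continuous_toFun := (continuousOn_iff_continuous_restrict.1 h.cf).subtype_mk _
     continuous_invFun := (continuousOn_iff_continuous_restrict.1 h.cg).subtype_mk _ }, fun _ => rfl⟩

def Hom (X : Set Cantor) : Prop := ∀ x ∈ X, ∀ y ∈ X, ∃ f g, SHw f g X X ∧ f x = y

lemma hom_iff (X : Set Cantor) : IsHomogeneous X ↔ Hom X := by
  constructor
  · intro h x hx y hy
    obtain ⟨e, he⟩ := h ⟨x, hx⟩ ⟨y, hy⟩
    obtain ⟨f, g, h1, h2⟩ := sh_of_homeo e
    exact ⟨f, g, h1, by rw [h2 ⟨x, hx⟩, he]⟩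
  · rintro h ⟨x, hx⟩ ⟨y, hy⟩
    obtain ⟨f, g, h1, h2⟩ := h x hx y hy
    obtain ⟨e, he⟩ := homeo_of_sh h1
    exact ⟨e, Subtype.ext (by rw [he]; exact h2)⟩

lemma hom_sh {X Y : Set Cantor} (h : SH X Y) (hX : Hom X) : Hom Y := by
  obtain ⟨f, g, h⟩ := h.ex
  intro x hx y hy
  obtain ⟨f', g', h1, h2⟩ := hX _ (h.gy x hx).1 _ (h.gy y hy).1
  exact ⟨_, _, (h.symm.trans h1).trans h, by simp [h2, (h.gy y hy).2]⟩

end BD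


namespace BD

/-! the easy direction -/

open Classical in
noncomputable def hh (x y z : Cantor) : Cantor := fun i =>
  if ∃ j < i, z j ≠ x j then z i else xor (z i) (xor (x i) (y i))

lemma hh_neg {x y z : Cantor} {i : ℕ} (h : ¬ ∃ j < i, z j ≠ x j) :
    hh x y z i = xor (z i) (xor (x i) (y i)) := if_neg h

lemma hh_pos {x y z : Cantor} {i : ℕ} (h : ∃ j < i, z j ≠ x j) : hh x y z i = z i := if_pos h

lemma hh_iff {x y z : Cantor} {i : ℕ} : (∃ j < i, hh x y z j ≠ y j) ↔ ∃ j < i, z j ≠ x j := by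
  classical
  constructor
  · rintro ⟨j, hj, hne⟩
    by_contra hcon
    push Not at hcon
    apply hne
    rw [hh_neg (by push Not; exact fun k hk => hcon k (hk.trans hj)), hcon j hj]
    cases x j <;> cases y j <;> rfl
  · intro h
    have h1 := Nat.find_spec h
    refine ⟨Nat.find h, h1.1, ?_⟩
    rw [hh_neg (by
      rintro ⟨k, hk, hne⟩
      exact Nat.find_min h hk ⟨hk.trans h1.1, hne⟩)]
    have := h1.2
    revert this
    cases z (Nat.find h) <;> cases x (Nat.find h) <;> cases y (Nat.find h) <;> simp

lemma hh_inv (x y z : Cantor) : hh y x (hh x y z) = z := by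
  funext i
  by_cases h : ∃ j < i, z j ≠ x j
  · rw [hh_pos (hh_iff.2 h), hh_pos h]
  · rw [hh_neg (fun h' => h (hh_iff.1 h')), hh_neg h]
    cases z i <;> cases x i <;> cases y i <;> rfl

lemma hh_self (x y : Cantor) : hh x y x = y := by
  funext i
  rw [hh_neg (by simp)]
  cases x i <;> cases y i <;> rfl

lemma hh_loc (x y : Cantor) {z w : Cantor} {k : ℕ} (h : EqU k z w) : EqU k (hh x y z) (hh x y w) := by
  intro i hi
  have h1 : (∃ j < i, z j ≠ x j) ↔ ∃ j < i, w j ≠ x j :=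
    exists_congr fun j => and_congr_right fun hj => by rw [h j (hj.trans hi)]
  unfold hh
  simp only [h1, h i hi]

lemma hh_cont (x y : Cantor) (X : Set Cantor) : ContinuousOn (hh x y) X :=
  co_iff.2 fun _ _ k => ⟨k, fun _ _ h => hh_loc x y h⟩

lemma hh_mem {S : Set Cantor} (hS : ClosedUnderFinMod S) {x y z : Cantor} (hy : y ∈ S)
    (hz : z ∈ S) : hh x y z ∈ S := by
  by_cases h : z = x
  · subst h; rw [hh_self]; exact hy
  · obtain ⟨n, hn⟩ := Function.ne_iff.1 h
    refine hS z hz _ ((finite_Iic n).subset fun i hi => ?_)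
    by_contra hcon
    exact hi (hh_pos ⟨n, not_le.1 hcon, hn⟩).symm

lemma hom_fm {S : Set Cantor} (hS : ClosedUnderFinMod S) : Hom S := by
  intro x hx y hy
  refine ⟨hh x y, hh y x, ⟨hh_cont _ _ _, hh_cont _ _ _, ?_, ?_⟩, hh_self x y⟩
  · exact fun z hz => ⟨hh_mem hS hy hz, hh_inv _ _ _⟩
  · exact fun z hz => ⟨hh_mem hS hx hz, hh_inv _ _ _⟩

def spl (x : Cantor) (n : ℕ) (y : Cantor) : Cantor := fun i => if i < n then x i else y i

lemma spl_cyl (x : Cantor) (n : ℕ) (y : Cantor) : spl x n y ∈ cyl x n :=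
  mem_cyl.2 fun i hi => if_pos hi

lemma spl_mem {S : Set Cantor} (hS : ClosedUnderFinMod S) {y : Cantor} (hy : y ∈ S) (x : Cantor)
    (n : ℕ) : spl x n y ∈ S := by
  refine hS y hy _ ((finite_Iio n).subset fun i hi => ?_)
  by_contra h
  exact hi (if_neg h).symm

lemma spl_nmem {S : Set Cantor} (hS : ClosedUnderFinMod S) {y : Cantor} (hy : y ∉ S) (x : Cantor)
    (n : ℕ) : spl x n y ∉ S := by
  intro h
  refine hy (hS _ h _ ((finite_Iio n).subset fun i hi => ?_))
  by_contra h
  exact hi (if_neg h)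

lemma nowc_of_dense {S : Set Cantor} (h1 : ∀ x n, ∃ y ∈ cyl x n, y ∈ S)
    (h2 : ∀ x n, ∃ y ∈ cyl x n, y ∉ S) : NowC S := by
  intro x hx n hc
  obtain ⟨p, hp, hpS⟩ := h2 x n
  refine hpS (hc.isClosed.closure_subset (mem_closure_cyl.2 fun m => ?_)).1
  obtain ⟨q, hq, hqS⟩ := h1 p (max m n)
  refine ⟨q, ⟨hqS, ?_⟩, cyl_mono (le_max_left _ _) hq⟩
  exact mem_cyl.2 (((mem_cyl.1 hq).mono (le_max_right _ _)).trans (mem_cyl.1 hp))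

lemma nowc_fm {S : Set Cantor} (hS : ClosedUnderFinMod S) {y z : Cantor} (hy : y ∈ S)
    (hz : z ∉ S) : NowC S :=
  nowc_of_dense (fun x n => ⟨_, spl_cyl x n y, spl_mem hS hy x n⟩)
    fun x n => ⟨_, spl_cyl x n z, spl_nmem hS hz x n⟩

lemma not_lc {S : Set Cantor} (hS : NowC S) (hne : S.Nonempty) : ¬ LocallyCompactSpace S := by
  intro hlc
  obtain ⟨x, hx⟩ := hne
  obtain ⟨K, hK, hKx⟩ := exists_compact_mem_nhds (⟨x, hx⟩ : S)
  obtain ⟨U, hU, hUK⟩ := mem_nhds_subtype _ _ _ |>.1 hKx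
  obtain ⟨V, hVU, hV, hxV⟩ := mem_nhds_iff.1 hU
  obtain ⟨n, hn⟩ := open_cyl hV hxV
  refine hS x hx n ?_
  have h1 : IsCompact (Subtype.val '' K) := hK.image continuous_subtype_val
  have h2 : S ∩ cyl x n = Subtype.val '' K ∩ cyl x n := by
    ext z; constructor
    · rintro ⟨h3, h4⟩
      exact ⟨⟨⟨z, h3⟩, hUK (hVU (hn h4)), rfl⟩, h4⟩
    · rintro ⟨⟨w, h3, rfl⟩, h4⟩
      exact ⟨w.2, h4⟩
  rw [h2]
  exact h1.inter_right (cn_closed _)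

lemma nowc_of_hom {X : Set Cantor} (hX : Hom X) (hlc : ¬ LocallyCompactSpace X) : NowC X := by
  intro x hx n hc
  apply hlc
  have : WeaklyLocallyCompactSpace X := by
    constructor
    rintro ⟨y, hy⟩
    obtain ⟨f, g, h, hfy⟩ := hX y hy x hx
    refine ⟨{z : X | f z ∈ cyl x n}, ?_, ?_⟩
    · rw [Subtype.isCompact_iff]
      have : Subtype.val '' {z : X | f z ∈ cyl x n} = g '' (X ∩ cyl x n) := by
        ext z; constructor
        · rintro ⟨w, hw, rfl⟩
          exact ⟨f w, ⟨(h.fx _ w.2).1, hw⟩, (h.fx _ w.2).2⟩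
        · rintro ⟨w, ⟨hw, hw'⟩, rfl⟩
          refine ⟨⟨g w, (h.gy w hw).1⟩, ?_, rfl⟩
          show f (g w) ∈ cyl x n
          rw [(h.gy w hw).2]; exact hw'
      rw [this]
      exact hc.image_of_continuousOn (h.cg.mono inter_subset_left)
    · have h1 := continuousOn_iff_continuous_restrict.1 h.cf
      refine ((cn_open (PiNat.res x n)).preimage h1).mem_nhds ?_
      show f y ∈ cyl x n
      rw [hfy]; exact self_cyl x n
  infer_instance

lemma easy {X S : Set Cantor} (hS : IsSemifilter S) (h : X ≃ₜ S) :
    IsHomogeneous X ∧ ¬ LocallyCompactSpace X := by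
  obtain ⟨h0, h1, _, h2⟩ := hS
  constructor
  · rw [hom_iff]
    obtain ⟨f, g, h3, _⟩ := sh_of_homeo h
    exact hom_sh h3.symm.sh (hom_fm h2)
  · intro hlc
    refine not_lc (nowc_fm h2 h1 h0) ⟨_, h1⟩ ?_
    exact h.symm.isOpenEmbedding.locallyCompactSpace

end BD


namespace BD

/-! classes of subsets of the Cantor space -/

abbrev Cls := Set Cantor → Prop

def Cl (ε : Prop) (P : Cls) : Cls := fun X => ∃ F : ℕ → Set Cantor, (∀ k, IsClosed (F k)) ∧
  (∀ p, (∀ k, p ∉ F k) → (p ∈ X ↔ ε)) ∧ ∀ k, P (X ∩ F k)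

def Her (P : Cls) : Prop := ∀ X A, P X → RC X A → P A
def Inv (P : Cls) : Prop := ∀ X Y, SH X Y → P X → P Y
def Sig (P : Cls) : Prop := ∀ X (F : ℕ → Set Cantor), (∀ k, IsClosed (F k)) →
  (∀ x ∈ X, ∃ k, x ∈ F k) → (∀ k, P (X ∩ F k)) → P X
def Glu (P : Cls) : Prop := ∀ X F, IsClosed F → P (X ∩ F) →
  (∀ x ∈ X, x ∉ F → ∃ n, P (X ∩ cyl x n)) → P X

structure Nice (P : Cls) : Prop where
  her : Her P
  inv : Inv P
  glu : Glu P

lemma cl_mk {ε : Prop} {P : Cls} {X : Set Cantor} {ι : Type} [Countable ι] [Nonempty ι]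
    (F : ι → Set Cantor) (hF : ∀ k, IsClosed (F k)) (h : ∀ p, (∀ k, p ∉ F k) → (p ∈ X ↔ ε))
    (hP : ∀ k, P (X ∩ F k)) : Cl ε P X := by
  obtain ⟨e, he⟩ := exists_surjective_nat ι
  refine ⟨fun n => F (e n), fun k => hF _, fun p hp => h p fun k => ?_, fun k => hP _⟩
  obtain ⟨n, rfl⟩ := he k
  exact hp n

lemma sig_mk {P : Cls} (hs : Sig P) {X : Set Cantor} {ι : Type} [Countable ι] [Nonempty ι]
    (F : ι → Set Cantor) (hF : ∀ k, IsClosed (F k)) (h : ∀ x ∈ X, ∃ k, x ∈ F k)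
    (hP : ∀ k, P (X ∩ F k)) : P X := by
  obtain ⟨e, he⟩ := exists_surjective_nat ι
  refine hs X (fun n => F (e n)) (fun k => hF _) (fun x hx => ?_) fun k => hP _
  obtain ⟨k, hk⟩ := h x hx
  obtain ⟨n, rfl⟩ := he k
  exact ⟨n, hk⟩

lemma cl_self {ε : Prop} {P : Cls} {X : Set Cantor} (h : P X) : Cl ε P X :=
  ⟨fun _ => univ, fun _ => isClosed_univ, fun p hp => absurd (mem_univ p) (hp 0),
    fun _ => by rwa [inter_univ]⟩

lemma cl_mono {ε : Prop} {P Q : Cls} (h : ∀ X, P X → Q X) {X : Set Cantor} (hX : Cl ε P X) :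
    Cl ε Q X := by
  obtain ⟨F, h1, h2, h3⟩ := hX
  exact ⟨F, h1, h2, fun k => h _ (h3 k)⟩

lemma Her.emp {P : Cls} (h : Her P) {X : Set Cantor} (hX : P X) : P ∅ :=
  h X ∅ hX ⟨empty_subset _, by simp⟩

lemma Her.inter {P : Cls} (h : Her P) {X F : Set Cantor} (hX : P X) (hF : IsClosed F) : P (X ∩ F) :=
  h X _ hX (rc_inter X hF)

lemma gd_compl {G : Set Cantor} (h : IsGδ G) :
    ∃ H : ℕ → Set Cantor, (∀ n, IsClosed (H n)) ∧ ∀ p, p ∈ G ↔ ∀ n, p ∉ H n := by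
  obtain ⟨O, hO, rfl⟩ := isGδ_iff_eq_iInter_nat.1 h
  exact ⟨fun n => (O n)ᶜ, fun n => (hO n).isClosed_compl, fun p => by simp⟩

lemma compl_gd {H : ℕ → Set Cantor} (h : ∀ n, IsClosed (H n)) : IsGδ {p | ∀ n, p ∉ H n} := by
  have : {p | ∀ n, p ∉ H n} = ⋂ n, (H n)ᶜ := by ext p; simp
  rw [this]
  exact IsGδ.iInter_of_isOpen fun n => (h n).isOpen_compl

lemma glu_of_sig {P : Cls} (hs : Sig P) : Glu P := by
  classical
  intro X F hF hPF h
  refine sig_mk hs (ι := List Bool) (fun l => if P (X ∩ cn l) then cn l else F) ?_ ?_ ?_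
  · intro l; by_cases hl : P (X ∩ cn l)
    · simp only [if_pos hl]; exact cn_closed l
    · simp only [if_neg hl]; exact hF
  · intro x hx
    by_cases hxF : x ∈ F
    · by_cases hall : ∀ l, P (X ∩ cn l)
      · exact ⟨[], by simp only [if_pos (hall [])]; rw [cn_nil]; simp⟩
      · push Not at hall
        obtain ⟨l, hl⟩ := hall
        exact ⟨l, by simp only [if_neg hl]; exact hxF⟩
    · obtain ⟨n, hn⟩ := h x hx hxF
      exact ⟨PiNat.res x n, by simp only [if_pos hn]; exact self_cyl x n⟩
  · intro l; by_cases hl : P (X ∩ cn l)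
    · simp only [if_pos hl]; exact hl
    · simp only [if_neg hl]; exact hPF

/-! sigma classes -/

lemma her_cl {ε : Prop} {P : Cls} (h : Her P) : Her (Cl ε P) := by
  rintro X A ⟨F, h1, h2, h3⟩ hA
  obtain ⟨H, h4, h5⟩ := gd_compl (G := closure A) isClosed_closure.isGδ
  have hrc : ∀ k, RC (X ∩ F k) (A ∩ F k) := fun k => ⟨inter_subset_inter_left _ hA.1, by
    rintro x ⟨⟨hx, hxF⟩, hxc⟩
    exact ⟨hA.2 ⟨hx, closure_mono inter_subset_left hxc⟩, hxF⟩⟩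
  by_cases hε : ε
  · refine cl_mk (ι := ℕ ⊕ ℕ) (fun i => Sum.elim F H i) ?_ ?_ ?_
    · rintro (k | k)
      · exact h1 k
      · exact h4 k
    · intro p hp
      have h6 := (h2 p fun k => hp (Sum.inl k)).2 hε
      exact ⟨fun _ => hε, fun _ => hA.2 ⟨h6, (h5 p).2 fun n => hp (Sum.inr n)⟩⟩
    · rintro (k | k)
      · exact h _ _ (h3 k) (hrc k)
      · have : A ∩ H k = ∅ := by
          ext x; simp only [mem_inter_iff, mem_empty_iff_false, iff_false, not_and]
          exact fun hx => (h5 x).1 (subset_closure hx) k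
        show P (A ∩ H k)
        rw [this]; exact h.emp (h3 0)
  · refine ⟨F, h1, fun p hp => ?_, fun k => h _ _ (h3 k) (hrc k)⟩
    have := h2 p hp
    exact ⟨fun hpA => this.1 (hA.1 hpA), fun h => absurd h hε⟩

lemma SHw.clos {f g : Cantor → Cantor} {X Y F : Set Cantor} (h : SHw f g X Y) (hF : IsClosed F) :
    Y ∩ closure (f '' (X ∩ F)) = f '' (X ∩ F) :=
  (h.rc (rc_inter X hF)).eq.symm

lemma inv_sig {P : Cls} (h : Inv P) : Inv (Cl False P) := by
  rintro X Y hXY ⟨F, h1, h2, h3⟩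
  obtain ⟨f, g, hfg⟩ := hXY.ex
  refine ⟨fun k => closure (f '' (X ∩ F k)), fun k => isClosed_closure, fun p hp => ?_, fun k => ?_⟩
  · refine ⟨fun hpY => ?_, False.elim⟩
    have h4 := hfg.gy p hpY
    refine (h2 (g p) fun k hk => hp k (subset_closure ⟨g p, ⟨h4.1, hk⟩, h4.2⟩)).1 h4.1
  · rw [hfg.clos (h1 k)]
    exact h _ _ (hfg.restrict inter_subset_left).sh (h3 k)

lemma sig_sig {P : Cls} : Sig (Cl False P) := by
  intro X F h1 h2 h3
  choose G g1 g2 g3 using h3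
  refine cl_mk (ι := ℕ × ℕ) (fun i => F i.1 ∩ G i.1 i.2) (fun i => (h1 _).inter (g1 _ _)) ?_ ?_
  · intro p hp
    refine ⟨fun hpX => ?_, False.elim⟩
    obtain ⟨k, hk⟩ := h2 p hpX
    exact (g2 k p fun m hm => hp (k, m) ⟨hk, hm⟩).1 ⟨hpX, hk⟩
  · rintro ⟨k, m⟩
    rw [← inter_assoc]; exact g3 k m

/-! gamma classes -/

lemma inv_gam {P : Cls} (hh : Her P) (hi : Inv P) (hs : Sig P) : Inv (Cl True P) := by
  rintro X Y hXY ⟨F, h1, h2, h3⟩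
  obtain ⟨f, g, hfg⟩ := hXY.ex
  have hGX : {p | ∀ n, p ∉ F n} ⊆ X := fun p hp => (h2 p hp).2 trivial
  have hG : IsGδ (f '' {p | ∀ n, p ∉ F n}) := sh_gd (hfg.restrict hGX).sh (compl_gd h1)
  obtain ⟨H, h4, h5⟩ := gd_compl hG
  refine ⟨H, h4, fun p hp => ⟨fun _ => trivial, fun _ => ?_⟩, fun m => ?_⟩
  · obtain ⟨x, hx, rfl⟩ := (h5 p).2 hp
    exact (hfg.fx x (hGX hx)).1
  · refine hs _ (fun k => closure (f '' (X ∩ F k))) (fun k => isClosed_closure) ?_ fun k => ?_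
    · rintro y ⟨hy, hyH⟩
      by_contra hcon
      push Not at hcon
      refine (h5 y).1 ⟨g y, fun n hn => hcon n (subset_closure ⟨g y, ⟨(hfg.gy y hy).1, hn⟩,
        (hfg.gy y hy).2⟩), (hfg.gy y hy).2⟩ m hyH
    · rw [inter_right_comm, hfg.clos (h1 k)]
      exact hh.inter (hi _ _ (hfg.restrict inter_subset_left).sh (h3 k)) (h4 m)

lemma glu_gam {P : Cls} (hh : Her P) : Glu (Cl True P) := by
  classical
  rintro X F hF ⟨H, h1, h2, h3⟩ hloc
  have hP0 := hh.emp (h3 0)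
  let L : Set (List Bool) := {l | Cl True P (X ∩ cn l)}
  let O := ⋃ l ∈ L, cn l
  have hO : IsOpen O := isOpen_biUnion fun l _ => cn_open l
  have hch : ∀ l : L, ∃ G : ℕ → Set Cantor, (∀ k, IsClosed (G k)) ∧
      (∀ p, (∀ k, p ∉ G k) → (p ∈ X ∩ cn l.1 ↔ True)) ∧ ∀ k, P (X ∩ cn l.1 ∩ G k) := fun l => l.2
  choose G g1 g2 g3 using hch
  obtain ⟨K, k1, k2⟩ := gd_compl (G := F) hF.isGδ
  refine cl_mk (ι := ℕ ⊕ (L × ℕ) ⊕ ℕ) (fun i => Sum.elim (fun n => F ∩ H n)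
    (Sum.elim (fun i => cn i.1.1 ∩ G i.1 i.2) (fun n => Oᶜ ∩ K n)) i) ?_ ?_ ?_
  · rintro (n | i | n)
    · exact hF.inter (h1 n)
    · exact (cn_closed _).inter (g1 _ _)
    · exact hO.isClosed_compl.inter (k1 n)
  · intro p hp
    refine ⟨fun _ => trivial, fun _ => ?_⟩
    by_cases hpF : p ∈ F
    · exact ((h2 p fun k hk => hp (Sum.inl k) ⟨hpF, hk⟩).2 trivial).1
    · by_cases hpO : p ∈ O
      · obtain ⟨l, hl, hpl⟩ := mem_iUnion₂.1 hpO
        exact ((g2 ⟨l, hl⟩ p fun k hk => hp (Sum.inr (Sum.inl (⟨l, hl⟩, k))) ⟨hpl, hk⟩).2 trivial).1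
      · have : ∃ n, p ∈ K n := by
          by_contra hcon
          push Not at hcon
          exact hpF ((k2 p).2 hcon)
        obtain ⟨n, hn⟩ := this
        exact absurd ⟨hpO, hn⟩ (hp (Sum.inr (Sum.inr n)))
  · rintro (n | i | n)
    · show P (X ∩ (F ∩ H n))
      rw [← inter_assoc]; exact h3 n
    · show P (X ∩ (cn i.1.1 ∩ G i.1 i.2))
      rw [← inter_assoc]; exact g3 _ _
    · have : X ∩ (Oᶜ ∩ K n) = ∅ := by
        ext x
        simp only [mem_inter_iff, mem_empty_iff_false, iff_false]
        rintro ⟨hx, hxO, hxK⟩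
        have hxF : x ∉ F := fun h => (k2 x).1 h n hxK
        obtain ⟨m, hm⟩ := hloc x hx hxF
        exact hxO (mem_iUnion₂.2 ⟨_, hm, self_cyl x m⟩)
      show P (X ∩ (Oᶜ ∩ K n))
      rw [this]; exact hP0

lemma gam_gam {P : Cls} {X : Set Cantor} {F : ℕ → Set Cantor} (h1 : ∀ k, IsClosed (F k))
    (h2 : ∀ p, (∀ k, p ∉ F k) → p ∈ X) (h3 : ∀ k, Cl True P (X ∩ F k)) : Cl True P X := by
  choose G g1 g2 g3 using h3
  refine cl_mk (ι := ℕ × ℕ) (fun i => F i.1 ∩ G i.1 i.2) (fun i => (h1 _).inter (g1 _ _)) ?_ ?_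
  · intro p hp
    refine ⟨fun _ => trivial, fun _ => ?_⟩
    by_cases hF : ∀ k, p ∉ F k
    · exact h2 p hF
    · push Not at hF
      obtain ⟨k, hk⟩ := hF
      exact ((g2 k p fun m hm => hp (k, m) ⟨hk, hm⟩).2 trivial).1
  · rintro ⟨k, m⟩
    rw [← inter_assoc]; exact g3 k m

/-! the hierarchy -/

def Rc : ℕ → Cls
  | 0 => fun X => X = ∅
  | 1 => fun X => X.Countable
  | 2 => Cl False IsCompact
  | (j+3) => Cl False (Cl True (Rc j))

def Ga (j : ℕ) : Cls := Cl True (Rc j)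

lemma her_compact : Her IsCompact := by
  intro X A hX hA
  rw [hA.eq]; exact hX.inter_right isClosed_closure

lemma inv_compact : Inv IsCompact := by
  intro X Y h hX
  obtain ⟨f, g, h⟩ := h.ex
  rw [← h.image]; exact hX.image_of_continuousOn h.cf

lemma inv_countable : Inv (fun X => X.Countable) := by
  intro X Y h hX
  obtain ⟨f, g, h⟩ := h.ex
  rw [← h.image]; exact hX.image f

lemma rc_her (j : ℕ) : Her (Rc j) := by
  induction j using Rc.induct with
  | case1 =>
      intro X A hX hA
      have : X = ∅ := hX
      subst this
      exact subset_empty_iff.1 hA.1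
  | case2 => exact fun X A hX hA => Countable.mono hA.1 hX
  | case3 => exact her_cl her_compact
  | case4 j ih => exact her_cl (her_cl ih)

lemma rc_sig (j : ℕ) : Sig (Rc j) := by
  match j with
  | 0 =>
    intro X F h1 h2 h3
    refine eq_empty_iff_forall_notMem.2 fun x hx => ?_
    obtain ⟨k, hk⟩ := h2 x hx
    exact eq_empty_iff_forall_notMem.1 (h3 k) x ⟨hx, hk⟩
  | 1 =>
    intro X F h1 h2 h3
    have : X ⊆ ⋃ k, X ∩ F k := fun x hx => by
      obtain ⟨k, hk⟩ := h2 x hx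
      exact mem_iUnion.2 ⟨k, hx, hk⟩
    exact (countable_iUnion h3).mono this
  | 2 => exact sig_sig
  | (j+3) => exact sig_sig

lemma rc_inv (j : ℕ) : Inv (Rc j) := by
  induction j using Rc.induct with
  | case1 =>
      intro X Y h hX
      have h0 : X = ∅ := hX
      obtain ⟨f, g, h⟩ := h.ex
      rw [h0] at h
      show Y = ∅
      rw [← h.image, image_empty]
  | case2 => exact inv_countable
  | case3 => exact inv_sig inv_compact
  | case4 j ih => exact inv_sig (inv_gam (rc_her j) ih (rc_sig j))

lemma rc_nice (j : ℕ) : Nice (Rc j) := ⟨rc_her j, rc_inv j, glu_of_sig (rc_sig j)⟩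

lemma ga_nice (j : ℕ) : Nice (Ga j) :=
  ⟨her_cl (rc_her j), inv_gam (rc_her j) (rc_inv j) (rc_sig j), glu_gam (rc_her j)⟩

lemma rc_emp (j : ℕ) : Rc j ∅ := by
  match j with
  | 0 => rfl
  | 1 => exact countable_empty
  | 2 => exact cl_self isCompact_empty
  | (j+3) => exact cl_self (cl_self (rc_emp j))

lemma ga_compact (j : ℕ) {X : Set Cantor} (h : IsCompact X) : Ga j X := by
  obtain ⟨H, h4, h5⟩ := gd_compl (G := X) h.isClosed.isGδ
  refine ⟨H, h4, fun p hp => by simpa using (h5 p).2 hp, fun k => ?_⟩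
  have : X ∩ H k = ∅ := by
    ext x; simp only [mem_inter_iff, mem_empty_iff_false, iff_false, not_and]
    exact fun hx => (h5 x).1 hx k
  rw [this]; exact rc_emp j

lemma rc_succ (j : ℕ) : ∀ X, Rc j X → Rc (j+1) X := by
  induction j using Rc.induct with
  | case1 => intro X h; rw [show X = ∅ from h]; exact rc_emp 1
  | case2 =>
    intro X h
    rcases X.eq_empty_or_nonempty with rfl | hne
    · exact rc_emp 2
    · obtain ⟨f, hf⟩ := Set.Countable.exists_eq_range h hne
      refine ⟨fun n => {f n}, fun _ => isClosed_singleton, fun p hp => ?_, fun k => ?_⟩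
      · simp only [iff_false]; rw [hf]; rintro ⟨k, rfl⟩; exact hp k rfl
      · exact (finite_singleton (f k)).subset inter_subset_right |>.isCompact
  | case3 => intro X h; exact cl_mono (fun X hX => ga_compact 0 hX) h
  | case4 j ih => intro X h; exact cl_mono (fun X hX => cl_mono ih hX) h

lemma rc_mono {i j : ℕ} (h : i ≤ j) : ∀ X, Rc i X → Rc j X := by
  induction h with
  | refl => exact fun _ h => h
  | step _ ih => exact fun X h => rc_succ _ X (ih X h)

lemma ga_mono {i j : ℕ} (h : i ≤ j) (X : Set Cantor) (hX : Ga i X) : Ga j X :=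
  cl_mono (rc_mono h) hX

lemma rc_ga (j : ℕ) (X : Set Cantor) (h : Rc j X) : Ga j X := cl_self h

lemma ga_rc (j : ℕ) (X : Set Cantor) (h : Ga j X) : Rc (j+3) X := cl_self h

lemma rc_compact (j : ℕ) {X : Set Cantor} (h : IsCompact X) : Rc (j+2) X :=
  rc_mono (by omega : 2 ≤ j+2) X (cl_self h)

end BD


namespace BD

def Now (Q : Cls) (X : Set Cantor) : Prop := ∀ c, (X ∩ cn c).Nonempty → ¬ Q (X ∩ cn c)

def Rigid (P Q : Cls) : Prop := ∀ X Y : Set Cantor, X.Nonempty → Y.Nonempty → P X → P Y →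
  Now Q X → Now Q Y → SH X Y

def Univ (P Q : Cls) : Prop := ∀ W Z : Set Cantor, P W → ¬ Q W → P Z →
  ∃ f g B, SHw f g Z B ∧ RC W B

lemma RC.sub {X A V : Set Cantor} (h : RC X A) (h1 : A ⊆ V) (h2 : V ⊆ X) : RC V A :=
  ⟨h1, fun _ hx => h.2 ⟨h2 hx.1, hx.2⟩⟩

lemma nwd_of {P Q : Cls} (hP : Her P) (hPQ : ∀ X, P X → Q X) {X B : Set Cantor} (hX : Now Q X)
    (hB : P B) (hBX : B ⊆ X) : Nwd X B := by
  intro a ha m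
  by_contra hcon
  push Not at hcon
  refine hX (PiNat.res a m) ⟨a, hBX ha, self_cyl a m⟩ (hPQ _ (hP B _ hB ?_))
  exact (rc_inter X (cn_closed _)).sub hcon hBX

lemma now_nowc {Q : Cls} (hc : ∀ X, IsCompact X → Q X) {X : Set Cantor} (hX : Now Q X) : NowC X :=
  fun x hx n h => hX _ ⟨x, hx, self_cyl x n⟩ (hc _ h)

lemma next {ε : Prop} {P Q Q' : Cls} (hU : Univ P Q) (hP : Her P) (hQ : Her Q)
    (hPQ : ∀ X, P X → Q' X) (hc : ∀ X, IsCompact X → Q' X) (hlow : ∀ X, Cl ε Q X → Q' X) :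
    Rigid (Cl ε P) Q' := by
  have key : ∀ X, Cl ε P X → Now Q' X → ∀ Z, P Z → Emb Z X := by
    rintro X ⟨F, h1, h2, h3⟩ hX Z hZ c hne
    have : ∃ k, ¬ Q (X ∩ (cn c ∩ F k)) := by
      by_contra hcon
      push Not at hcon
      refine hX c hne (hlow _ ?_)
      have hQX : Cl ε Q (X ∩ cn c) := by
        by_cases hε : ε
        · refine cl_mk (ι := Option ℕ) (fun i => i.elim (cn c)ᶜ F) ?_ ?_ ?_
          · rintro (_ | k)
            · exact (cn_open c).isClosed_compl
            · exact h1 k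
          · intro p hp
            refine ⟨fun _ => hε, fun _ => ⟨(h2 p fun k => hp (some k)).2 hε, ?_⟩⟩
            by_contra h
            exact hp none h
          · rintro (_ | k)
            · have : X ∩ cn c ∩ (cn c)ᶜ = ∅ := by
                rw [inter_assoc, inter_compl_self, inter_empty]
              show Q (X ∩ cn c ∩ (cn c)ᶜ)
              rw [this]; exact hQ.emp (hcon 0)
            · show Q (X ∩ cn c ∩ F k)
              rw [inter_assoc]; exact hcon k
        · refine ⟨F, h1, fun p hp => ⟨fun h => (h2 p hp).1 h.1, fun h => absurd h hε⟩, fun k => ?_⟩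
          rw [inter_assoc]; exact hcon k
      exact hQX
    obtain ⟨k, hk⟩ := this
    have hW : P (X ∩ (cn c ∩ F k)) := by
      have := hP.inter (h3 k) (cn_closed c)
      rwa [inter_assoc, inter_comm (F k)] at this
    obtain ⟨f, g, B, hs, hB⟩ := hU _ Z hW hk hZ
    have hBX : RC X B := (rc_inter X ((cn_closed c).inter (h1 k))).trans hB
    refine ⟨f, g, hs.cf, fun z hz => ?_, ?_, ?_, ?_⟩
    · have h4 := hs.fx z hz
      exact ⟨⟨hBX.1 h4.1, (hB.1 h4.1).2.1⟩, h4.2⟩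
    · rw [hs.image]; exact hs.cg
    · rw [hs.image]; exact hBX.2
    · rw [hs.image]; exact nwd_of hP hPQ hX (hP _ _ hW hB) hBX.1
  intro X Y hX0 hY0 hX hY nX nY
  have e1 := key X hX nX
  have e2 := key Y hY nY
  obtain ⟨F, h1, h2, h3⟩ := hX
  obtain ⟨F', h1', h2', h3'⟩ := hY
  exact bf (now_nowc hc nX) (now_nowc hc nY) hX0 hY0 F F' ε h1 h1' h2 h2'
    (fun k => nwd_of hP hPQ nX (h3 k) inter_subset_left)
    (fun k => nwd_of hP hPQ nY (h3' k) inter_subset_left)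
    (fun k => e2 _ (h3 k)) (fun k => e1 _ (h3' k))

/-! removing the small part -/

lemma remove {Q : Cls} (hQ : Nice Q) (hQ0 : Q ∅) {W : Set Cantor} (hW : ¬ Q W) :
    ∃ F, IsClosed F ∧ (W ∩ F).Nonempty ∧ Now Q (W ∩ F) := by
  let O := ⋃ l ∈ {l : List Bool | Q (W ∩ cn l)}, cn l
  have hO : IsOpen O := isOpen_biUnion fun l _ => cn_open l
  have hloc : ∀ c, ∀ x ∈ W ∩ cn c, x ∉ Oᶜ → ∃ n, Q (W ∩ cn c ∩ cyl x n) := by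
    rintro c x ⟨hx, hxc⟩ hxO
    obtain ⟨l, hl, hxl⟩ := mem_iUnion₂.1 (not_not.1 hxO)
    refine ⟨l.length, ?_⟩
    rw [← cn_cyl hxl, inter_right_comm]
    exact hQ.her.inter hl (cn_closed c)
  refine ⟨Oᶜ, hO.isClosed_compl, ?_, ?_⟩
  · by_contra hne
    rw [not_nonempty_iff_eq_empty] at hne
    apply hW
    refine hQ.glu W Oᶜ hO.isClosed_compl (by rwa [hne]) fun x hx hxO => ?_
    have := hloc [] x ⟨hx, by rw [cn_nil]; trivial⟩ hxO
    rwa [cn_nil, inter_univ] at this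
  · rintro c ⟨x, ⟨hx, hxO⟩, hxc⟩ hcon
    refine hxO (mem_iUnion₂.2 ⟨c, ?_, hxc⟩)
    refine hQ.glu _ Oᶜ hO.isClosed_compl ?_ (hloc c)
    rwa [inter_right_comm]

/-! pairs -/

def join (x y : Cantor) : Cantor := fun n => if n % 2 = 0 then x (n / 2) else y (n / 2)
def pr1 (z : Cantor) : Cantor := fun n => z (2 * n)
def pr2 (z : Cantor) : Cantor := fun n => z (2 * n + 1)

@[simp] lemma pr1_join (x y : Cantor) : pr1 (join x y) = x := by
  funext n; simp [pr1, join]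

@[simp] lemma pr2_join (x y : Cantor) : pr2 (join x y) = y := by
  funext n; simp only [pr2, join]
  rw [if_neg (by omega)]; congr 1; omega

@[simp] lemma join_pr (z : Cantor) : join (pr1 z) (pr2 z) = z := by
  funext n; simp only [pr1, pr2, join]
  split_ifs <;> congr 1 <;> omega

lemma cont_join : Continuous fun p : Cantor × Cantor => join p.1 p.2 := by
  refine continuous_pi fun n => ?_
  by_cases h : n % 2 = 0
  · simp only [join, h, if_true]; fun_prop
  · simp only [join, h, if_false]; fun_prop

lemma cont_pr1 : Continuous pr1 := by unfold pr1; fun_prop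
lemma cont_pr2 : Continuous pr2 := by unfold pr2; fun_prop

def blk (i : ℕ) (y : Cantor) : Cantor := fun n => if n < i then false else if n = i then true else y (n - i - 1)
def tl (i : ℕ) (y : Cantor) : Cantor := fun n => y (n + i + 1)

lemma tl_blk (i : ℕ) (y : Cantor) : tl i (blk i y) = y := by
  funext n
  simp only [tl, blk]
  rw [if_neg (by omega), if_neg (by omega)]
  congr 1; omega

lemma cont_tl (i : ℕ) : Continuous (tl i) := by unfold tl; fun_prop

lemma cont_blk (i : ℕ) : Continuous (blk i) := by
  refine continuous_pi fun n => ?_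
  by_cases h : n < i
  · simp only [blk, h, if_true]; fun_prop
  · by_cases h' : n = i
    · simp only [blk, h, h', if_true, if_false]; fun_prop
    · simp only [blk, h, h', if_false]; fun_prop

/-- sets starting with `0^i 1` -/
def CC (i : ℕ) : Set Cantor := {w | (∀ j < i, w j = false) ∧ w i = true}

lemma blk_cc (i : ℕ) (y : Cantor) : blk i y ∈ CC i := by
  refine ⟨fun j hj => ?_, ?_⟩ <;> simp [blk]
  intro h; omega

lemma cc_uniq {w : Cantor} {i j : ℕ} (h : w ∈ CC i) (h' : w ∈ CC j) : i = j := by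
  rcases lt_trichotomy i j with hl | hl | hl
  · have := h'.1 i hl; rw [h.2] at this; simp at this
  · exact hl
  · have := h.1 j hl; rw [h'.2] at this; simp at this

lemma cc_closed (i : ℕ) : IsClosed (CC i) := by
  have : CC i = (⋂ j : ℕ, {w | j < i → w j = false}) ∩ {w | w i = true} := by
    ext w; simp [CC]
  rw [this]
  refine IsClosed.inter (isClosed_iInter fun j => ?_)
    (isClosed_eq (continuous_apply i) continuous_const)
  by_cases h : j < i
  · simp only [h, forall_const]; exact isClosed_eq (continuous_apply j) continuous_const
  · simp [h]

def spr (Z M : Set Cantor) (d : ℕ → Cantor) : Set Cantor :=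
  {w | (pr1 w ∈ Z ∧ pr2 w = fun _ => false) ∨ ∃ i, pr1 w = d i ∧ ∃ y ∈ M, pr2 w = blk i y}

lemma spr_zero (Z M : Set Cantor) (d : ℕ → Cantor) :
    SHw (fun z => join z fun _ => false) pr1 Z (spr Z M d ∩ {w | pr2 w = fun _ => false}) := by
  refine ⟨(cont_join.comp (continuous_id.prodMk
    (continuous_const (y := fun _ => false)))).continuousOn,
    cont_pr1.continuousOn, fun z hz => ⟨⟨Or.inl ⟨by simpa using hz, by simp⟩, ?_⟩, by simp⟩, ?_⟩
  · show pr2 (join z _) = _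
    simp
  · rintro w ⟨h1, h2⟩
    have h2' : pr2 w = fun _ => false := h2
    refine ⟨?_, ?_⟩
    · rcases h1 with h | ⟨i, _, y, _, h⟩
      · exact h.1
      · have := (blk_cc i y).2
        rw [← h, h2'] at this; simp at this
    · show join (pr1 w) _ = _
      rw [← h2', join_pr]

lemma spr_copy (Z M : Set Cantor) (d : ℕ → Cantor) (i : ℕ) :
    SHw (fun y => join (d i) (blk i y)) (fun w => tl i (pr2 w)) M
      (spr Z M d ∩ {w | pr2 w ∈ CC i}) := by
  refine ⟨(cont_join.comp (continuous_const.prodMk (cont_blk i))).continuousOn,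
    ((cont_tl i).comp cont_pr2).continuousOn,
    fun y hy => ⟨⟨Or.inr ⟨i, by simp, y, hy, by simp⟩, ?_⟩, by simp [tl_blk]⟩, ?_⟩
  · show pr2 (join (d i) (blk i y)) ∈ CC i
    rw [pr2_join]; exact blk_cc i y
  · rintro w ⟨h1, h2⟩
    have h2' : pr2 w ∈ CC i := h2
    rcases h1 with h | ⟨j, hj, y, hy, h⟩
    · have := h2'.2
      rw [h.2] at this; simp at this
    · have : i = j := cc_uniq h2' (by rw [h]; exact blk_cc j y)
      subst this
      refine ⟨by rw [h, tl_blk]; exact hy, ?_⟩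
      show join (d i) (blk i (tl i (pr2 w))) = w
      rw [h, tl_blk, ← h, ← hj, join_pr]

lemma join_eqU {x y x' y' : Cantor} {n : ℕ} (h : EqU n x x') (h' : EqU n y y') :
    EqU n (join x y) (join x' y') := by
  intro i hi
  simp only [join]
  rw [h (i/2) (by omega), h' (i/2) (by omega)]

lemma spr_now {Q : Cls} (hQ : Nice Q) {Z M : Set Cantor} {d : ℕ → Cantor} (hM : M.Nonempty)
    (hMQ : Now Q M) (hd : ∀ z ∈ Z, ∀ m, ∃ i ≥ m, d i ∈ cyl z m) : Now Q (spr Z M d) := by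
  rintro c ⟨w, hw, hwc⟩ hcon
  have h1 : ∃ i, ∃ y ∈ M, join (d i) (blk i y) ∈ cn c := by
    rcases hw with ⟨h1, h2⟩ | ⟨i, h1, y, hy, h2⟩
    · obtain ⟨i, hi, hdi⟩ := hd _ h1 c.length
      obtain ⟨y, hy⟩ := hM
      refine ⟨i, y, hy, ?_⟩
      rw [cn_cyl hwc]
      refine mem_cyl.2 ?_
      conv_rhs => rw [← join_pr w]
      refine join_eqU (mem_cyl.1 hdi) fun j hj => ?_
      rw [h2, (blk_cc i y).1 j (by omega)]
    · exact ⟨i, y, hy, by rw [← h1, ← h2, join_pr]; exact hwc⟩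
  obtain ⟨i, y, hy, hyc⟩ := h1
  have hcp := spr_copy Z M d i
  obtain ⟨m, hm⟩ := open_cyl ((cn_open c).preimage
    (cont_join.comp (continuous_const (y := d i) |>.prodMk (cont_blk i)))) (x := y) hyc
  have hr : RC (spr Z M d) ((fun y => join (d i) (blk i y)) '' (M ∩ cyl y m)) :=
    (rc_inter _ ((cc_closed i).preimage cont_pr2)).trans (hcp.rc (rc_inter M (cn_closed _)))
  have hr' : RC (spr Z M d ∩ cn c) ((fun y => join (d i) (blk i y)) '' (M ∩ cyl y m)) :=
    hr.sub (by
      rintro _ ⟨v, ⟨hv, hv'⟩, rfl⟩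
      exact ⟨(hcp.fx v hv).1.1, hm hv'⟩) inter_subset_left
  refine hMQ _ ⟨y, hy, self_cyl y m⟩ (hQ.inv _ _ ?_ (hQ.her _ _ hcon hr'))
  exact (hcp.restrict inter_subset_left).symm.sh

lemma spr_in {P : Cls} (hP : Nice P) {Z M : Set Cantor} {d : ℕ → Cantor} (hZ : P Z) (hM : P M) :
    P (spr Z M d) := by
  refine hP.glu _ {w | pr2 w = fun _ => false} (isClosed_eq cont_pr2 continuous_const)
    (hP.inv _ _ (spr_zero Z M d).sh hZ) fun w hw hw0 => ?_
  rcases hw with h | ⟨i, h1, y, hy, h2⟩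
  · exact absurd h.2 hw0
  · have hcp := hP.inv _ _ (spr_copy Z M d i).sh hM
    refine ⟨2 * i + 2, hP.her _ _ hcp ?_⟩
    refine (rc_inter _ (cn_closed _)).sub ?_ inter_subset_left
    rintro v ⟨hv, hvw⟩
    refine ⟨hv, ?_⟩
    have h3 := mem_cyl.1 hvw
    have h4 : pr2 w ∈ CC i := by rw [h2]; exact blk_cc i y
    refine ⟨fun j hj => ?_, ?_⟩
    · rw [← h4.1 j hj]; exact h3 _ (by omega)
    · rw [← h4.2]; exact h3 _ (by omega)

lemma dense_seq {Z : Set Cantor} (hZ : Z.Nonempty) : ∃ d : ℕ → Cantor, (∀ i, d i ∈ Z) ∧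
    ∀ z ∈ Z, ∀ m, ∃ i ≥ m, d i ∈ cyl z m := by
  classical
  obtain ⟨z0, hz0⟩ := hZ
  have : ∀ l : List Bool, ∃ z ∈ Z, (Z ∩ cn l).Nonempty → z ∈ cn l := by
    intro l
    by_cases h : (Z ∩ cn l).Nonempty
    · obtain ⟨z, hz, hzl⟩ := h
      exact ⟨z, hz, fun _ => hzl⟩
    · exact ⟨z0, hz0, fun h' => absurd h' h⟩
  choose e he1 he2 using this
  obtain ⟨s, hs⟩ := exists_surjective_nat (List Bool)
  refine ⟨fun i => e (s i.unpair.1), fun i => he1 _, fun z hz m => ?_⟩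
  obtain ⟨k, hk⟩ := hs (PiNat.res z m)
  refine ⟨Nat.pair k m, Nat.right_le_pair k m, ?_⟩
  simp only [Nat.unpair_pair, hk]
  exact he2 _ ⟨z, hz, self_cyl z m⟩

lemma univ_emp (W : Set Cantor) : ∃ f g B, SHw f g ∅ B ∧ RC W B :=
  ⟨id, id, ∅, SHw.refl ∅, empty_subset _, by simp⟩

lemma univ_of_rigid {P Q : Cls} (hP : Nice P) (hQ : Nice Q) (hQ0 : Q ∅) (hR : Rigid P Q) :
    Univ P Q := by
  intro W Z hW hWQ hZ
  rcases Z.eq_empty_or_nonempty with rfl | hne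
  · exact univ_emp W
  obtain ⟨F, hF, hFne, hFQ⟩ := remove hQ hQ0 hWQ
  obtain ⟨d, hd1, hd2⟩ := dense_seq hne
  have hM := hP.her.inter hW hF
  have hsz := spr_zero Z (W ∩ F) d
  obtain ⟨z, hz⟩ := hne
  obtain ⟨f, g, hfg⟩ := (hR (spr Z (W ∩ F) d) (W ∩ F) ⟨_, (hsz.fx z hz).1.1⟩ hFne
    (spr_in hP hZ hM) hM (spr_now hQ hFne hFQ hd2) hFQ).ex
  refine ⟨_, _, _, hsz.trans (hfg.restrict inter_subset_left), ?_⟩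
  exact (rc_inter W hF).trans (hfg.rc (rc_inter _ (isClosed_eq cont_pr2 continuous_const)))

/-! base cases -/

lemma inj_inv {f : Cantor → Cantor} (hf : Continuous f) (hi : Function.Injective f) :
    ContinuousOn (Function.invFun f) (range f) := by
  have h := hf.isClosedEmbedding hi
  rw [h.isInducing.continuousOn_iff]
  refine continuousOn_id.congr ?_
  rintro _ ⟨x, rfl⟩
  simp [Function.leftInverse_invFun hi x]

lemma inj_shw {f : Cantor → Cantor} (hf : Continuous f) (hi : Function.Injective f)
    (Z : Set Cantor) : SHw f (Function.invFun f) Z (f '' Z) := by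
  refine ⟨hf.continuousOn, (inj_inv hf hi).mono (image_subset_range f Z),
    fun x hx => ⟨mem_image_of_mem f hx, Function.leftInverse_invFun hi x⟩, ?_⟩
  rintro _ ⟨x, hx, rfl⟩
  rw [Function.leftInverse_invFun hi x]; exact ⟨hx, rfl⟩

lemma univ_none : Univ (fun X => X = ∅) (fun _ => False) := by
  rintro W Z _ _ hZ
  rw [show Z = ∅ from hZ]; exact univ_emp W

lemma univ_single : Univ (fun X => X.Subsingleton) (fun X => X = ∅) := by
  intro W Z hW hW0 hZ
  rcases Z.eq_empty_or_nonempty with rfl | ⟨z, hz⟩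
  · exact univ_emp W
  obtain ⟨w, hw⟩ := nonempty_iff_ne_empty.2 hW0
  refine ⟨fun _ => w, fun _ => z, {w}, ⟨continuousOn_const, continuousOn_const, ?_, ?_⟩, ?_, ?_⟩
  · exact fun x hx => ⟨rfl, hZ hz hx⟩
  · exact fun x hx => ⟨hz, hx.symm⟩
  · simpa using hw
  · simp

lemma pol : PolishSpace Cantor := { }

lemma univ_compact : Univ IsCompact (fun X => X.Countable) := by
  intro W Z hW hW0 hZ
  have := pol
  obtain ⟨f, h1, h2, h3⟩ := hW.isClosed.exists_nat_bool_injection_of_not_countable hW0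
  refine ⟨f, _, _, inj_shw h2 h3 Z, (image_subset_range f Z).trans h1, ?_⟩
  rw [(hZ.image h2).isClosed.closure_eq]
  exact inter_subset_right

lemma rc_one (X : Set Cantor) : Rc 1 X ↔ Cl False (fun X => X.Subsingleton) X := by
  constructor
  · intro h
    rcases X.eq_empty_or_nonempty with rfl | hne
    · exact cl_self subsingleton_empty
    · obtain ⟨f, hf⟩ := Set.Countable.exists_eq_range h hne
      refine ⟨fun n => {f n}, fun _ => isClosed_singleton, fun p hp => ?_, fun k => ?_⟩
      · simp only [iff_false]; rw [hf]; rintro ⟨k, rfl⟩; exact hp k rfl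
      · exact subsingleton_singleton.anti inter_subset_right
  · rintro ⟨F, h1, h2, h3⟩
    refine rc_sig 1 X F h1 (fun x hx => ?_) fun k => (h3 k).countable
    by_contra hcon
    push Not at hcon
    exact (h2 x hcon).1 hx

lemma cl_false_rc {j : ℕ} {X : Set Cantor} (h : Cl False (Rc j) X) : Rc j X := by
  obtain ⟨F, h1, h2, h3⟩ := h
  refine rc_sig j X F h1 (fun x hx => ?_) h3
  by_contra hcon
  push Not at hcon
  exact (h2 x hcon).1 hx

lemma cl_true_ga {j : ℕ} {X : Set Cantor} (h : Cl True (Ga j) X) : Ga j X := by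
  obtain ⟨F, h1, h2, h3⟩ := h
  exact gam_gam h1 (fun p hp => (h2 p hp).2 trivial) h3

/-- uniqueness of the spaces at the finite levels -/
lemma uv (j : ℕ) : Rigid (Ga j) (Rc (j+2)) ∧ Rigid (Rc (j+1)) (Ga j) := by
  induction j using Nat.strong_induction_on with
  | _ j ih =>
    have hU : Rigid (Rc (j+1)) (Ga j) := by
      match j with
      | 0 =>
        have := next (ε := False) (Q' := Ga 0) univ_single
          (fun X A hX hA => Set.Subsingleton.anti hX hA.1) (rc_her 0)
          (fun X hX => ga_compact 0 hX.finite.isCompact) (fun X hX => ga_compact 0 hX)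
          (fun X hX => rc_ga 0 X (cl_false_rc (j := 0) hX))
        intro X Y h1 h2 h3 h4
        exact this X Y h1 h2 ((rc_one X).1 h3) ((rc_one Y).1 h4)
      | 1 =>
        exact next (ε := False) (Q' := Ga 1) univ_compact her_compact (rc_her 1)
          (fun X hX => ga_compact 1 hX) (fun X hX => ga_compact 1 hX)
          (fun X hX => rc_ga 1 X (cl_false_rc (j := 1) hX))
      | (j+2) =>
        exact next (ε := False) (Q' := Ga (j+2))
          (univ_of_rigid (ga_nice j) (rc_nice (j+2)) (rc_emp _) (ih j (by omega)).1)
          (ga_nice j).her (rc_her (j+2)) (fun X hX => ga_mono (by omega) X hX)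
          (fun X hX => ga_compact _ hX) (fun X hX => rc_ga _ X (cl_false_rc hX))
    refine ⟨?_, hU⟩
    match j with
    | 0 =>
      exact next (ε := True) (Q' := Rc 2) univ_none (rc_her 0) (fun X A h _ => h)
        (fun X hX => rc_mono (by omega : 0 ≤ 2) X hX) (fun X hX => rc_compact 0 hX)
        (fun X hX => by obtain ⟨F, _, _, h⟩ := hX; exact (h 0).elim)
    | (j+1) =>
      exact next (ε := True) (Q' := Rc (j+3))
        (univ_of_rigid (rc_nice (j+1)) (ga_nice j) (rc_ga _ _ (rc_emp _)) (ih j (by omega)).2)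
        (rc_her _) (ga_nice j).her (fun X hX => rc_mono (by omega) X hX)
        (fun X hX => rc_compact _ hX) (fun X hX => ga_rc j X (cl_true_ga hX))

end BD


namespace BD

lemma cn_ne (c : List Bool) : (cn c).Nonempty := by
  induction c with
  | nil => exact ⟨fun _ => false, rfl⟩
  | cons a c ih =>
    obtain ⟨z, hz⟩ := ih
    refine ⟨Function.update z c.length a, ?_⟩
    show PiNat.res _ (c.length + 1) = a :: c
    rw [PiNat.res_succ]
    congr 1
    · simp
    · rw [← show PiNat.res z c.length = c from hz, PiNat.res_length, PiNat.res_eq_res]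
      intro m hm
      exact Function.update_of_ne (by omega) _ _

lemma baire_cone {ι : Type} [Countable ι] (F : ι → Set Cantor) (hF : ∀ i, IsClosed (F i))
    {c : List Bool} (hc : ∀ p ∈ cn c, ∃ i, p ∈ F i) : ∃ i d, cn d ⊆ F i ∧ cn d ⊆ cn c := by
  have h1 : Dense (⋃ i : Option ι, interior (i.elim (cn c)ᶜ fun i => F i ∩ cn c)) := by
    refine dense_iUnion_interior_of_closed ?_ ?_
    · rintro (_ | i)
      · exact (cn_open c).isClosed_compl
      · exact (hF i).inter (cn_closed c)
    · refine eq_univ_of_forall fun p => ?_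
      by_cases hp : p ∈ cn c
      · obtain ⟨i, hi⟩ := hc p hp
        exact mem_iUnion.2 ⟨some i, hi, hp⟩
      · exact mem_iUnion.2 ⟨none, hp⟩
  obtain ⟨p, hp, hpc⟩ := h1.inter_open_nonempty _ (cn_open c) (cn_ne c)
  obtain ⟨(_ | i), hi⟩ := mem_iUnion.1 hpc
  · exact absurd hp (interior_subset hi)
  · obtain ⟨n, hn⟩ := open_cyl isOpen_interior hi
    refine ⟨i, PiNat.res p n, fun z hz => ?_, fun z hz => ?_⟩
    · exact (interior_subset (hn hz)).1
    · exact (interior_subset (hn hz)).2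

def cof (s : Finset ℕ) : Cantor := fun n => decide (n ∉ s)
def fin (s : Finset ℕ) : Cantor := fun n => decide (n ∈ s)

def Cof : Set Cantor := {x | ∃ s, x = cof s}
def Fin' : Set Cantor := {x | ∃ s, x = fin s}

lemma fin_iff (x : Cantor) : x ∈ Fin' ↔ {n | x n = true}.Finite := by
  constructor
  · rintro ⟨s, rfl⟩
    refine s.finite_toSet.subset fun n hn => ?_
    simpa [fin] using hn
  · intro h
    refine ⟨h.toFinset, funext fun n => ?_⟩
    simp [fin]

lemma cof_iff (x : Cantor) : x ∈ Cof ↔ {n | x n = false}.Finite := by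
  constructor
  · rintro ⟨s, rfl⟩
    refine s.finite_toSet.subset fun n hn => ?_
    simpa [cof] using hn
  · intro h
    refine ⟨h.toFinset, funext fun n => ?_⟩
    cases hx : x n <;> simp [cof, hx]

lemma fin_fm : ClosedUnderFinMod Fin' := by
  intro x hx y h
  rw [fin_iff] at hx ⊢
  refine (hx.union h).subset fun n hn => ?_
  by_cases h1 : x n = y n
  · exact Or.inl (h1.trans hn)
  · exact Or.inr h1

lemma cof_fm : ClosedUnderFinMod Cof := by
  intro x hx y h
  rw [cof_iff] at hx ⊢
  refine (hx.union h).subset fun n hn => ?_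
  by_cases h1 : x n = y n
  · exact Or.inl (h1.trans hn)
  · exact Or.inr h1

lemma cof_up : UpwardClosed Cof := by
  intro x hx y h
  rw [cof_iff] at hx ⊢
  refine hx.subset fun n hn => ?_
  have := h n
  have hn' : y n = false := hn
  show x n = false
  cases hx : x n
  · rfl
  · rw [hx, hn'] at this; simp at this

lemma fin_down : DownwardClosed Fin' := by
  intro x hx y h
  rw [fin_iff] at hx ⊢
  exact hx.subset fun n hn => h n hn

def Up (S : Set Cantor) : Prop := UpwardClosed S ∧ ClosedUnderFinMod S

def MA (Y : Set Cantor) : Set Cantor := {w | pr1 w ∈ Cof ∧ pr2 w ∈ Y}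
def MB (Y : Set Cantor) : Set Cantor := {w | pr1 w ∉ Fin' ∨ pr2 w ∈ Y}

lemma pr1_fm {x y : Cantor} (h : {n | x n ≠ y n}.Finite) : {n | pr1 x n ≠ pr1 y n}.Finite :=
  h.preimage (f := fun n => 2 * n) (fun a _ b _ hab => by simpa using hab)

lemma pr2_fm {x y : Cantor} (h : {n | x n ≠ y n}.Finite) : {n | pr2 x n ≠ pr2 y n}.Finite :=
  h.preimage (f := fun n => 2 * n + 1) (fun a _ b _ hab => by simpa using hab)

lemma fm_symm {x y : Cantor} (h : {n | x n ≠ y n}.Finite) : {n | y n ≠ x n}.Finite := by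
  simpa only [ne_comm] using h

lemma one_cof : (fun _ => true) ∈ Cof := by rw [cof_iff]; simp
lemma one_fin : (fun _ => true) ∉ Fin' := by rw [fin_iff]; simpa using Set.infinite_univ
lemma zero_fin : (fun _ => false) ∈ Fin' := by rw [fin_iff]; simp
lemma zero_cof : (fun _ => false) ∉ Cof := by rw [cof_iff]; simpa using Set.infinite_univ

lemma ma_semi {Y : Set Cantor} (hY : Up Y) (h1 : (fun _ => true) ∈ Y) : IsSemifilter (MA Y) := by
  refine ⟨fun h => zero_cof h.1, ⟨one_cof, h1⟩, ?_, ?_⟩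
  · exact fun x hx y h => ⟨cof_up _ hx.1 _ fun n => h _, hY.1 _ hx.2 _ fun n => h _⟩
  · exact fun x hx y h => ⟨cof_fm _ hx.1 _ (pr1_fm h), hY.2 _ hx.2 _ (pr2_fm h)⟩

lemma mb_semi {Y : Set Cantor} (hY : Up Y) (h1 : (fun _ => false) ∉ Y) : IsSemifilter (MB Y) := by
  refine ⟨fun h => h.elim (fun h => h zero_fin) h1, Or.inl one_fin, ?_, ?_⟩
  · intro x hx y h
    rcases hx with hx | hx
    · exact Or.inl fun hy => hx (fin_down _ hy _ fun n => h _)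
    · exact Or.inr (hY.1 _ hx _ fun n => h _)
  · intro x hx y h
    rcases hx with hx | hx
    · exact Or.inl fun hy => hx (fin_fm _ hy _ (pr1_fm (fm_symm h)))
    · exact Or.inr (hY.2 _ hx _ (pr2_fm h))

lemma fib_closed (a : Cantor) : IsClosed {w | pr1 w = a} := isClosed_eq cont_pr1 continuous_const

lemma join_inj (a : Cantor) : Function.Injective (join a) := fun x y h => by
  simpa using congrArg pr2 h

lemma join_ct (a : Cantor) : Continuous (join a) :=
  cont_join.comp (continuous_const.prodMk continuous_id)

lemma fib_eq (a : Cantor) (Y : Set Cantor) : join a '' Y = {w | pr1 w = a ∧ pr2 w ∈ Y} := by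
  ext w; constructor
  · rintro ⟨y, hy, rfl⟩; exact ⟨pr1_join _ _, by rw [pr2_join]; exact hy⟩
  · rintro ⟨rfl, h⟩; exact ⟨_, h, join_pr w⟩

lemma fib_in {P : Cls} (hP : Inv P) {Y : Set Cantor} (a : Cantor) :
    P {w | pr1 w = a ∧ pr2 w ∈ Y} ↔ P Y := by
  rw [← fib_eq]
  have := inj_shw (join_ct a) (join_inj a) Y
  exact ⟨hP _ _ this.symm.sh, hP _ _ this.sh⟩

lemma ma_in {P : Cls} (hP : Inv P) {Y : Set Cantor} (h : P Y) : Cl False P (MA Y) := by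
  refine cl_mk (fun s => {w | pr1 w = cof s}) (fun s => fib_closed _) ?_ ?_
  · intro p hp
    refine ⟨fun h => ?_, False.elim⟩
    obtain ⟨s, hs⟩ := h.1
    exact hp s hs
  · intro s
    rw [← fib_in hP (cof s)] at h
    convert h using 1
    ext w; constructor
    · exact fun h => ⟨h.2, h.1.2⟩
    · exact fun h => ⟨⟨⟨s, h.1⟩, h.2⟩, h.1⟩

lemma mb_in {P : Cls} (hP : Inv P) {Y : Set Cantor} (h : P Y) : Cl True P (MB Y) := by
  refine cl_mk (fun s => {w | pr1 w = fin s}) (fun s => fib_closed _) ?_ ?_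
  · intro p hp
    refine ⟨fun h => trivial, fun _ => Or.inl fun h => ?_⟩
    obtain ⟨s, hs⟩ := h
    exact hp s hs
  · intro s
    rw [← fib_in hP (fin s)] at h
    convert h using 1
    ext w; constructor
    · rintro ⟨h | h, h'⟩
      · exact absurd ⟨s, h'⟩ h
      · exact ⟨h', h⟩
    · exact fun h => ⟨Or.inr h.2, h.1⟩

/-- inside every cone, a fibre over a point of `G` carries a copy of a cone of `Y` -/
lemma fib_cone {Q : Cls} (hQ : Her Q) (hi : Inv Q) {S G Y : Set Cantor} (hY : Now Q Y) (hY2 : ClosedUnderFinMod Y)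
    (hY0 : Y.Nonempty) {g : Cantor} (hg : g ∈ G) (hG : ClosedUnderFinMod G)
    (hS : ∀ a ∈ G, ∀ y, join a y ∈ S ↔ y ∈ Y) (d : List Bool) : ¬ Q (S ∩ cn d) := by
  intro h
  obtain ⟨p, hp⟩ := cn_ne d
  obtain ⟨y, hy⟩ := hY0
  rw [cn_cyl hp] at h
  set n := d.length
  have h1 := spl_mem hG hg (pr1 p) n
  have h2 := spl_mem hY2 hy (pr2 p) n
  have e1 := spl_cyl (pr1 p) n g
  have e2 := spl_cyl (pr2 p) n y
  refine hY _ ⟨_, h2, self_cyl _ n⟩ ?_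
  rw [← fib_in hi (spl (pr1 p) n g)]
  refine hQ _ _ h ?_
  have : {w | pr1 w = spl (pr1 p) n g ∧ pr2 w ∈ Y ∩ cyl (spl (pr2 p) n y) n} =
      (S ∩ cyl p n) ∩ ({w | pr1 w = spl (pr1 p) n g} ∩ pr2 ⁻¹' (cyl (spl (pr2 p) n y) n)) := by
    ext w; constructor
    · rintro ⟨h3, h4, h5⟩
      refine ⟨⟨?_, ?_⟩, h3, h5⟩
      · rw [← join_pr w]
        refine (hS _ ?_ _).2 h4
        rw [h3]; exact h1
      · rw [← join_pr w, ← join_pr p, mem_cyl]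
        refine EqU.mono (join_eqU (n := n) ?_ ?_) (by omega)
        · rw [h3]; exact mem_cyl.1 e1
        · exact (mem_cyl.1 h5).trans (mem_cyl.1 e2)
    · rintro ⟨⟨h3, h6⟩, h4, h5⟩
      refine ⟨h4, ?_, h5⟩
      rw [← join_pr w] at h3
      refine (hS _ ?_ _).1 h3
      rw [show pr1 w = _ from h4]; exact h1
  rw [this]
  exact rc_inter _ ((fib_closed _).inter ((cn_closed _).preimage cont_pr2))

lemma gen_now {ε : Prop} {Q : Cls} (hQ : Her Q) {ι : Type} [Countable ι] {S : Set Cantor}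
    (G : ι → Set Cantor) (hG : ∀ i, IsClosed (G i)) (hG0 : ∀ i d, ¬ cn d ⊆ G i)
    (hS : ∀ p c, p ∈ cn c → (p ∈ S ∩ cn c ↔ ε) → ∃ i, p ∈ G i) (hq : ∀ d, ¬ Q (S ∩ cn d)) :
    Now (Cl ε Q) S := by
  rintro c - ⟨F, h1, h2, h3⟩
  obtain ⟨i, d, hd, hdc⟩ := baire_cone (ι := ℕ ⊕ ι) (fun i => i.elim F G)
    (by rintro (i | i); exacts [h1 i, hG i]) (c := c) (by
      intro p hp
      by_cases h : ∃ k, p ∈ F k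
      · obtain ⟨k, hk⟩ := h; exact ⟨Sum.inl k, hk⟩
      · obtain ⟨i, hi⟩ := hS p c hp (h2 p (by simpa using h))
        exact ⟨Sum.inr i, hi⟩)
  rcases i with k | i
  · refine hq d (hQ _ _ (h3 k) ?_)
    have : S ∩ cn d = S ∩ cn c ∩ F k ∩ cn d := by
      ext w; constructor
      · exact fun h => ⟨⟨⟨h.1, hdc h.2⟩, hd h.2⟩, h.2⟩
      · exact fun h => ⟨h.1.1.1, h.2⟩
    rw [this]
    exact rc_inter _ (cn_closed _)
  · exact hG0 i d hd

lemma two_pts (d : List Bool) (m : ℕ) : ∃ p ∈ cn d, ∃ q ∈ cn d, ∃ n ≥ m, pr1 p n ≠ pr1 q n := by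
  obtain ⟨p, hp⟩ := cn_ne d
  refine ⟨p, hp, Function.update p (2 * (d.length + m)) (!p (2 * (d.length + m))), ?_, d.length + m, by omega, ?_⟩
  · rw [cn_cyl hp, mem_cyl]
    intro i hi
    exact Function.update_of_ne (by omega) _ _
  · simp [pr1]

lemma fib_cn (a : Cantor) (d : List Bool) : ¬ cn d ⊆ {w | pr1 w = a} := by
  intro h
  obtain ⟨p, hp, q, hq, n, -, hn⟩ := two_pts d 0
  rw [show pr1 p = a from h hp, show pr1 q = a from h hq] at hn
  exact hn rfl

lemma ma_now {Q : Cls} (hQ : Her Q) (hi : Inv Q) {Y : Set Cantor} (hY : Now Q Y) (hY2 : Up Y)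
    (hY0 : Y.Nonempty) : Now (Cl True Q) (MA Y) := by
  refine gen_now hQ (fun s => {w | pr1 w = cof s}) (fun s => fib_closed _) (fun s => fib_cn _) ?_ ?_
  · exact fun p c hp h => (h.2 trivial).1.1
  · refine fib_cone hQ hi hY hY2.2 hY0 one_cof cof_fm fun a ha y => ?_
    simp [MA, ha]

lemma mb_now {Q : Cls} (hQ : Her Q) {Y : Set Cantor} (h : ∀ d, ¬ Q (MB Y ∩ cn d)) :
    Now (Cl False Q) (MB Y) := by
  refine gen_now hQ (fun s => {w | pr1 w = fin s}) (fun s => fib_closed _) (fun s => fib_cn _) ?_ h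
  intro p c hp h
  by_contra hcon
  exact h.1 ⟨Or.inl hcon, hp⟩

lemma mb_fib {Q : Cls} (hQ : Her Q) (hi : Inv Q) {Y : Set Cantor} (hY : Now Q Y) (hY2 : Up Y)
    (hY0 : Y.Nonempty) : ∀ d, ¬ Q (MB Y ∩ cn d) := by
  refine fib_cone hQ hi hY hY2.2 hY0 zero_fin fin_fm fun a ha y => ?_
  simp [MB, ha]

lemma semi_nowc {S : Set Cantor} (hS : IsSemifilter S) : NowC S := nowc_fm hS.2.2.2 hS.2.1 hS.1

lemma semi_dense {S : Set Cantor} (hS : IsSemifilter S) (c : List Bool) : (S ∩ cn c).Nonempty := by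
  obtain ⟨p, hp⟩ := cn_ne c
  refine ⟨spl p c.length fun _ => true, spl_mem hS.2.2.2 hS.2.1 _ _, ?_⟩
  rw [cn_cyl hp]; exact spl_cyl _ _ _

lemma cantor_unc : Cardinal.aleph0 < Cardinal.mk Cantor := by
  simpa using Cardinal.cantor Cardinal.aleph0

lemma cn_unc (d : List Bool) : ¬ (cn d).Countable := by
  intro h
  obtain ⟨p, hp⟩ := cn_ne d
  have : Function.Injective fun y : Cantor => fun i => if i < d.length then p i else y (i - d.length) := by
    intro x y hxy
    funext i
    have := congrFun hxy (i + d.length)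
    simpa using this
  have h2 : (univ : Set Cantor).Countable := by
    refine MapsTo.countable_of_injOn (f := fun y : Cantor => fun i => if i < d.length then p i else y (i - d.length)) ?_ this.injOn h
    intro y _
    show _ ∈ cn d
    rw [cn_cyl hp]
    exact mem_cyl.2 fun i hi => if_pos hi
  rw [countable_univ_iff] at h2
  exact (Cardinal.mk_le_aleph0_iff.2 h2).not_gt cantor_unc

lemma models (j : ℕ) : (∃ S, IsSemifilter S ∧ Rc (j+1) S ∧ Now (Ga j) S) ∧
    (∃ S, IsSemifilter S ∧ Ga j S ∧ Now (Rc (j+2)) S) := by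
  have hA0 : ∃ S, IsSemifilter S ∧ Rc 1 S ∧ Now (Ga 0) S := by
    refine ⟨Cof, ⟨zero_cof, one_cof, cof_up, cof_fm⟩, ?_, ?_⟩
    · show Cof.Countable
      have : Cof = range cof := by ext x; simp [Cof, eq_comm]
      rw [this]; exact countable_range _
    · refine gen_now (rc_her 0) (fun s => {cof s}) (fun s => isClosed_singleton) ?_ ?_ ?_
      · intro s d h
        exact cn_unc d ((countable_singleton _).mono h)
      · intro p c hp h; exact (h.2 trivial).1
      · intro d h
        have := semi_dense ⟨zero_cof, one_cof, cof_up, cof_fm⟩ d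
        exact this.ne_empty h
  have hA1 : ∃ S, IsSemifilter S ∧ Rc 2 S ∧ Now (Ga 1) S := by
    have hu : Up univ := ⟨fun _ _ _ _ => trivial, fun _ _ _ _ => trivial⟩
    refine ⟨MA univ, ma_semi hu trivial, ma_in inv_compact isCompact_univ, ?_⟩
    refine ma_now (rc_her 1) (rc_inv 1) ?_ hu univ_nonempty
    intro c _ h
    refine cn_unc c ?_
    have h' : (univ ∩ cn c).Countable := h
    rwa [univ_inter] at h'
  have hB0 : ∃ S, IsSemifilter S ∧ Ga 0 S ∧ Now (Rc 2) S := by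
    have hu : Up ∅ := ⟨fun _ h => h.elim, fun _ h => h.elim⟩
    have hs := mb_semi hu (notMem_empty _)
    refine ⟨MB ∅, hs, mb_in (rc_inv 0) (rc_emp 0), ?_⟩
    refine mb_now her_compact fun d h => ?_
    obtain ⟨p, hp⟩ := semi_dense hs d
    rw [cn_cyl hp.2] at h
    exact semi_nowc hs p hp.1 _ h
  have hA : ∀ j, (∃ S, IsSemifilter S ∧ Ga j S ∧ Now (Rc (j+2)) S) →
      ∃ S, IsSemifilter S ∧ Rc (j+3) S ∧ Now (Ga (j+2)) S := by
    rintro j ⟨S, hs, h1, h2⟩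
    exact ⟨MA S, ma_semi hs.2.2 hs.2.1, ma_in (ga_nice j).inv h1,
      ma_now (rc_her _) (rc_inv _) h2 hs.2.2 ⟨_, hs.2.1⟩⟩
  have hB : ∀ j, (∃ S, IsSemifilter S ∧ Rc (j+1) S ∧ Now (Ga j) S) →
      ∃ S, IsSemifilter S ∧ Ga (j+1) S ∧ Now (Rc (j+3)) S := by
    rintro j ⟨S, hs, h1, h2⟩
    exact ⟨MB S, mb_semi hs.2.2 hs.1, mb_in (rc_inv _) h1,
      mb_now (ga_nice j).her (mb_fib (ga_nice j).her (ga_nice j).inv h2 hs.2.2 ⟨_, hs.2.1⟩)⟩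
  have : ((∃ S, IsSemifilter S ∧ Rc (j+1) S ∧ Now (Ga j) S) ∧
    (∃ S, IsSemifilter S ∧ Ga j S ∧ Now (Rc (j+2)) S)) ∧
    (∃ S, IsSemifilter S ∧ Rc (j+2) S ∧ Now (Ga (j+1)) S) := by
    induction j with
    | zero => exact ⟨⟨hA0, hB0⟩, hA1⟩
    | succ j ih => exact ⟨⟨ih.2, hB j ih.1.1⟩, hA j ih.1.2⟩
  exact this.1

lemma hom_all {Q : Cls} (hQ : Nice Q) (hQ0 : Q ∅) {X : Set Cantor} (hX : Hom X) {c : List Bool}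
    (hc : (X ∩ cn c).Nonempty) (h : Q (X ∩ cn c)) : Q X := by
  obtain ⟨p, hp, hpc⟩ := hc
  refine hQ.glu X ∅ isClosed_empty (by rwa [inter_empty]) fun x hx _ => ?_
  obtain ⟨f, g, hf, hfx⟩ := hX x hx p hp
  obtain ⟨n, hn⟩ := (co_iff.1 hf.cf) x hx c.length
  refine ⟨n, ?_⟩
  have hsub : ∀ z ∈ X ∩ cyl x n, f z ∈ cn c := by
    intro z hz
    rw [cn_cyl hpc, ← hfx]
    exact mem_cyl.2 (hn z hz.1 (mem_cyl.1 hz.2))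
  have h1 : SHw f g (X ∩ cyl x n) (f '' (X ∩ cyl x n)) := hf.restrict inter_subset_left
  refine hQ.inv _ _ h1.symm.sh (hQ.her _ _ h ?_)
  refine (hf.rc (rc_inter X (cn_closed _))).sub ?_ inter_subset_left
  rintro _ ⟨z, hz, rfl⟩
  exact ⟨(hf.fx z hz.1).1, hsub z hz⟩

lemma hom_now {Q : Cls} (hQ : Nice Q) (hQ0 : Q ∅) {X : Set Cantor} (hX : Hom X) (h : ¬ Q X) :
    Now Q X := fun _ hc hq => h (hom_all hQ hQ0 hX hc hq)

theorem low {X : Set Cantor} (hX : Hom X) (hc : NowC X) (hd : ∀ c, (X ∩ cn c).Nonempty)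
    (h : ∃ j c, Ga j (X ∩ cn c)) : ∃ S, IsSemifilter S ∧ SH X S := by
  classical
  have h0 : ∃ j, Ga j X := by
    obtain ⟨j, c, h⟩ := h
    exact ⟨j, hom_all (ga_nice j) (rc_ga _ _ (rc_emp j)) hX (hd c) h⟩
  have hX0 : X.Nonempty := (hd []).mono inter_subset_left
  obtain ⟨j, hj, hmin⟩ : ∃ j, Ga j X ∧ ∀ i < j, ¬ Ga i X :=
    ⟨Nat.find h0, Nat.find_spec h0, fun i hi => Nat.find_min h0 hi⟩
  by_cases hr : Rc j X
  · cases j with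
    | zero => exact absurd hr hX0.ne_empty
    | succ i =>
      obtain ⟨S, hs, h1, h2⟩ := (models i).1
      exact ⟨S, hs, (uv i).2 X S hX0 ⟨_, hs.2.1⟩ hr h1
        (hom_now (ga_nice i) (rc_ga _ _ (rc_emp i)) hX (hmin i (by omega))) h2⟩
  · have hr2 : ¬ Rc (j+2) X := by
      intro h2
      obtain ⟨F, f1, f2, f3⟩ := hj
      have key : ∃ Q : Cls, Her Q ∧ Cl False Q X ∧ ∀ d, ¬ Q (X ∩ cn d) := by
        cases j with
        | zero =>
          refine ⟨IsCompact, her_compact, h2, fun d h => ?_⟩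
          obtain ⟨p, hp⟩ := hd d
          rw [cn_cyl hp.2] at h
          exact hc p hp.1 _ h
        | succ i =>
          refine ⟨Ga i, (ga_nice i).her, h2, fun d h => hmin i (by omega) ?_⟩
          exact hom_all (ga_nice i) (rc_ga _ _ (rc_emp i)) hX (hd d) h
      have sub : ∀ {Q : Cls}, Her Q → ∀ {F : Set Cantor} {d}, cn d ⊆ F → Q (X ∩ F) → Q (X ∩ cn d) := by
        intro Q hQ F d hd h
        have : X ∩ cn d = X ∩ F ∩ cn d := by
          rw [inter_assoc, inter_eq_self_of_subset_right hd]
        rw [this]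
        exact hQ.inter h (cn_closed d)
      obtain ⟨Q, hQH, ⟨C, c1, c2, c3⟩, hQ⟩ := key
      obtain ⟨i, d, hdi, -⟩ := baire_cone (ι := ℕ ⊕ ℕ) (fun i => i.elim F C)
        (by rintro (i | i); exacts [f1 i, c1 i]) (c := []) (by
          intro p _
          by_cases h : ∃ k, p ∈ F k
          · obtain ⟨k, hk⟩ := h; exact ⟨Sum.inl k, hk⟩
          · have hp := (f2 p (by simpa using h)).2 trivial
            by_contra hcon
            exact (c2 p (fun k hk => hcon ⟨Sum.inr k, hk⟩)).1 hp)
      rcases i with k | k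
      · exact hr (hom_all (rc_nice j) (rc_emp j) hX (hd d) (sub (rc_her j) hdi (f3 k)))
      · exact hQ d (sub hQH hdi (c3 k))
    obtain ⟨S, hs, h1, h2⟩ := (models j).2
    exact ⟨S, hs, (uv j).1 X S hX0 ⟨_, hs.2.1⟩ hj h1
        (hom_now (rc_nice _) (rc_emp _) hX hr2) h2⟩

end BD


namespace BD

/-! dense re-embedding -/

open Classical in
noncomputable def bw (X : Set Cantor) (x : Cantor) : ℕ → Option Bool := fun n =>
  if ∃ y ∈ X, EqU n y x ∧ y n ≠ x n then some (x n) else none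

lemma first_diff {x y : Cantor} (h : x ≠ y) : ∃ n, EqU n x y ∧ x n ≠ y n := by
  classical
  have h1 := Function.ne_iff.1 h
  exact ⟨Nat.find h1, fun i hi => not_not.1 (Nat.find_min h1 hi), Nat.find_spec h1⟩

lemma bw_loc {X : Set Cantor} {x x' : Cantor} {i : ℕ} (h : EqU (i+1) x x') : bw X x i = bw X x' i := by
  have h1 : x i = x' i := h i (by omega)
  have h2 : (∃ y ∈ X, EqU i y x ∧ y i ≠ x i) ↔ (∃ y ∈ X, EqU i y x' ∧ y i ≠ x' i) := by
    rw [h1]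
    exact exists_congr fun y => and_congr_right fun _ => and_congr_left fun _ =>
      ⟨fun h3 => h3.trans (h.mono (by omega)), fun h3 => h3.trans (h.mono (by omega)).symm⟩
  by_cases h3 : ∃ y ∈ X, EqU i y x ∧ y i ≠ x i
  · rw [bw, if_pos h3, bw, if_pos (h2.1 h3), h1]
  · rw [bw, if_neg h3, bw, if_neg fun h => h3 (h2.2 h)]

lemma bw_split {X : Set Cantor} {x y : Cantor} {i : ℕ} (hy : y ∈ X) (h : EqU i y x) (h' : y i ≠ x i) :
    bw X x i = some (x i) := if_pos ⟨y, hy, h, h'⟩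

lemma bw_inf {X : Set Cantor} (hX : NowC X) {x : Cantor} (hx : x ∈ X) : InfD (bw X x) := by
  rw [infD_iff]
  intro n
  have : ∃ y ∈ X ∩ cyl x n, y ≠ x := by
    by_contra hcon
    push Not at hcon
    refine hX x hx n ?_
    have : X ∩ cyl x n = {x} := by
      ext y; constructor
      · exact hcon y
      · rintro rfl; exact ⟨hx, self_cyl _ _⟩
    rw [this]; exact isCompact_singleton
  obtain ⟨y, ⟨hy, hyn⟩, hne⟩ := this
  obtain ⟨m, h1, h2⟩ := first_diff hne
  refine ⟨m, ?_, by rw [bw_split hy h1 h2]; rfl⟩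
  by_contra hcon
  exact h2 (mem_cyl.1 hyn m (by omega))

lemma dep_at {w : ℕ → Option Bool} {i : ℕ} {b : Bool} (h : w i = some b) :
    dep w (Nat.count (fun n => (w n).isSome = true) i) = b := by
  unfold dep
  rw [Nat.nth_count (p := fun n => (w n).isSome = true) (by simp [h]), h]
  rfl

lemma count_loc {w w' : ℕ → Option Bool} {i : ℕ} (h : EqU i w w') :
    Nat.count (fun n => (w n).isSome = true) i = Nat.count (fun n => (w' n).isSome = true) i := by
  induction i with
  | zero => simp
  | succ i ih =>
    rw [Nat.count_succ, Nat.count_succ, ih (h.mono (by omega)), h i (by omega)]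

lemma dep_below {w w' : ℕ → Option Bool} {i : ℕ} (hw : InfD w) (h : EqU i w' w) :
    EqU (Nat.count (fun n => (w n).isSome = true) i) (dep w') (dep w) := by
  intro k hk
  refine dep_local hw k (h.mono ?_)
  exact Nat.nth_lt_of_lt_count hk

lemma re_inv {X : Set Cantor} {x y : Cantor} (hx : x ∈ X) (hy : y ∈ X) {n : ℕ}
    (h : EqU n (dep (bw X x)) (dep (bw X y))) : EqU n x y := by
  by_contra hcon
  have hne : x ≠ y := fun h => hcon (h ▸ EqU.refl _ _)
  obtain ⟨i, h1, h2⟩ := first_diff hne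
  have hi : i < n := by
    by_contra h3
    exact hcon (h1.mono (by omega))
  have e1 := dep_at (bw_split hy h1.symm h2.symm)
  have e2 := dep_at (bw_split hx h1 h2)
  have e3 : EqU i (bw X x) (bw X y) := fun j hj => bw_loc (h1.mono (by omega))
  rw [← count_loc e3] at e2
  refine h2 (e1.symm.trans ((h _ ?_).trans e2))
  exact (Nat.count_le _).trans_lt hi

lemma re_dense {X : Set Cantor} (hX : NowC X) (hX0 : X.Nonempty) (c : List Bool) :
    ∃ x ∈ X, dep (bw X x) ∈ cn c := by
  induction c with
  | nil => obtain ⟨x, hx⟩ := hX0; exact ⟨x, hx, rfl⟩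
  | cons a c ih =>
    obtain ⟨x, hx, hxc⟩ := ih
    set p := fun n => (bw X x n).isSome = true with hp
    have hi := bw_inf hX hx
    have h1 : p (Nat.nth p c.length) := Nat.nth_mem_of_infinite hi _
    have hcnt : Nat.count p (Nat.nth p c.length) = c.length := Nat.count_nth_of_infinite hi _
    have key : ∃ y ∈ X, EqU (Nat.nth p c.length) y x ∧ bw X y (Nat.nth p c.length) = some a := by
      set i := Nat.nth p c.length
      have h2 : ∃ y ∈ X, EqU i y x ∧ y i ≠ x i := by
        by_contra hcon
        simp only [hp, bw, if_neg hcon] at h1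
        simp at h1
      obtain ⟨y, hy, h3, h4⟩ := h2
      by_cases ha : x i = a
      · exact ⟨x, hx, EqU.refl _ _, by rw [bw_split hy h3 h4, ha]⟩
      · refine ⟨y, hy, h3, ?_⟩
        rw [bw_split hx h3.symm h4.symm]
        congr 1
        revert ha h4
        cases x i <;> cases y i <;> cases a <;> simp
    obtain ⟨y, hy, h3, h4⟩ := key
    have e3 : EqU (Nat.nth p c.length) (bw X y) (bw X x) := fun j hj => bw_loc (h3.mono (by omega))
    refine ⟨y, hy, ?_⟩
    show PiNat.res _ (c.length + 1) = a :: c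
    rw [PiNat.res_succ]
    congr 1
    · have := dep_at h4
      rwa [count_loc e3, hcnt] at this
    · rw [← show PiNat.res (dep (bw X x)) c.length = c from hxc, PiNat.res_length]
      have := dep_below hi e3
      rw [hcnt] at this
      exact this.res

lemma nowc_sh {X Y : Set Cantor} (h : SH X Y) (hX : NowC X) : NowC Y := by
  obtain ⟨f, g, h⟩ := h.ex
  intro y hy n hc
  obtain ⟨m, hm⟩ := co_iff.1 h.cf _ (h.gy y hy).1 n
  have h1 : SHw f g (X ∩ cyl (g y) m) (f '' (X ∩ cyl (g y) m)) := h.restrict inter_subset_left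
  refine hX _ (h.gy y hy).1 m (inv_compact _ _ h1.symm.sh (her_compact _ _ hc ?_))
  refine (h.rc (rc_inter X (cn_closed _))).sub ?_ inter_subset_left
  rintro _ ⟨z, hz, rfl⟩
  refine ⟨(h.fx z hz.1).1, mem_cyl.2 ?_⟩
  have := hm z hz.1 (mem_cyl.1 hz.2)
  rwa [(h.gy y hy).2] at this

lemma reembed {X : Set Cantor} (hB : Bor X) (hX : NowC X) (hX0 : X.Nonempty) :
    ∃ Y, SH X Y ∧ Bor Y ∧ ∀ c, (Y ∩ cn c).Nonempty := by
  set f : Cantor → Cantor := fun x => dep (bw X x)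
  have hinj : InjOn f X := fun x hx y hy hxy => EqU.eq fun n =>
    re_inv hx hy (by rw [show dep (bw X x) = dep (bw X y) from hxy]; exact EqU.refl _ _)
  have hcf : ContinuousOn f X := by
    rw [co_iff]
    intro x hx k
    refine ⟨Nat.nth (fun n => (bw X x n).isSome = true) k + 1, fun z _ hz i hi =>
      dep_local (bw_inf hX hx) i ?_⟩
    have := Nat.nth_monotone (bw_inf hX hx) hi.le
    exact fun j hj => bw_loc (hz.mono (by omega))
  refine ⟨f '' X, ⟨f, Function.invFunOn f X, hcf, ?_, ?_, ?_⟩, ?_, ?_⟩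
  · rw [co_iff]
    rintro _ ⟨x, hx, rfl⟩ k
    refine ⟨k, ?_⟩
    rintro _ ⟨z, hz, rfl⟩ hzx
    rw [hinj.leftInvOn_invFunOn hx, hinj.leftInvOn_invFunOn hz]
    exact re_inv hz hx hzx
  · exact fun x hx => ⟨mem_image_of_mem f hx, hinj.leftInvOn_invFunOn hx⟩
  · exact fun y hy => ⟨Function.invFunOn_mem hy, Function.invFunOn_eq hy⟩
  · let := borel Cantor; have : BorelSpace Cantor := ⟨rfl⟩
    have := pol
    exact MeasurableSet.image_of_continuousOn_injOn hB hcf hinj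
  · intro c
    obtain ⟨x, hx, h⟩ := re_dense hX hX0 c
    exact ⟨_, mem_image_of_mem f hx, h⟩

/-! category -/

def Mgr (A : Set Cantor) : Prop := ∃ F : ℕ → Set Cantor, (∀ k, IsClosed (F k)) ∧
  (∀ k d, ¬ cn d ⊆ F k) ∧ ∀ p ∈ A, ∃ k, p ∈ F k

lemma mgr_iff (A : Set Cantor) : Mgr A ↔ IsMeagre A := by
  rw [isMeagre_iff_countable_union_isNowhereDense]
  constructor
  · rintro ⟨F, h1, h2, h3⟩
    refine ⟨range F, ?_, countable_range _, ?_⟩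
    · rintro _ ⟨k, rfl⟩
      rw [IsNowhereDense, (h1 k).closure_eq, eq_empty_iff_forall_notMem]
      intro p hp
      obtain ⟨n, hn⟩ := open_cyl isOpen_interior hp
      exact h2 k _ (hn.trans interior_subset)
    · intro p hp
      obtain ⟨k, hk⟩ := h3 p hp
      exact ⟨_, ⟨k, rfl⟩, hk⟩
  · rintro ⟨S, h1, h2, h3⟩
    obtain ⟨e, he⟩ := (h2.insert ∅).exists_eq_range (insert_nonempty _ _)
    refine ⟨fun k => closure (e k), fun k => isClosed_closure, fun k d hd => ?_, fun p hp => ?_⟩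
    · have hk : e k ∈ insert ∅ S := he ▸ mem_range_self k
      have hn : IsNowhereDense (e k) := by
        rcases hk with hk | hk
        · rw [hk, IsNowhereDense]; simp
        · exact h1 _ hk
      obtain ⟨p, hp⟩ := cn_ne d
      have : p ∈ interior (closure (e k)) := interior_maximal hd (cn_open d) hp
      rw [hn] at this
      exact this
    · obtain ⟨t, ht, hpt⟩ := h3 hp
      have : t ∈ range e := he ▸ mem_insert_of_mem _ ht
      obtain ⟨k, rfl⟩ := this
      exact ⟨k, subset_closure hpt⟩

lemma cat {X : Set Cantor} (hB : Bor X) (hX : Hom X) (hd : ∀ c, (X ∩ cn c).Nonempty) :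
    Mgr X ∨ Mgr Xᶜ := by
  have glob : ∀ t, IsMeagre (X ∩ cn t) → IsMeagre X := by
    intro t ht
    obtain ⟨F, h1, h2, h3⟩ := (mgr_iff _).2 ht
    obtain ⟨p, hp, hpt⟩ := hd t
    have loc : ∀ x ∈ X, ∃ n, IsMeagre (X ∩ cyl x n) := by
      intro x hx
      obtain ⟨f, g, h, hfx⟩ := hX x hx p hp
      obtain ⟨n, hn⟩ := co_iff.1 h.cf x hx t.length
      have hsub : ∀ z ∈ X ∩ cyl x n, f z ∈ X ∩ cn t := by
        intro z hz
        refine ⟨(h.fx z hz.1).1, ?_⟩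
        rw [cn_cyl hpt, ← hfx]
        exact mem_cyl.2 (hn z hz.1 (mem_cyl.1 hz.2))
      refine ⟨n, (mgr_iff _).1 ⟨fun k => closure (X ∩ cyl x n ∩ f ⁻¹' F k), fun k => isClosed_closure,
        fun k d hdk => ?_, fun z hz => ?_⟩⟩
      · have hin : ∀ z ∈ X ∩ cn d, f z ∈ F k := by
          rintro z ⟨hz, hzd⟩
          by_contra hcon
          obtain ⟨m, hm⟩ := open_cyl (h1 k).isOpen_compl hcon
          obtain ⟨l, hl⟩ := co_iff.1 h.cf z hz m
          obtain ⟨y, hy, hyl⟩ := mem_closure_cyl.1 (hdk hzd) l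
          exact hm (mem_cyl.2 (hl y hy.1.1 (mem_cyl.1 hyl))) hy.2
        obtain ⟨a, ha, had⟩ := hd d
        obtain ⟨m, hm⟩ := co_iff.1 h.cg _ (h.fx a ha).1 d.length
        refine h2 k (PiNat.res (f a) m) fun q hq => ?_
        rw [← (h1 k).closure_eq, mem_closure_cyl]
        intro l
        obtain ⟨z, hz, hzl⟩ := hd (PiNat.res q (max l m))
        refine ⟨z, ?_, cyl_mono (le_max_left _ _) hzl⟩
        have e1 : EqU m z (f a) :=
          ((mem_cyl.1 hzl).mono (le_max_right _ _)).trans (mem_cyl.1 hq)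
        have e2 := hm z hz e1
        rw [(h.fx a ha).2] at e2
        have := hin (g z) ⟨(h.gy z hz).1, by rw [cn_cyl had]; exact mem_cyl.2 e2⟩
        rwa [(h.gy z hz).2] at this
      · obtain ⟨k, hk⟩ := h3 _ (hsub z hz)
        exact ⟨k, subset_closure ⟨hz, hk⟩⟩
    have : X ⊆ ⋃ c : {c : List Bool // IsMeagre (X ∩ cn c)}, X ∩ cn c.1 := by
      intro x hx
      obtain ⟨n, hn⟩ := loc x hx
      exact mem_iUnion.2 ⟨⟨_, hn⟩, hx, self_cyl _ _⟩
    exact (isMeagre_iUnion fun c : {c : List Bool // IsMeagre (X ∩ cn c)} => c.2).mono this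
  rw [mgr_iff, mgr_iff]
  obtain ⟨u, hu, hXu⟩ : ∃ u, IsOpen u ∧ X =ᶠ[residual Cantor] u := by
    let := borel Cantor; have : BorelSpace Cantor := ⟨rfl⟩
    exact MeasurableSet.residualEq_isOpen hB
  have hm : IsMeagre {x | ¬ (x ∈ X ↔ x ∈ u)} := by
    rw [Filter.eventuallyEq_set] at hXu
    rw [IsMeagre]
    refine Filter.mem_of_superset hXu fun x hx h => h hx
  by_cases ht : ∃ t, cn t ∩ u = ∅
  · obtain ⟨t, ht⟩ := ht
    left
    refine glob t (hm.mono ?_)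
    rintro x ⟨hx, hxt⟩ h
    have : x ∈ cn t ∩ u := ⟨hxt, h.1 hx⟩
    rw [ht] at this; exact this
  · right
    have h2 : IsMeagre uᶜ := (mgr_iff _).1 ⟨fun _ => uᶜ, fun _ => hu.isClosed_compl, fun _ d hd => ht ⟨d, ?_⟩,
      fun p hp => ⟨0, hp⟩⟩
    · refine (h2.union hm).mono fun x hx => ?_
      by_cases hxu : x ∈ u
      · exact Or.inr fun h => hx (h.2 hxu)
      · exact Or.inl hxu
    · rw [eq_empty_iff_forall_notMem]
      exact fun x hx => hd hx.1 hx.2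

end BD


namespace BD

/-! no set with the property of Baire is flipped by all single bit changes -/

def flipb (m : ℕ) (z : Cantor) : Cantor := Function.update z m (!z m)

lemma flipb_ne {m i : ℕ} (h : i ≠ m) (z : Cantor) : flipb m z i = z i := Function.update_of_ne h _ _
lemma flipb_eq (m : ℕ) (z : Cantor) : flipb m z m = !z m := Function.update_self _ _ _
lemma flipb_flipb (m : ℕ) (z : Cantor) : flipb m (flipb m z) = z := by
  funext i
  by_cases h : i = m
  · subst h; rw [flipb_eq, flipb_eq, Bool.not_not]
  · rw [flipb_ne h, flipb_ne h]

lemma flipb_eqU {m n : ℕ} {z w : Cantor} (h : EqU n z w) : EqU n (flipb m z) (flipb m w) := by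
  intro i hi
  by_cases hm : i = m
  · subst hm; rw [flipb_eq, flipb_eq, h i hi]
  · rw [flipb_ne hm, flipb_ne hm, h i hi]

lemma flipb_cont (m : ℕ) : Continuous (flipb m) :=
  cont_iff.2 fun _ k => ⟨k, fun _ hz => flipb_eqU hz⟩

lemma no_flip_set {E : Set Cantor} (hE : Bor E) (h : ∀ z m, flipb m z ∈ E ↔ z ∉ E) : False := by
  obtain ⟨u, hu, hXu⟩ : ∃ u, IsOpen u ∧ E =ᶠ[residual Cantor] u := by
    let := borel Cantor; have : BorelSpace Cantor := ⟨rfl⟩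
    exact MeasurableSet.residualEq_isOpen hE
  have hm : IsMeagre {x | ¬ (x ∈ E ↔ x ∈ u)} := by
    rw [Filter.eventuallyEq_set] at hXu
    rw [IsMeagre]
    refine Filter.mem_of_superset hXu fun x hx h => h hx
  obtain ⟨F, h1, h2, h3⟩ := (mgr_iff _).2 hm
  have hd : ∃ d, ∃ ε : Prop, ∀ p ∈ cn d, (p ∈ u ↔ ε) := by
    by_cases hu0 : u.Nonempty
    · obtain ⟨p, hp⟩ := hu0
      obtain ⟨n, hn⟩ := open_cyl hu hp
      exact ⟨_, True, fun p hp => ⟨fun _ => trivial, fun _ => hn hp⟩⟩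
    · exact ⟨[], False, fun p _ => ⟨fun hp => hu0 ⟨p, hp⟩, False.elim⟩⟩
  obtain ⟨d, ε, hd⟩ := hd
  set m := d.length
  have hfd : ∀ p ∈ cn d, flipb m p ∈ cn d := by
    intro p hp
    rw [cn_cyl hp]
    exact mem_cyl.2 fun i hi => flipb_ne (ne_of_lt hi) _
  obtain ⟨i, c, hc, -⟩ := baire_cone (ι := ℕ ⊕ ℕ) (fun i => i.elim F fun k => flipb m ⁻¹' F k)
    (by rintro (k | k); exacts [h1 k, (h1 k).preimage (flipb_cont m)]) (c := d) (by
      intro p hp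
      by_cases hpE : p ∈ E ↔ p ∈ u
      · obtain ⟨k, hk⟩ := h3 (flipb m p) (by
          intro hcon
          have e1 := hd p hp
          have e2 := hd _ (hfd p hp)
          have e3 := h p m
          tauto)
        exact ⟨Sum.inr k, hk⟩
      · obtain ⟨k, hk⟩ := h3 p hpE
        exact ⟨Sum.inl k, hk⟩)
  rcases i with k | k
  · exact h2 k c hc
  · obtain ⟨p, hp⟩ := cn_ne c
    refine h2 k (PiNat.res (flipb m p) c.length) fun q hq => ?_
    have : flipb m q ∈ cn c := by
      rw [cn_cyl hp]
      refine mem_cyl.2 ?_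
      have := flipb_eqU (m := m) (mem_cyl.1 hq)
      rwa [flipb_flipb] at this
    have h4 : flipb m (flipb m q) ∈ F k := hc this
    rwa [flipb_flipb] at h4

lemma no_flip {X : Set Cantor} (hX : Bor X) (y : ℕ → Cantor → Cantor) (hc : Continuous (y 0))
    (hdep : ∀ m z z', (∀ i ≥ m, z i = z' i) → y m z = y m z')
    (hy : ∀ m z, y m z ∈ X ↔ (y (m+1) z ∈ X ↔ z m = false)) : False := by
  refine no_flip_set (bor_pre' hc hX) fun z m => ?_
  have key : ∀ k ≤ m, (y k (flipb m z) ∈ X ↔ ¬ y k z ∈ X) := by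
    intro k hk
    induction hk using Nat.decreasingInduction with
    | self =>
      rw [hy m, hy m z, hdep (m+1) (flipb m z) z fun i hi => flipb_ne (by omega) _, flipb_eq]
      cases z m <;> simp
    | of_succ k hk ih =>
      rw [hy k, hy k z, ih, flipb_ne (by omega)]
      tauto
  exact key 0 (Nat.zero_le m)

/-! the self-duality lemma -/

section sd
variable (D : Set Cantor) (p : Cantor) (O : ℕ → Set Cantor) (F : ℕ → Bool → Cantor → Cantor)

def SelC (L : List (Cantor → Cantor)) (n l : ℕ) : Prop := ∀ h ∈ L, ∃ j ≥ n, cyl (h p) j ⊆ O n ∧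
  ∀ q ∈ D, EqU l q p → EqU j (h q) (h p)

open Classical in
noncomputable def sel (L : List (Cantor → Cantor)) (n : ℕ) : ℕ :=
  if h : ∃ l, SelC D p O L n l then h.choose else 0

noncomputable def fam : ℕ → List (Cantor → Cantor)
  | 0 => [id]
  | n+1 => id :: ((fam n).map (fun h => h ∘ F (sel D p O (fam n) n) false) ++
      (fam n).map (fun h => h ∘ F (sel D p O (fam n) n) true))

noncomputable def ll (n : ℕ) : ℕ := sel D p O (fam D p O F n) n

noncomputable def cmp (z : Cantor) (m : ℕ) : ℕ → Cantor → Cantor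
  | 0 => id
  | k+1 => cmp z m k ∘ F (ll D p O F (m+k)) (z (m+k))

lemma cmp_mem (z : Cantor) (m k : ℕ) : cmp D p O F z m k ∈ fam D p O F (m+k) := by
  induction k with
  | zero =>
    show id ∈ fam D p O F m
    cases m with
    | zero => simp [fam]
    | succ m => simp [fam]
  | succ k ih =>
    show cmp D p O F z m k ∘ F (ll D p O F (m+k)) (z (m+k)) ∈ fam D p O F (m+k+1)
    rw [fam]
    refine List.mem_cons_of_mem _ (List.mem_append.2 ?_)
    cases hz : z (m+k)
    · exact Or.inl (List.mem_map.2 ⟨_, ih, rfl⟩)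
    · exact Or.inr (List.mem_map.2 ⟨_, ih, rfl⟩)

lemma cmp_add (z : Cantor) (m a b : ℕ) :
    cmp D p O F z m (a+b) = cmp D p O F z m a ∘ cmp D p O F z (m+a) b := by
  induction b with
  | zero => rfl
  | succ b ih =>
    show cmp D p O F z m (a+b) ∘ F (ll D p O F (m+(a+b))) (z (m+(a+b))) = _ ∘
      (cmp D p O F z (m+a) b ∘ F (ll D p O F (m+a+b)) (z (m+a+b)))
    rw [ih, ← Nat.add_assoc]; rfl

lemma cmp_dep (z z' : Cantor) (m k : ℕ) (h : ∀ i, m ≤ i → i < m + k → z i = z' i) :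
    cmp D p O F z m k = cmp D p O F z' m k := by
  induction k with
  | zero => rfl
  | succ k ih =>
    show cmp D p O F z m k ∘ F (ll D p O F (m+k)) (z (m+k)) =
      cmp D p O F z' m k ∘ F (ll D p O F (m+k)) (z' (m+k))
    rw [ih fun i h1 h2 => h i h1 (by omega), h (m+k) (by omega) (by omega)]

end sd

lemma sd {X D : Set Cantor} (hX : Bor X) (hD : IsGδ D) (hD0 : D.Nonempty)
    (H : ∀ t, (D ∩ cn t).Nonempty → ∀ b : Bool, ∃ f, ContinuousOn f D ∧
      ∀ x ∈ D, f x ∈ D ∩ cn t ∧ (x ∈ X ↔ (f x ∈ X ↔ b = false))) : False := by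
  obtain ⟨p, hp⟩ := hD0
  obtain ⟨O, hO, hOD, hDO⟩ : ∃ O : ℕ → Set Cantor, (∀ n, IsOpen (O n)) ∧
      (∀ x, x ∈ D ↔ ∀ n, ∃ k ≥ n, x ∈ O k) ∧ ∀ x ∈ D, ∀ n, x ∈ O n := by
    obtain ⟨U, hU, rfl⟩ := isGδ_iff_eq_iInter_nat.1 hD
    refine ⟨fun n => ⋂ i ∈ Finset.range (n+1), U i, fun n => isOpen_biInter_finset fun i _ => hU i, fun x => ?_,
      fun x hx n => ?_⟩
    · simp only [mem_iInter, Finset.mem_range]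
      constructor
      · exact fun h n => ⟨n, le_rfl, fun i _ => h i⟩
      · intro h n
        obtain ⟨k, hk, h1⟩ := h n
        exact h1 n (by omega)
    · simp only [mem_iInter] at hx ⊢
      exact fun i _ => hx i
  have H' : ∀ (l : ℕ) (b : Bool), ∃ f, ContinuousOn f D ∧
      ∀ x ∈ D, f x ∈ D ∩ cyl p l ∧ (x ∈ X ↔ (f x ∈ X ↔ b = false)) :=
    fun l b => H _ ⟨p, hp, self_cyl p l⟩ b
  choose F hFc hF using H'
  set l := ll D p O F with hl
  set C := cmp D p O F with hC
  have hsel : ∀ (L : List (Cantor → Cantor)) n, (∀ h ∈ L, ContinuousOn h D ∧ MapsTo h D D) →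
      ∃ l, SelC D p O L n l := by
    intro L n
    induction L with
    | nil => exact fun _ => ⟨0, by simp [SelC]⟩
    | cons h L ih =>
      intro hL
      obtain ⟨l1, h1⟩ := ih fun h hh => hL h (List.mem_cons_of_mem _ hh)
      obtain ⟨hc, hm⟩ := hL h List.mem_cons_self
      obtain ⟨j, hj⟩ := open_cyl (hO n) (hDO _ (hm hp) n)
      obtain ⟨l2, h2⟩ := co_iff.1 hc p hp (max j n)
      refine ⟨max l1 l2, fun h' hh' => ?_⟩
      rcases List.mem_cons.1 hh' with rfl | hh'
      · exact ⟨max j n, le_max_right _ _, (cyl_mono (le_max_left _ _)).trans hj,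
          fun q hq hqp => h2 q hq (hqp.mono (le_max_right _ _))⟩
      · obtain ⟨j, h3, h4, h5⟩ := h1 h' hh'
        exact ⟨j, h3, h4, fun q hq hqp => h5 q hq (hqp.mono (le_max_left _ _))⟩
  have hfam : ∀ n, ∀ h ∈ fam D p O F n, ContinuousOn h D ∧ MapsTo h D D := by
    intro n
    induction n with
    | zero => simp [fam, continuousOn_id, mapsTo_id]
    | succ n ih =>
      intro h hh
      rw [fam, List.mem_cons, List.mem_append, List.mem_map, List.mem_map] at hh
      have hF' : ∀ l b, MapsTo (F l b) D D := fun l b x hx => (hF l b x hx).1.1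
      rcases hh with rfl | ⟨h', h1, rfl⟩ | ⟨h', h1, rfl⟩
      · exact ⟨continuousOn_id, mapsTo_id _⟩
      · exact ⟨(ih h' h1).1.comp (hFc _ _) (hF' _ _), (ih h' h1).2.comp (hF' _ _)⟩
      · exact ⟨(ih h' h1).1.comp (hFc _ _) (hF' _ _), (ih h' h1).2.comp (hF' _ _)⟩
  have hll : ∀ n, SelC D p O (fam D p O F n) n (l n) := by
    intro n
    have := hsel _ n (hfam n)
    show SelC D p O (fam D p O F n) n (sel D p O (fam D p O F n) n)
    rw [sel, dif_pos this]
    exact this.choose_spec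
  have hCD : ∀ z m k, ContinuousOn (C z m k) D ∧ MapsTo (C z m k) D D :=
    fun z m k => hfam _ _ (cmp_mem D p O F z m k)
  have hone : ∀ z m, C z m 1 = F (l m) (z m) := fun z m => rfl
  have hnear : ∀ z m k, EqU (l m) (C z m k p) p := by
    intro z m k
    cases k with
    | zero => exact EqU.refl _ _
    | succ k =>
      rw [Nat.add_comm k 1, hC, cmp_add]
      exact mem_cyl.1 (hF (l m) (z m) _ ((hCD z (m+1) k).2 hp)).1.2
  have hst : ∀ z m k, ∃ j ≥ m + k, cyl (C z m k p) j ⊆ O (m+k) ∧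
      ∀ K ≥ k, EqU j (C z m K p) (C z m k p) := by
    intro z m k
    obtain ⟨j, h1, h2, h3⟩ := hll (m+k) _ (cmp_mem D p O F z m k)
    refine ⟨j, h1, h2, fun K hK => ?_⟩
    obtain ⟨r, rfl⟩ := Nat.exists_eq_add_of_le hK
    rw [hC, cmp_add]
    exact h3 _ ((hCD z (m+k) r).2 hp) (hnear z (m+k) r)
  set x : ℕ → Cantor → Cantor := fun m z i => C z m (i+1) p i with hx
  have hxl : ∀ z m k j, j ≥ m + k → (∀ K ≥ k, EqU j (C z m K p) (C z m k p)) →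
      EqU j (x m z) (C z m k p) := by
    intro z m k j hj h i hi
    rcases le_total (i+1) k with h1 | h1
    · obtain ⟨j', h2, -, h3⟩ := hst z m (i+1)
      exact (h3 k h1 i (by omega)).symm
    · exact h (i+1) h1 i hi
  have hxD : ∀ m z, x m z ∈ D := by
    intro m z
    rw [hOD]
    intro n
    obtain ⟨j, h1, h2, h3⟩ := hst z m n
    exact ⟨m+n, by omega, h2 (mem_cyl.2 (hxl z m n j h1 h3))⟩
  have hxk : ∀ m z k, EqU k (x m z) (C z m k p) := by
    intro m z k
    obtain ⟨j, h1, h2, h3⟩ := hst z m k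
    exact (hxl z m k j h1 h3).mono (by omega)
  have hstep : ∀ m z, F (l m) (z m) (x (m+1) z) = x m z := by
    intro m z
    refine EqU.eq fun n => ?_
    obtain ⟨k, hk⟩ := co_iff.1 (hFc (l m) (z m)) _ (hxD (m+1) z) n
    have e1 := hk (C z (m+1) (max n k) p) ((hCD _ _ _).2 hp)
      ((hxk (m+1) z (max n k)).symm.mono (le_max_right _ _))
    have e2 : C z m (1 + max n k) p = F (l m) (z m) (C z (m+1) (max n k) p) := by
      rw [hC, cmp_add]; rfl
    rw [← e2] at e1
    exact e1.symm.trans ((hxk m z (1 + max n k)).symm.mono (by omega))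
  refine no_flip hX x ?_ ?_ ?_
  · rw [cont_iff]
    intro z k
    refine ⟨k+1, fun z' hz i hi => ?_⟩
    simp only [hx]
    rw [hC, cmp_dep D p O F z' z 0 (i+1) fun j _ hj => hz j (by omega)]
  · intro m z z' h
    funext i
    simp only [hx]
    rw [hC, cmp_dep D p O F z z' m (i+1) fun j hj _ => h j hj]
  · intro m z
    have := (hF (l m) (z m) _ (hxD (m+1) z)).2
    rw [hstep] at this
    rw [this]
    tauto

end BD


namespace BD

/-! Martin-Monk -/

def Le (D A D' A' : Set Cantor) : Prop := ∃ f : Cantor → Cantor, ContinuousOn f D ∧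
  ∀ x ∈ D, f x ∈ D' ∧ (x ∈ A ↔ f x ∈ A')

section mm
variable (σ : ℕ → Bool → List Bool → Bool)

def pre (z : Cantor) : ℕ → ℕ → List Bool
  | 0, _ => []
  | k+1, n => σ n (z n) (pre z k (n+1)) :: pre z k n

def bd (n : ℕ) (z : Cantor) : Cantor := fun k => σ n (z n) (pre σ z k (n+1))

lemma bd_res (z : Cantor) (n k : ℕ) : PiNat.res (bd σ n z) k = pre σ z k n := by
  induction k with
  | zero => rfl
  | succ k ih => rw [PiNat.res_succ, ih]; rfl

lemma pre_dep (z z' : Cantor) (k : ℕ) : ∀ n, (∀ i, n ≤ i → i < n + k → z i = z' i) →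
    pre σ z k n = pre σ z' k n := by
  induction k with
  | zero => exact fun _ _ => rfl
  | succ k ih =>
    intro n h
    rw [pre, pre, ih n fun i h1 h2 => h i h1 (by omega),
      ih (n+1) fun i h1 h2 => h i (by omega) (by omega), h n le_rfl (by omega)]

end mm

lemma mm {X : Set Cantor} (hX : Bor X) {Φ : Set Cantor → Prop} {D0 : Set Cantor} (h0 : Φ D0)
    (hB : ∀ D, Φ D → Bor D) : ∃ D, Φ D ∧ ∀ D', Φ D' → Le D X D' X ∨ Le D Xᶜ D' X := by
  by_contra hcon
  push Not at hcon
  choose N hN1 hN2 using hcon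
  let Ds : ℕ → {D // Φ D} := fun n => Nat.rec ⟨D0, h0⟩ (fun _ D => ⟨N D.1 D.2, hN1 D.1 D.2⟩) n
  have hs : ∀ n, ∀ b : Bool, ∃ σ : List Bool → Bool, ∀ y : Cantor,
      (fun n => σ (PiNat.res y n)) ∈ (Ds n).1 ∧ (y ∈ (Ds (n+1)).1 →
        ((fun n => σ (PiNat.res y n)) ∈ X ↔ (y ∈ X ↔ b = false))) := by
    intro n b
    have h1 := hN2 (Ds n).1 (Ds n).2
    have h2 : (Ds (n+1)).1 = N (Ds n).1 (Ds n).2 := rfl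
    rw [← h2] at h1
    cases b with
    | true =>
      rcases wadge (hB _ (Ds n).2) hX (hB _ (Ds (n+1)).2) hX with h3 | ⟨σ, h3⟩
      · exact absurd h3 h1.1
      · refine ⟨σ, fun y => ⟨(h3 y).1, fun hy => ?_⟩⟩
        have := (h3 y).2 hy
        simpa using this
    | false =>
      rcases wadge (hB _ (Ds n).2) (bor_compl hX) (hB _ (Ds (n+1)).2) hX with h3 | ⟨σ, h3⟩
      · exact absurd h3 h1.2
      · refine ⟨σ, fun y => ⟨(h3 y).1, fun hy => ?_⟩⟩
        have := (h3 y).2 hy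
        rw [mem_compl_iff, not_iff_not] at this
        simpa using this
  choose σ hσ using hs
  have hbd : ∀ n z, bd σ n z = fun k => σ n (z n) (PiNat.res (bd σ (n+1) z) k) := by
    intro n z; funext k; rw [bd_res]; rfl
  have hD : ∀ n z, bd σ n z ∈ (Ds n).1 := by
    intro n z; rw [hbd]; exact (hσ n (z n) _).1
  refine no_flip hX (bd σ) ?_ ?_ ?_
  · rw [cont_iff]
    intro z k
    refine ⟨k+1, fun z' hz i hi => ?_⟩
    show σ 0 (z' 0) (pre σ z' i 1) = σ 0 (z 0) (pre σ z i 1)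
    rw [hz 0 (by omega), pre_dep σ z' z i 1 fun j _ hj => hz j (by omega)]
  · intro m z z' h
    funext k
    show σ m (z m) (pre σ z k (m+1)) = σ m (z' m) (pre σ z' k (m+1))
    rw [h m le_rfl, pre_dep σ z z' k (m+1) fun j hj _ => h j (by omega)]
  · intro m z
    have := (hσ m (z m) _).2 (hD (m+1) z)
    rw [← hbd] at this
    exact this

/-! low subsets of cones -/

def Fs (H : Set Cantor) : Prop := ∃ C : ℕ → Set Cantor, (∀ n, IsClosed (C n)) ∧ ∀ p, p ∈ H ↔ ∃ n, p ∈ C n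

lemma Fs.gd {H : Set Cantor} (h : Fs H) : IsGδ Hᶜ := by
  obtain ⟨C, h1, h2⟩ := h
  convert compl_gd h1 using 1
  ext p; simp [h2]

lemma gd_fs {G : Set Cantor} (h : IsGδ G) : Fs Gᶜ := by
  obtain ⟨H, h1, h2⟩ := gd_compl h
  exact ⟨H, h1, fun p => by simp [h2]⟩

inductive Lo (X : Set Cantor) (t : List Bool) : Set Cantor → Prop
  | base : Lo X t (cn t)
  | step (D H : Set Cantor) (ε : Prop) : Lo X t D → Fs H → (∀ x ∈ D, x ∈ H → (x ∈ X ↔ ε)) → Lo X t (D \ H)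

section lo
variable {X : Set Cantor} {t : List Bool}

lemma Lo.sub {D : Set Cantor} (h : Lo X t D) : D ⊆ cn t := by
  induction h with
  | base => exact Subset.rfl
  | step D H ε _ _ _ ih => exact sdiff_subset.trans ih

lemma Lo.gd {D : Set Cantor} (h : Lo X t D) : IsGδ D := by
  induction h with
  | base => exact (cn_open t).isGδ
  | step D H ε _ h _ ih => exact ih.inter h.gd

lemma Lo.cone {D : Set Cantor} (h : Lo X t D) {t' : List Bool} (ht : cn t' ⊆ cn t) :
    Lo X t' (D ∩ cn t') := by
  induction h with
  | base => rw [inter_eq_self_of_subset_right ht]; exact Lo.base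
  | step D H ε _ h1 h2 ih =>
    have : D \ H ∩ cn t' = (D ∩ cn t') \ H := by
      ext x; simp only [mem_inter_iff, mem_sdiff]; tauto
    rw [this]
    exact Lo.step _ H ε ih h1 fun x hx => h2 x hx.1

lemma Lo.inter {D D' : Set Cantor} (h : Lo X t D) (h' : Lo X t D') : Lo X t (D ∩ D') := by
  induction h' with
  | base => rwa [inter_eq_self_of_subset_left h.sub]
  | step D' H ε _ h1 h2 ih =>
    have : D ∩ (D' \ H) = (D ∩ D') \ H := by
      ext x; simp only [mem_inter_iff, mem_sdiff]; tauto
    rw [this]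
    exact Lo.step _ H ε ih h1 fun x hx => h2 x hx.2

lemma fs_pre {R H : Set Cantor} {g : Cantor → Cantor} (hg : ContinuousOn g R) (hH : Fs H) :
    ∃ H', Fs H' ∧ ∀ x ∈ R, (x ∈ H' ↔ g x ∈ H) := by
  obtain ⟨C, h1, h2⟩ := hH
  refine ⟨{x | ∃ n, x ∈ closure (R ∩ g ⁻¹' C n)}, ⟨_, fun n => isClosed_closure, fun p => Iff.rfl⟩,
    fun x hx => ?_⟩
  rw [h2]
  refine exists_congr fun n => ⟨fun h => ?_, fun h => subset_closure ⟨hx, h⟩⟩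
  by_contra hcon
  obtain ⟨m, hm⟩ := open_cyl (h1 n).isOpen_compl hcon
  obtain ⟨k, hk⟩ := co_iff.1 hg x hx m
  obtain ⟨y, hy, hyk⟩ := mem_closure_cyl.1 h k
  exact hm (mem_cyl.2 (hk y hy.1 (mem_cyl.1 hyk))) hy.2

lemma Lo.pre {R D : Set Cantor} (hR : Lo X t R) {g : Cantor → Cantor} (hg : ContinuousOn g R)
    (hgt : ∀ x ∈ R, g x ∈ cn t) (hgX : ∀ x ∈ R, (x ∈ X ↔ g x ∉ X)) (hD : Lo X t D) :
    Lo X t (R ∩ g ⁻¹' D) := by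
  induction hD with
  | base => rwa [inter_eq_self_of_subset_left (show R ⊆ g ⁻¹' cn t from hgt)]
  | step D H ε _ h1 h2 ih =>
    obtain ⟨H', h3, h4⟩ := fs_pre hg h1
    have : R ∩ g ⁻¹' (D \ H) = (R ∩ g ⁻¹' D) \ H' := by
      ext x; simp only [mem_inter_iff, mem_sdiff, mem_preimage]
      have := h4 x
      tauto
    rw [this]
    refine Lo.step _ H' (¬ ε) ih h3 fun x hx hxH => ?_
    rw [hgX x hx.1, h2 _ hx.2 ((h4 x hx.1).1 hxH)]

lemma Lo.ga {D : Set Cantor} (h : Lo X t D) :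
    ∃ n, ∀ C, IsClosed C → C ∩ D = ∅ → C ⊆ cn t → Ga n (X ∩ C) := by
  induction h with
  | base =>
    refine ⟨0, fun C _ h1 h2 => ?_⟩
    rw [inter_eq_self_of_subset_left h2] at h1
    rw [h1, inter_empty]
    exact rc_ga _ _ (rc_emp 0)
  | step D H ε hD h1 h2 ih =>
    obtain ⟨n, hn⟩ := ih
    obtain ⟨E, hE, hED⟩ := gd_compl hD.gd
    refine ⟨n + 3, fun C hC hCD hCt => ?_⟩
    obtain ⟨K, hK, hKC⟩ := gd_compl (show IsGδ C from hC.isGδ)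
    have hCH : ∀ x ∈ C, x ∈ D → (x ∈ X ↔ ε) := by
      intro x hx hxD
      refine h2 x hxD ?_
      by_contra hcon
      have : x ∈ C ∩ (D \ H) := ⟨hx, hxD, hcon⟩
      rw [hCD] at this
      exact this
    have hF : ∀ m, Ga n (X ∩ C ∩ (C ∩ E m)) := by
      intro m
      have : X ∩ C ∩ (C ∩ E m) = X ∩ (C ∩ E m) := by
        ext x; simp only [mem_inter_iff]; tauto
      rw [this]
      refine hn _ (hC.inter (hE m)) ?_ (inter_subset_left.trans hCt)
      rw [eq_empty_iff_forall_notMem]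
      exact fun x hx => (hED x).1 hx.2 m hx.1.2
    by_cases hε : ε
    · refine ga_mono (by omega) _ (cl_true_ga (j := n) ?_)
      have hO : Fs Cᶜ := gd_fs hC.isGδ
      obtain ⟨K, hK, hKC⟩ := hO
      refine cl_mk (ι := ℕ ⊕ ℕ) (fun i => i.elim (fun m => C ∩ E m) K) ?_ ?_ ?_
      · rintro (m | m)
        · exact hC.inter (hE m)
        · exact hK m
      · intro p hp
        have hpC : p ∈ C := by
          by_contra hcon
          obtain ⟨m, hm⟩ := (hKC p).1 hcon
          exact hp (Sum.inr m) hm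
        have hpD : p ∈ D := (hED p).2 fun m hm => hp (Sum.inl m) ⟨hpC, hm⟩
        have := hCH p hpC hpD
        simp [this, hε, hpC]
      · rintro (m | m)
        · exact hF m
        · have : X ∩ C ∩ K m = ∅ := by
            rw [eq_empty_iff_forall_notMem]
            exact fun x hx => (hKC x).2 ⟨m, hx.2⟩ hx.1.2
          show Ga n (X ∩ C ∩ K m)
          rw [this]
          exact rc_ga _ _ (rc_emp n)
    · refine rc_ga _ _ ?_
      refine ⟨fun m => C ∩ E m, fun m => hC.inter (hE m), fun p hp => ⟨fun h => ?_, False.elim⟩, hF⟩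
      have hpD : p ∈ D := (hED p).2 fun m hm => hp m ⟨h.2, hm⟩
      exact hε ((hCH p h.2 hpD).1 h.1)

lemma Lo.ne (hH : ∀ j c, ¬ Ga j (X ∩ cn c)) {D : Set Cantor} (h : Lo X t D) : D.Nonempty := by
  by_contra hcon
  rw [not_nonempty_iff_eq_empty] at hcon
  subst hcon
  obtain ⟨n, hn⟩ := h.ga
  exact hH n t (hn _ (cn_closed t) (inter_empty _) Subset.rfl)

end lo

/-- no flips of low sets -/
lemma lo_flip {X : Set Cantor} (hX : Bor X) (hH : ∀ j c, ¬ Ga j (X ∩ cn c)) (s : List Bool)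
    (hR : ∀ t, cn t ⊆ cn s → ∃ R g, Lo X t R ∧ ContinuousOn g R ∧
      ∀ x ∈ R, g x ∈ cn t ∧ (x ∈ X ↔ g x ∉ X)) : False := by
  obtain ⟨D, ⟨t, hts, hD⟩, hmin⟩ := mm hX (Φ := fun D => ∃ t, cn t ⊆ cn s ∧ Lo X t D)
    ⟨s, Subset.rfl, Lo.base⟩ (by rintro D ⟨t, -, h⟩; exact bor_gd h.gd)
  obtain ⟨R, g, hRl, hg, hgx⟩ := hR t hts
  have hflip : ∃ f, ContinuousOn f D ∧ ∀ x ∈ D, f x ∈ D ∧ (x ∈ X ↔ f x ∉ X) := by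
    rcases hmin (D ∩ (R ∩ g ⁻¹' D)) ⟨t, hts, hD.inter (hRl.pre hg (fun x hx => (hgx x hx).1)
      (fun x hx => (hgx x hx).2) hD)⟩ with ⟨f, hf, h⟩ | ⟨f, hf, h⟩
    · refine ⟨g ∘ f, hg.comp hf fun x hx => (h x hx).1.2.1, fun x hx => ⟨(h x hx).1.2.2, ?_⟩⟩
      rw [(h x hx).2]; exact (hgx _ (h x hx).1.2.1).2
    · refine ⟨f, hf, fun x hx => ⟨(h x hx).1.1, ?_⟩⟩
      have := (h x hx).2
      rw [mem_compl_iff] at this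
      tauto
  obtain ⟨f, hf, hfx⟩ := hflip
  refine sd hX hD.gd (hD.ne hH) fun u hu b => ?_
  have : ∃ b' : Bool, ∃ f, ContinuousOn f D ∧
      ∀ x ∈ D, f x ∈ D ∩ cn u ∧ (x ∈ X ↔ (f x ∈ X ↔ b' = false)) := by
    obtain ⟨p, hp, hpu⟩ := hu
    have hpt := hD.sub hp
    rcases le_total u.length t.length with hl | hl
    · have hsub : cn t ⊆ cn u := cn_sub hpu hpt hl
      exact ⟨false, id, continuousOn_id, fun x hx => ⟨⟨hx, hsub (hD.sub hx)⟩, by simp⟩⟩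
    · have hsub : cn u ⊆ cn t := cn_sub hpt hpu hl
      rcases hmin (D ∩ cn u) ⟨u, hsub.trans hts, hD.cone hsub⟩ with ⟨f, hf, h⟩ | ⟨f, hf, h⟩
      · exact ⟨false, f, hf, fun x hx => ⟨(h x hx).1, by simpa using (h x hx).2⟩⟩
      · refine ⟨true, f, hf, fun x hx => ⟨(h x hx).1, ?_⟩⟩
        have := (h x hx).2
        rw [mem_compl_iff] at this
        simp; tauto
  obtain ⟨b', h, hc, hh⟩ := this
  by_cases hbb : b = b'
  · subst hbb; exact ⟨h, hc, hh⟩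
  · refine ⟨h ∘ f, hc.comp hf fun x hx => (hfx x hx).1, fun x hx => ⟨(hh _ (hfx x hx).1).1, ?_⟩⟩
    have h1 := (hfx x hx).2
    have h2 := (hh _ (hfx x hx).1).2
    simp only [Function.comp]
    rw [h1, h2]
    revert hbb
    cases b <;> cases b' <;> simp

end BD


namespace BD

/-- mapping X-membership into a cone, on a Gδ set containing X -/
lemma loc_map {X : Set Cantor} (hX : Hom X) (hd : ∀ c, (X ∩ cn c).Nonempty) (t : List Bool) :
    ∃ (D : Set Cantor) (k : Cantor → Cantor), IsGδ D ∧ X ⊆ D ∧ ContinuousOn k D ∧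
      ∀ x ∈ D, k x ∈ cn t ∧ (x ∈ X ↔ k x ∈ X) := by
  classical
  let Good : List Bool → Prop := fun c => ∃ (D : Set Cantor) (k : Cantor → Cantor),
    IsGδ D ∧ X ⊆ D ∧ ContinuousOn k D ∧
      ∀ x ∈ D, (x ∈ X ↔ k x ∈ X) ∧ (x ∈ cn c → k x ∈ cn t)
  have hg : ∀ x ∈ X, ∃ n, Good (PiNat.res x n) := by
    intro x hx
    obtain ⟨y, hy, hyt⟩ := hd t
    obtain ⟨f, g, hfg, hfx⟩ := hX x hx y hy
    obtain ⟨D, k, hD, hXD, hk, hkf, hkX⟩ := lav hfg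
    obtain ⟨n, hn⟩ := co_iff.1 hk x (hXD hx) t.length
    refine ⟨n, D ∩ (cn (PiNat.res x n) ∪ X ∪ (cn (PiNat.res x n))ᶜ), k, ?_, ?_, ?_, ?_⟩
    · have : (cn (PiNat.res x n) ∪ X ∪ (cn (PiNat.res x n))ᶜ) = univ := by
        ext z; simp only [mem_union, mem_compl_iff, mem_univ, iff_true]; tauto
      rwa [this, inter_univ]
    · exact fun z hz => ⟨hXD hz, Or.inl (Or.inr hz)⟩
    · exact hk.mono inter_subset_left
    · intro z hz
      refine ⟨hkX z hz.1, fun hzc => ?_⟩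
      have := hn z hz.1 (mem_cyl.1 hzc)
      rw [hkf x hx, hfx] at this
      rw [cn_cyl hyt]
      exact mem_cyl.2 this
  choose! Dc kc hDc hXDc hkc hkcx using fun c (h : Good c) => h
  let E : Set Cantor := {x | ∃ n, Good (PiNat.res x n)}
  have hE : IsOpen E := by
    refine isOpen_pre fun x hx => ?_
    obtain ⟨n, hn⟩ := hx
    exact ⟨n, fun z hz => ⟨n, by rw [hz.res]; exact hn⟩⟩
  let nn : Cantor → ℕ := fun x => if h : ∃ n, Good (PiNat.res x n) then Nat.find h else 0
  have hnn : ∀ x ∈ E, Good (PiNat.res x (nn x)) := by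
    intro x hx
    have hx' : ∃ n, Good (PiNat.res x n) := hx
    simp only [nn, dif_pos hx']
    exact Nat.find_spec hx'
  have hnn' : ∀ x ∈ E, ∀ z, EqU (nn x) z x → z ∈ E ∧ nn z = nn x := by
    intro x hx z hz
    have hx' : ∃ n, Good (PiNat.res x n) := hx
    have hz' : ∃ n, Good (PiNat.res z n) := ⟨nn x, by rw [hz.res]; exact hnn x hx⟩
    refine ⟨hz', ?_⟩
    simp only [nn, dif_pos hx', dif_pos hz'] at hz ⊢
    rw [Nat.find_eq_iff]
    refine ⟨by rw [hz.res]; exact Nat.find_spec hx', fun m hm => ?_⟩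
    rw [(hz.mono hm.le).res]
    exact Nat.find_min hx' hm
  let D : Set Cantor := E ∩ ⋂ c : List Bool, (if Good c then Dc c ∪ (cn c)ᶜ else univ)
  have hDE : ∀ x ∈ D, x ∈ Dc (PiNat.res x (nn x)) := by
    intro x hx
    have h1 := mem_iInter.1 hx.2 (PiNat.res x (nn x))
    rw [if_pos (hnn x hx.1)] at h1
    rcases h1 with h1 | h1
    · exact h1
    · exact absurd (self_cyl x _) h1
  refine ⟨D, fun x => kc (PiNat.res x (nn x)) x, ?_, ?_, ?_, ?_⟩
  · refine hE.isGδ.inter (IsGδ.iInter fun c => ?_)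
    split_ifs with h
    · exact (hDc c h).union (cn_closed c).isOpen_compl.isGδ
    · exact isOpen_univ.isGδ
  · intro x hx
    refine ⟨hg x hx, mem_iInter.2 fun c => ?_⟩
    split_ifs with h
    · exact Or.inl (hXDc c h hx)
    · trivial
  · rw [co_iff]
    intro x hx k
    obtain ⟨n, hn⟩ := co_iff.1 (hkc _ (hnn x hx.1)) x (hDE x hx) k
    refine ⟨max n (nn x), fun z hz hzx => ?_⟩
    have h1 := (hnn' x hx.1 z (hzx.mono (le_max_right _ _))).2
    have h2 := hDE z hz
    have h3 : PiNat.res z (nn x) = PiNat.res x (nn x) := (hzx.mono (le_max_right _ _)).res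
    simp only [h1, h3] at h2 ⊢
    exact hn z h2 (hzx.mono (le_max_left _ _))
  · intro x hx
    have := hkcx _ (hnn x hx.1) x (hDE x hx)
    exact ⟨this.2 (self_cyl x _), this.1⟩

def Sym : Type := Option Bool × Bool

instance : Fintype Sym := inferInstanceAs (Fintype (Option Bool × Bool))
instance : Nonempty Sym := ⟨((none, true) : Option Bool × Bool)⟩
instance : TopologicalSpace Sym := ⊥
instance : DiscreteTopology Sym := ⟨rfl⟩
instance : TopologicalSpace (Option Bool) := ⊥
instance : DiscreteTopology (Option Bool) := ⟨rfl⟩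

def dg (z : ℕ → Sym) : ℕ → Option Bool := fun n => (z n).1

/-- sequences with blanks and default answers -/
def Bs (B : Set Cantor) : Set (ℕ → Sym) :=
  {z | (InfD (dg z) ∧ dep (dg z) ∈ B) ∨ (¬ InfD (dg z) ∧ ∃ n, ∀ m ≥ n, (z m).2 = true)}

lemma dg_cont : Continuous dg := by
  rw [cont_iff]
  exact fun x k => ⟨k, fun z hz i hi => by unfold dg; rw [hz i hi]⟩

lemma dd_cont : ContinuousOn (fun z => dep (dg z)) {z | InfD (dg z)} :=
  dep_cont.comp dg_cont.continuousOn fun _ h => h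

lemma infdg : IsGδ {z : ℕ → Sym | InfD (dg z)} := infD_gd.preimage dg_cont

lemma bs_bor {B : Set Cantor} (hB : Bor B) : Bor (Bs B) := by
  have h1 := bor_pre dd_cont (bor_gd infdg) hB
  have h2 : Bor {z : ℕ → Sym | ∃ n, ∀ m ≥ n, (z m).2 = true} := by
    have : {z : ℕ → Sym | ∃ n, ∀ m ≥ n, (z m).2 = true} =
        (⋂ n : ℕ, {z : ℕ → Sym | ∃ m ≥ n, (z m).2 ≠ true})ᶜ := by
      ext z; simp
    rw [this]
    refine bor_compl (bor_gd (IsGδ.iInter_of_isOpen fun n => isOpen_pre ?_))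
    rintro z ⟨m, h1, h2⟩
    exact ⟨m + 1, fun w hw => ⟨m, h1, by rw [hw m (by omega)]; exact h2⟩⟩
  have := bor_union h1 (bor_inter (bor_compl (bor_gd infdg)) h2)
  exact this

/-- the universal reduction -/
lemma red {X : Set Cantor} (hB : Bor X) (hX : Hom X) (hd : ∀ c, (X ∩ cn c).Nonempty)
    (hH : ∀ j c, ¬ Ga j (X ∩ cn c)) {R : Set Cantor} (hR : IsGδ R) {g : Cantor → Cantor}
    (hg : ContinuousOn g R) (ε : Prop) (s : List Bool) :
    ∃ f : (ℕ → Sym) → Cantor, Continuous f ∧ ∀ z, f z ∈ cn s ∧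
      (z ∈ Bs {x | (x ∈ R ∧ g x ∈ X) ∨ (x ∉ R ∧ ε)} ↔ f z ∈ X) := by
  have hBB : Bor {x | (x ∈ R ∧ g x ∈ X) ∨ (x ∉ R ∧ ε)} := by
    have h1 := bor_pre hg (bor_gd hR) hB
    by_cases hε : ε
    · have h2 := bor_union h1 (bor_compl (bor_gd hR))
      convert h2 using 1
      ext x; simp [hε]
    · convert h1 using 1
      ext x; simp [hε]
  rcases wadge (D := univ) (bor_open isOpen_univ) (bs_bor hBB) (bor_open (cn_open s)) hB with
    ⟨f, hf, h⟩ | ⟨σ, hσ⟩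
  · exact ⟨f, continuousOn_univ.1 hf, fun z => h z trivial⟩
  exfalso
  set ρ : Cantor → (ℕ → Sym) := fun y n => σ (PiNat.res y n) with hρ
  have hρc : Continuous ρ := strat_cont σ
  replace hσ : ∀ y ∈ cn s, (ρ y ∈ Bs {x | (x ∈ R ∧ g x ∈ X) ∨ (x ∉ R ∧ ε)} ↔ y ∉ X) :=
    fun y => (hσ y).2
  refine lo_flip hB hH s fun t hts => ?_
  obtain ⟨D, k, hD, hXD, hk, hkx⟩ := loc_map hX hd t
  let H1 : Set Cantor := {y | ∃ n, ∀ m ≥ n, (ρ y m).1 = none ∧ (ρ y m).2 = true}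
  have f1 : Fs H1 := by
    refine ⟨fun n => {y | ∀ m ≥ n, (ρ y m).1 = none ∧ (ρ y m).2 = true}, fun n => ⟨?_⟩,
      fun p => Iff.rfl⟩
    refine isOpen_pre fun x hx => ?_
    simp only [mem_compl_iff, mem_ofPred_eq, not_forall] at hx
    obtain ⟨m, hm, h⟩ := hx
    obtain ⟨N, hN⟩ := cont_iff.1 hρc x (m+1)
    refine ⟨N, fun z hz hcon => h ?_⟩
    rw [← hN z hz m (by omega)]
    exact hcon m hm
  let G : Set Cantor := {y | InfD (dg (ρ y))}
  have hG : IsGδ G := infdg.preimage hρc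
  let gg : Cantor → Cantor := fun y => dep (dg (ρ y))
  have hgg : ContinuousOn gg G := dd_cont.comp hρc.continuousOn fun _ h => h
  obtain ⟨H3, f3, h3⟩ := fs_pre hgg (gd_fs hR)
  have hgi : ∀ y ∈ (G \ H3), gg y ∈ R := by
    intro y hy
    have := mt (h3 y hy.1).2 hy.2
    rwa [mem_compl_iff, not_not] at this
  have hg0 : ContinuousOn (fun y => g (gg y)) (G \ H3) :=
    hg.comp (hgg.mono sdiff_subset) hgi
  obtain ⟨H4, f4, h4⟩ := fs_pre hg0 (gd_fs hD)
  have hBsG : ∀ y ∈ G, (ρ y ∈ Bs {x | (x ∈ R ∧ g x ∈ X) ∨ (x ∉ R ∧ ε)} ↔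
      ((gg y ∈ R ∧ g (gg y) ∈ X) ∨ (gg y ∉ R ∧ ε))) := by
    intro y hy
    have hy' : InfD (dg (ρ y)) := hy
    show (_ ∧ _) ∨ (_ ∧ _) ↔ _
    simp only [hy', true_and, not_true, false_and, or_false]; rfl
  have l1 : Lo X t (cn t \ H1) := by
    refine Lo.step _ H1 False Lo.base f1 fun y hy hyH => ?_
    have h5 := hσ y (hts hy)
    rw [iff_false, ← h5]
    obtain ⟨n, hn⟩ := hyH
    refine Or.inr ⟨fun hi => ?_, n, fun m hm => (hn m hm).2⟩
    obtain ⟨m, h1, h2⟩ := (infD_iff _).1 hi n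
    have h6 := (hn m h1).1
    unfold dg at h2
    rw [h6] at h2; simp at h2
  have l2 : Lo X t ((cn t \ H1) \ Gᶜ) := by
    refine Lo.step _ Gᶜ True l1 (gd_fs hG) fun y hy hyH => ?_
    have h5 := hσ y (hts hy.1)
    rw [iff_true]
    by_contra hcon
    rcases h5.2 hcon with h6 | ⟨h6, n, hn⟩
    · exact hyH h6.1
    · apply hy.2
      rw [infD_iff] at h6
      push Not at h6
      obtain ⟨n', hn'⟩ := h6
      refine ⟨max n n', fun m hm => ⟨?_, hn m (le_trans (le_max_left _ _) hm)⟩⟩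
      have := hn' m (le_trans (le_max_right _ _) hm)
      simpa [dg] using this
  have l3 : Lo X t (((cn t \ H1) \ Gᶜ) \ H3) := by
    refine Lo.step _ H3 (¬ ε) l2 f3 fun y hy hyH => ?_
    have hyG : y ∈ G := not_not.1 hy.2
    have h5 := hσ y (hts hy.1.1)
    rw [hBsG y hyG] at h5
    have h6 : gg y ∉ R := (h3 y hyG).1 hyH
    tauto
  have l4 : Lo X t ((((cn t \ H1) \ Gᶜ) \ H3) \ H4) := by
    refine Lo.step _ H4 True l3 f4 fun y hy hyH => ?_
    have hyG : y ∈ G := not_not.1 hy.1.2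
    have h5 := hσ y (hts hy.1.1.1)
    rw [hBsG y hyG] at h5
    have h6 := (h4 y ⟨hyG, hy.2⟩).1 hyH
    have h7 : g (gg y) ∉ X := fun h => h6 (hXD h)
    have h8 := hgi y ⟨hyG, hy.2⟩
    tauto
  have hsub : ∀ y ∈ (((cn t \ H1) \ Gᶜ) \ H3) \ H4, y ∈ G \ H3 ∧ g (gg y) ∈ D := by
    intro y hy
    have hyG : y ∈ G := not_not.1 hy.1.1.2
    have h6 := mt (h4 y ⟨hyG, hy.1.2⟩).2 hy.2
    exact ⟨⟨hyG, hy.1.2⟩, not_not.1 h6⟩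
  refine ⟨_, fun y => k (g (gg y)), l4, ?_, ?_⟩
  · exact hk.comp (hg0.mono fun y hy => (hsub y hy).1) fun y hy => (hsub y hy).2
  · intro y hy
    obtain ⟨h5, h6⟩ := hsub y hy
    have h7 := hkx _ h6
    refine ⟨h7.1, ?_⟩
    have h8 := hσ y (hts hy.1.1.1.1)
    rw [hBsG y h5.1] at h8
    have h9 := hgi y h5
    tauto

end BD


namespace BD

def bl (b : Bool) : Sym := ((none, b) : Option Bool × Bool)

lemma bl_mem {B : Set Cantor} {z : ℕ → Sym} {m : ℕ} {b : Bool} (h : ∀ i ≥ m, z i = bl b) :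
    z ∈ Bs B ↔ b = true := by
  have hn : ¬ InfD (dg z) := by
    rw [infD_iff]; push Not
    refine ⟨m, fun i hi => ?_⟩
    simp [dg, h i hi, bl]
  show (_ ∧ _) ∨ (_ ∧ _) ↔ _
  simp only [hn, false_and, false_or, not_false_eq_true, true_and]
  constructor
  · rintro ⟨n, hn⟩
    have := hn (max n m) (le_max_left _ _)
    rw [h _ (le_max_right _ _)] at this
    exact this
  · intro hb
    exact ⟨m, fun i hi => by rw [h i hi]; exact hb⟩

lemma sep {B X : Set Cantor} {f : (ℕ → Sym) → Cantor} (hf : Continuous f)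
    (hfX : ∀ z, (z ∈ Bs B ↔ f z ∈ X)) (m : ℕ) :
    ∃ M, ∀ z z', EqU m z z' → (∀ i, m ≤ i → i < M → z i = bl true) →
      (∀ i, m ≤ i → i < M → z' i = bl false) → f z ≠ f z' := by
  classical
  let P : Bool → (Fin m → Sym) → ℕ → Sym := fun b t n => if h : n < m then t ⟨n, h⟩ else bl b
  have h1 : ∀ t : Fin m → Sym, ∃ M, ∀ z z', EqU M z (P true t) → EqU M z' (P false t) →
      f z ≠ f z' := by
    intro t
    have hne : f (P true t) ≠ f (P false t) := by
      intro h
      have a1 := bl_mem (B := B) (z := P true t) (m := m) (b := true)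
        (fun i hi => by simp [P, not_lt.2 hi])
      have a2 := bl_mem (B := B) (z := P false t) (m := m) (b := false)
        (fun i hi => by simp [P, not_lt.2 hi])
      rw [hfX] at a1 a2
      rw [h, a2] at a1
      simp at a1
    obtain ⟨k, -, hk⟩ := first_diff hne
    obtain ⟨n1, hn1⟩ := cont_iff.1 hf (P true t) (k+1)
    obtain ⟨n2, hn2⟩ := cont_iff.1 hf (P false t) (k+1)
    refine ⟨max n1 n2, fun z z' hz hz' hcon => hk ?_⟩
    rw [← hn1 z (hz.mono (le_max_left _ _)) k (by omega),
      ← hn2 z' (hz'.mono (le_max_right _ _)) k (by omega), hcon]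
  choose N hN using h1
  refine ⟨Finset.univ.sup N, fun z z' hzz h2 h3 => ?_⟩
  have hle : N (fun i => z i) ≤ Finset.univ.sup N := Finset.le_sup (f := N) (Finset.mem_univ _)
  refine hN (fun i => z i) z z' (fun i hi => ?_) (fun i hi => ?_)
  · by_cases him : i < m
    · simp [P, him]
    · simp only [P, him, dite_false]
      exact h2 i (not_lt.1 him) (by omega)
  · by_cases him : i < m
    · simp only [P, him, dite_true]; exact (hzz i him).symm
    · simp only [P, him, dite_false]
      exact h3 i (not_lt.1 him) (by omega)

def stt (M : ℕ → ℕ) : ℕ → ℕ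
  | 0 => 0
  | k + 1 => max (M (stt M k)) (stt M k) + 1

def JJ (M : ℕ → ℕ) (k : ℕ) : ℕ := max (M (stt M k)) (stt M k)

lemma stt_succ (M : ℕ → ℕ) (k : ℕ) : stt M (k+1) = JJ M k + 1 := rfl

lemma stt_le (M : ℕ → ℕ) (k : ℕ) : stt M k ≤ JJ M k := le_max_right _ _

lemma JJ_mono (M : ℕ → ℕ) : StrictMono (JJ M) := strictMono_nat_of_lt_succ fun k => by
  have := stt_le M (k+1)
  rw [stt_succ] at this
  omega

open Classical in
noncomputable def ix (M : ℕ → ℕ) (n : ℕ) : ℕ := Nat.count (fun m => m ∈ range (JJ M)) n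

lemma ix_J (M : ℕ → ℕ) (k : ℕ) : ix M (JJ M k) = k := by
  classical
  have h1 := Nat.nth_comp_of_strictMono (p := fun m => m ∈ range (JJ M)) (n := k) (JJ_mono M)
    (fun _ h => h) (fun hfin => by
      exfalso
      exact infinite_range_of_injective (JJ_mono M).injective hfin)
  have h2 : Nat.nth (fun i => JJ M i ∈ range (JJ M)) k = k := by
    have : (fun i => JJ M i ∈ range (JJ M)) = fun _ => True := by
      funext i; simp
    rw [this]; exact Nat.nth_true k
  rw [h2] at h1
  unfold ix
  conv_lhs => rw [h1]
  convert Nat.count_nth_of_infinite (p := fun m => m ∈ range (JJ M))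
    (infinite_range_of_injective (JJ_mono M).injective) k

lemma ix_mono (M : ℕ → ℕ) : Monotone (ix M) := by
  classical
  intro a b h
  unfold ix
  exact Nat.count_monotone _ h

lemma ix_stt (M : ℕ → ℕ) (k : ℕ) : ix M (stt M k) = k := by
  classical
  cases k with
  | zero => simp [ix, stt]
  | succ k =>
    have h := ix_J M k
    rw [stt_succ]
    unfold ix at *
    rw [Nat.count_succ, if_pos ⟨k, rfl⟩, h]

lemma ix_mid {M : ℕ → ℕ} {k n : ℕ} (h : stt M k ≤ n) (h' : n ≤ JJ M k) : ix M n = k :=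
  le_antisymm ((ix_mono M h').trans (ix_J M k).le) ((ix_stt M k).ge.trans (ix_mono M h))

lemma ix_lt {M : ℕ → ℕ} {k n : ℕ} (h : n < stt M k) : ix M n < k := by
  cases k with
  | zero => simp [stt] at h
  | succ k =>
    rw [stt_succ] at h
    have := (ix_mono M (show n ≤ JJ M k by omega)).trans (ix_J M k).le
    omega

open Classical in
noncomputable def pd (M : ℕ → ℕ) (x : Cantor) : ℕ → Sym := fun n =>
  ((if n ∈ range (JJ M) then some (x (ix M n)) else none, x (ix M n)) : Option Bool × Bool)

lemma pd_inf (M : ℕ → ℕ) (x : Cantor) : InfD (dg (pd M x)) := by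
  classical
  refine Set.Infinite.mono ?_ (infinite_range_of_injective (JJ_mono M).injective)
  intro n hn
  show (dg (pd M x) n).isSome = true
  simp only [dg, pd, if_pos hn, Option.isSome_some]

lemma pd_dep (M : ℕ → ℕ) (x : Cantor) : dep (dg (pd M x)) = x := by
  classical
  funext k
  have h1 : dg (pd M x) (JJ M k) = some (x k) := by
    simp [dg, pd, ix_J]
  have h2 := dep_at h1
  have h3 : (fun n => (dg (pd M x) n).isSome = true) = fun m => m ∈ range (JJ M) := by
    funext n
    by_cases hn : n ∈ range (JJ M)
    · simp only [dg, pd, hn, if_true, Option.isSome_some]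
    · simp only [dg, pd, if_neg hn, hn, Option.isSome_none]; simp
  have h4 : Nat.count (fun n => (dg (pd M x) n).isSome = true) (JJ M k) = k := by
    have := ix_J M k
    unfold ix at this
    convert this
  rwa [h4] at h2

lemma pd_loc {M : ℕ → ℕ} {x y : Cantor} {n : ℕ} (h : EqU n x y) : EqU (stt M n) (pd M x) (pd M y) := by
  intro i hi
  unfold pd
  rw [h _ (ix_lt hi)]

lemma pd_bl {M : ℕ → ℕ} {x : Cantor} {n i : ℕ} (h : stt M n ≤ i) (h' : i < JJ M n) :
    pd M x i = bl (x n) := by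
  have h1 := ix_mid h h'.le
  have h2 : i ∉ range (JJ M) := by
    rintro ⟨j, rfl⟩
    rw [ix_J] at h1
    subst h1
    exact lt_irrefl _ h'
  unfold pd bl
  rw [if_neg h2, h1]

lemma le_stt (M : ℕ → ℕ) (n : ℕ) : n ≤ stt M n := by
  induction n with
  | zero => simp
  | succ n ih => rw [stt_succ]; have := stt_le M n; omega

/-- the injective reduction -/
lemma inj_red {X : Set Cantor} (hB : Bor X) (hX : Hom X) (hd : ∀ c, (X ∩ cn c).Nonempty)
    (hH : ∀ j c, ¬ Ga j (X ∩ cn c)) {R : Set Cantor} (hR : IsGδ R) {g : Cantor → Cantor}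
    (hg : ContinuousOn g R) (ε : Prop) (s : List Bool) :
    ∃ e : Cantor → Cantor, Continuous e ∧ Function.Injective e ∧ ∀ x, e x ∈ cn s ∧
      (e x ∈ X ↔ (x ∈ R ∧ g x ∈ X) ∨ (x ∉ R ∧ ε)) := by
  obtain ⟨f, hf, hfx⟩ := red hB hX hd hH hR hg ε s
  choose M hM using sep hf fun z => (hfx z).2
  refine ⟨fun x => f (pd M x), ?_, ?_, fun x => ⟨(hfx _).1, ?_⟩⟩
  · refine hf.comp (cont_iff.2 fun x k => ⟨k, fun z hz => (pd_loc hz).mono (le_stt M k)⟩)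
  · intro x y hxy
    by_contra hne
    obtain ⟨n, h1, h2⟩ := first_diff hne
    have key : ∀ x y : Cantor, EqU n x y → x n = true → y n = false → f (pd M x) ≠ f (pd M y) := by
      intro x y h1 hx hy
      have hle : M (stt M n) ≤ JJ M n := le_max_left _ _
      refine hM (stt M n) _ _ (pd_loc h1) (fun i a b => ?_) (fun i a b => ?_)
      · rw [pd_bl a (by omega), hx]
      · rw [pd_bl a (by omega), hy]
    cases hx : x n
    · refine key y x h1.symm ?_ hx hxy.symm
      rw [hx] at h2
      simpa using h2.symm
    · refine key x y h1 hx ?_ hxy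
      rw [hx] at h2
      simpa using h2.symm
  · rw [← (hfx _).2]
    show (_ ∧ _) ∨ (_ ∧ _) ↔ _
    have := pd_inf M x
    simp only [this, true_and, not_true, false_and, or_false, pd_dep]
    rfl

/-- nowhere density of small sets -/
lemma nwd_sm {Y A K : Set Cantor} (hY : ∀ c, (Y ∩ cn c).Nonempty) (hK : IsClosed K)
    (hn : ∀ d, ¬ cn d ⊆ K) (hA : A ⊆ K) : Nwd Y A := by
  intro a _ m
  obtain ⟨p, hp, hpK⟩ := not_subset.1 (hn (PiNat.res a m))
  obtain ⟨k, hk⟩ := open_cyl hK.isOpen_compl hpK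
  obtain ⟨q, hq, hqc⟩ := hY (PiNat.res p (max k m))
  have hqc' : EqU (max k m) q p := mem_cyl.1 hqc
  refine ⟨q, ⟨hq, mem_cyl.2 ?_⟩, fun hqA => hk (mem_cyl.2 (hqc'.mono (le_max_left _ _))) (hA hqA)⟩
  exact (hqc'.mono (le_max_right _ _)).trans (mem_cyl.1 hp)

lemma emb_mk {Y Z F : Set Cantor} (hY : ∀ c, (Y ∩ cn c).Nonempty) (hF : IsClosed F) (hZ : Z ⊆ F)
    (h : ∀ c, ∃ e : Cantor → Cantor, Continuous e ∧ Function.Injective e ∧ (∀ x ∈ F, e x ∈ cn c) ∧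
      (∀ x ∈ F, x ∈ Z ↔ e x ∈ Y) ∧ ∀ d, ¬ cn d ⊆ e '' F) : Emb Z Y := by
  intro c _
  obtain ⟨e, h1, h2, h3, h4, h5⟩ := h c
  have hs := inj_shw h1 h2 Z
  have hcl : IsClosed (e '' F) := (hF.isCompact.image h1).isClosed
  refine ⟨e, Function.invFun e, hs.cf, fun z hz => ⟨⟨(h4 z (hZ hz)).1 hz, h3 z (hZ hz)⟩,
    (hs.fx z hz).2⟩, hs.cg, ?_, nwd_sm hY hcl h5 (image_mono hZ)⟩
  rintro y ⟨hy, hyc⟩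
  obtain ⟨x, hx, rfl⟩ := closure_minimal (image_mono hZ) hcl hyc
  exact ⟨x, (h4 x hx).2 hy, rfl⟩

/-- injective images of nowhere dense sets -/
lemma nwd_img {e : Cantor → Cantor} (hc : Continuous e) (hi : Function.Injective e) {F : Set Cantor}
    (hn : ∀ d, ¬ cn d ⊆ F) (d : List Bool) : ¬ cn d ⊆ e '' F := by
  intro h
  obtain ⟨p, hp⟩ := cn_ne d
  obtain ⟨x, hx, rfl⟩ := h hp
  obtain ⟨m, hm⟩ := open_cyl ((cn_open d).preimage hc) hp
  refine hn (PiNat.res x m) fun z hz => ?_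
  obtain ⟨w, hw, hwz⟩ := h (hm hz)
  rwa [← hi hwz]

end BD


namespace BD

lemma fm_ev {x y : Cantor} (h : {n | x n ≠ y n}.Finite) : ∃ k, ∀ i ≥ k, x i = y i := by
  obtain ⟨k, hk⟩ := h.bddAbove
  refine ⟨k + 1, fun i hi => ?_⟩
  by_contra hcon
  have : i ≤ k := hk hcon
  omega

open Classical in
/-- the branch of x, coded as a set of naturals -/
noncomputable def br (x : Cantor) : Cantor := fun i => decide (∃ n, Encodable.encode (PiNat.res x n) = i)

lemma br_iff {x : Cantor} {i : ℕ} : br x i = true ↔ ∃ n, Encodable.encode (PiNat.res x n) = i := by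
  simp [br]

lemma enc_eq {x y : Cantor} {n m : ℕ}
    (h : Encodable.encode (PiNat.res x n) = Encodable.encode (PiNat.res y m)) : n = m ∧ EqU n x y := by
  have h1 := Encodable.encode_injective h
  have h2 := congrArg List.length h1
  rw [PiNat.res_length, PiNat.res_length] at h2
  subst h2
  exact ⟨rfl, fun i hi => PiNat.res_eq_res.1 h1 hi⟩

lemma enc_inj (x : Cantor) : Function.Injective fun n => Encodable.encode (PiNat.res x n) :=
  fun _ _ h => (enc_eq h).1

/-- far codes along branches -/
lemma br_far (x : Cantor) (k m : ℕ) : ∃ n ≥ m, k ≤ Encodable.encode (PiNat.res x n) := by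
  obtain ⟨i, ⟨n, hn, rfl⟩, hi⟩ :=
    ((Set.Ici_infinite m).image (enc_inj x).injOn).exists_gt k
  exact ⟨n, hn, hi.le⟩

lemma br_cont : Continuous br := by
  rw [cont_iff]
  intro x k
  have h1 : ∀ i, ∃ n, ∀ z, EqU n z x → br z i = br x i := by
    intro i
    by_cases h : ∃ l : List Bool, Encodable.encode l = i
    · obtain ⟨l, rfl⟩ := h
      refine ⟨l.length, fun z hz => ?_⟩
      have key : ∀ w : Cantor, br w (Encodable.encode l) = true ↔ PiNat.res w l.length = l := by
        intro w
        rw [br_iff]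
        constructor
        · rintro ⟨n, hn⟩
          have := Encodable.encode_injective hn
          rw [← this, PiNat.res_length]
        · intro h; exact ⟨_, by rw [h]⟩
      rw [Bool.eq_iff_iff, key, key, hz.res]
    · refine ⟨0, fun z _ => ?_⟩
      have key : ∀ w : Cantor, ¬ br w i = true := by
        intro w hw
        obtain ⟨n, hn⟩ := br_iff.1 hw
        exact h ⟨_, hn⟩
      rw [Bool.eq_iff_iff]
      exact iff_of_false (key z) (key x)
  choose N hN using h1
  exact ⟨(Finset.range k).sup N, fun z hz i hi => hN i z
    (hz.mono (Finset.le_sup (f := N) (Finset.mem_range.2 hi)))⟩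

/-- almost inclusion from `k` on -/
def Sub (k : ℕ) (z w : Cantor) : Prop := ∀ i ≥ k, z i = true → w i = true

def InfT (z : Cantor) : Prop := ∀ n, ∃ m ≥ n, z m = true

lemma not_inft {z : Cantor} (h : ¬ InfT z) : ∃ n, ∀ m ≥ n, z m = false := by
  unfold InfT at h
  push Not at h
  simpa using h

lemma Sub.mono {k m : ℕ} {z w : Cantor} (h : Sub k z w) (hm : k ≤ m) : Sub m z w :=
  fun i hi => h i (hm.trans hi)

lemma br_near {z x : Cantor} {k : ℕ} (hz : InfT z) (h : Sub k z (br x)) (k' m : ℕ) :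
    ∃ N, ∀ z' y, Sub k' z' (br y) → EqU N z' z → EqU m y x := by
  obtain ⟨i, hi, hzi⟩ := hz (max (max k k') ((Finset.range m).sup
    (fun n => Encodable.encode (PiNat.res x n)) + 1))
  have hi1 := (le_max_left _ _).trans hi
  have h2 := (le_max_right (max k k') _).trans hi
  obtain ⟨n, hn⟩ := br_iff.1 (h i ((le_max_left _ _).trans hi1) hzi)
  have hnm : m ≤ n := by
    by_contra hcon
    have h1 : Encodable.encode (PiNat.res x n) ≤ _ :=
      Finset.le_sup (f := fun n => Encodable.encode (PiNat.res x n))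
        (Finset.mem_range.2 (not_le.1 hcon))
    omega
  refine ⟨i + 1, fun z' y h' hzz => ?_⟩
  obtain ⟨n', hn'⟩ := br_iff.1 (h' i ((le_max_right _ _).trans hi1) (by rw [hzz i (by omega), hzi]))
  have h3 := enc_eq (hn'.trans hn.symm)
  exact h3.2.mono (by omega)

lemma br_uniq {z x y : Cantor} {k k' : ℕ} (hz : InfT z) (h : Sub k z (br x)) (h' : Sub k' z (br y)) :
    y = x := by
  refine EqU.eq fun m => ?_
  obtain ⟨N, hN⟩ := br_near hz h k' m
  exact hN z y h' (EqU.refl _ _)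

lemma br_inf (x : Cantor) : InfT (br x) := by
  intro n
  obtain ⟨m, -, hm⟩ := br_far x n 0
  exact ⟨_, hm, br_iff.2 ⟨m, rfl⟩⟩

lemma InfT.congr {z w : Cantor} {n : ℕ} (hz : InfT z) (h : ∀ i ≥ n, z i = w i) : InfT w := by
  intro k
  obtain ⟨m, h1, h2⟩ := hz (max n k)
  exact ⟨m, (le_max_right _ _).trans h1, by rw [← h m ((le_max_left _ _).trans h1), h2]⟩

lemma one_sub {z : Cantor} {n : ℕ} (hz : ∀ i ≥ n, z i = true) (k : ℕ) (x : Cantor) :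
    ¬ Sub k z (br x) := by
  intro h
  have h1 : Sub (max n k) (br fun i => !x i) z := fun i hi _ => hz i ((le_max_left _ _).trans hi)
  have h2 : Sub (max n k) (br fun i => !x i) (br x) :=
    fun i hi hb => h i ((le_max_right _ _).trans hi) (h1 i hi hb)
  have h3 := br_uniq (br_inf _) (fun i _ h => h : Sub 0 (br fun i => !x i) (br fun i => !x i)) h2
  have := congrFun h3 0
  simp at this

/-- the semiideal generated by the branches through A -/
def Id (A : Set Cantor) : Set Cantor := {z | InfT z → ∃ x ∈ A, ∃ k, Sub k z (br x)}

lemma id_zero (A : Set Cantor) {z : Cantor} (h : ¬ InfT z) : z ∈ Id A := fun h' => absurd h' h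

lemma id_one (A : Set Cantor) : (fun _ => true) ∉ Id A := by
  intro h
  obtain ⟨x, -, k, h⟩ := h (fun n => ⟨n, le_rfl, rfl⟩)
  exact one_sub (n := 0) (fun _ _ => rfl) k x h

lemma id_down {A : Set Cantor} {y x : Cantor} (hy : y ∈ Id A) (h : ∀ n, x n = true → y n = true) :
    x ∈ Id A := by
  intro hx
  obtain ⟨w, hw, k, hk⟩ := hy fun n => by
    obtain ⟨m, h1, h2⟩ := hx n; exact ⟨m, h1, h m h2⟩
  exact ⟨w, hw, k, fun i hi hxi => hk i hi (h i hxi)⟩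

lemma id_fm (A : Set Cantor) : ClosedUnderFinMod (Id A) := by
  intro x hx y hxy hy
  obtain ⟨k, hk⟩ := fm_ev hxy
  obtain ⟨w, hw, m, hm⟩ := hx (hy.congr fun i hi => (hk i hi).symm)
  exact ⟨w, hw, max m k, fun i hi h => hm i ((le_max_left _ _).trans hi)
    (by rw [hk i ((le_max_right _ _).trans hi)]; exact h)⟩

lemma id_compl (A : Set Cantor) : IsSemifilter (Id A)ᶜ := by
  refine ⟨fun h => h (id_zero A fun h => ?_), id_one A, fun x hx y h hy => hx (id_down hy h),
    fun x hx y h hy => hx (id_fm A y hy x (fm_symm h))⟩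
  obtain ⟨m, -, h⟩ := h 0
  simp at h

def ng (x : Cantor) : Cantor := fun i => !x i

lemma ng_ng (x : Cantor) : ng (ng x) = x := by funext i; simp [ng]

lemma ng_cont : Continuous ng := by
  rw [cont_iff]
  exact fun x k => ⟨k, fun z hz i hi => by unfold ng; rw [hz i hi]⟩

lemma id_ng (A : Set Cantor) : IsSemifilter (ng ⁻¹' Id A) := by
  refine ⟨id_one A, id_zero A fun h => ?_, fun x hx y h => ?_, fun x hx y h => ?_⟩
  · obtain ⟨m, -, h⟩ := h 0
    simp [ng] at h
  · refine id_down (show ng x ∈ Id A from hx) fun n hn => ?_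
    by_contra hcon
    simp only [ng, Bool.not_eq_true'] at hn hcon
    have := h n (by simpa using hcon)
    simp [this] at hn
  · refine id_fm A (ng x) hx (ng y) (h.subset fun n hn => ?_)
    intro hcon
    exact hn (by simp [ng, hcon])

lemma id_sh (A : Set Cantor) : SH (Id A) (ng ⁻¹' Id A) := by
  have : SHw ng ng (Id A) (ng ⁻¹' Id A) := ⟨ng_cont.continuousOn, ng_cont.continuousOn,
    fun x hx => ⟨by rw [mem_preimage, ng_ng]; exact hx, ng_ng x⟩, fun y hy => ⟨hy, ng_ng y⟩⟩
  exact this.sh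

/-- the closed pieces -/
def Hk (k : ℕ) : Set Cantor := {z | ∃ x, Sub k z (br x)}

lemma hk_closed (k : ℕ) : IsClosed (Hk k) := by
  have h1 : IsClosed {p : Cantor × Cantor | Sub k p.1 (br p.2)} := by
    have : {p : Cantor × Cantor | Sub k p.1 (br p.2)} =
        ⋂ i : ℕ, {p | k ≤ i → p.1 i = true → br p.2 i = true} := by
      ext p; simp only [mem_iInter]; rfl
    rw [this]
    refine isClosed_iInter fun i => ?_
    have c1 : Continuous fun p : Cantor × Cantor => (p.1 i, br p.2 i) :=
      ((continuous_apply i).comp continuous_fst).prodMk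
        ((continuous_apply i).comp (br_cont.comp continuous_snd))
    exact (isClosed_discrete {q : Bool × Bool | k ≤ i → q.1 = true → q.2 = true}).preimage c1
  have h2 := isClosedMap_fst_of_compactSpace _ h1
  convert h2 using 1
  ext z
  constructor
  · rintro ⟨x, hx⟩; exact ⟨(z, x), hx, rfl⟩
  · rintro ⟨⟨z, x⟩, hx, rfl⟩; exact ⟨x, hx⟩

lemma hk_nwd (k : ℕ) (d : List Bool) : ¬ cn d ⊆ Hk k := by
  intro h
  obtain ⟨p, hp⟩ := cn_ne d
  have : spl p d.length (fun _ => true) ∈ cn d := by rw [cn_cyl hp]; exact spl_cyl _ _ _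
  obtain ⟨x, hx⟩ := h this
  exact one_sub (n := d.length) (fun i hi => by simp [spl, not_lt.2 hi]) k x hx

lemma id_hk {A : Set Cantor} {z : Cantor} (h : z ∈ Id A) : ∃ k, z ∈ Hk k := by
  by_cases hz : InfT z
  · obtain ⟨x, -, k, hk⟩ := h hz
    exact ⟨k, x, hk⟩
  · obtain ⟨n, hn⟩ := not_inft hz
    refine ⟨n, fun _ => true, fun i hi h => ?_⟩
    rw [hn i hi] at h; simp at h

lemma hk_struct (k : ℕ) : ∃ (R : Set Cantor) (g : Cantor → Cantor), IsGδ R ∧ ContinuousOn g R ∧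
    ∀ (A : Set Cantor), ∀ z ∈ Hk k, (z ∈ Id A ↔ (z ∈ R ∧ g z ∈ A) ∨ z ∉ R) := by
  let R : Set Cantor := Hk k ∩ {z | InfT z}
  choose! g hg using fun (z : Cantor) (h : z ∈ Hk k) => h
  refine ⟨R, g, ?_, ?_, ?_⟩
  · refine (hk_closed k).isGδ.inter ?_
    have : {z : Cantor | InfT z} = ⋂ n : ℕ, {z | ∃ m ≥ n, z m = true} := by
      ext z; simp only [mem_iInter]; rfl
    rw [this]
    refine IsGδ.iInter_of_isOpen fun n => isOpen_pre ?_
    rintro z ⟨m, h1, h2⟩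
    exact ⟨m + 1, fun w hw => ⟨m, h1, by rw [hw m (by omega)]; exact h2⟩⟩
  · rw [co_iff]
    intro z hz m
    obtain ⟨N, hN⟩ := br_near hz.2 (hg z hz.1) k m
    exact ⟨N, fun z' hz' h => hN z' _ (hg z' hz'.1) h⟩
  · intro A z hz
    constructor
    · intro h
      by_cases hR : z ∈ R
      · left
        obtain ⟨x, hx, m, hm⟩ := h hR.2
        rw [← br_uniq hR.2 (hg z hz) hm]
        exact ⟨hR, hx⟩
      · exact Or.inr hR
    · rintro (⟨h1, h2⟩ | h) hi
      · exact ⟨_, h2, k, hg z hz⟩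
      · exact absurd ⟨hz, hi⟩ h

/-- embedding any set into its branch ideal -/
lemma br_emb (A : Set Cantor) (c : List Bool) : ∃ e : Cantor → Cantor, Continuous e ∧
    Function.Injective e ∧ (∀ x, e x ∈ cn c) ∧ (∀ x, x ∈ A ↔ e x ∈ Id A) ∧
    ∀ F d, ¬ cn d ⊆ e '' F := by
  obtain ⟨p, hp⟩ := cn_ne c
  let e : Cantor → Cantor := fun x => spl p c.length (br x)
  have he : ∀ x, ∀ i ≥ c.length, br x i = e x i := fun x i hi => by simp [e, spl, not_lt.2 hi]
  have hei : ∀ x, InfT (e x) := fun x => (br_inf x).congr (he x)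
  have hes : ∀ x, Sub c.length (e x) (br x) := fun x i hi h => by rw [he x i hi]; exact h
  refine ⟨e, ?_, ?_, ?_, ?_, ?_⟩
  · rw [cont_iff]
    intro x k
    obtain ⟨n, hn⟩ := cont_iff.1 br_cont x k
    refine ⟨n, fun z hz i hi => ?_⟩
    simp only [e, spl]
    rw [hn z hz i hi]
  · intro x y hxy
    have h1 := hes y
    rw [← hxy] at h1
    exact (br_uniq (hei x) (hes x) h1).symm
  · intro x
    rw [cn_cyl hp]; exact spl_cyl _ _ _
  · intro x
    constructor
    · exact fun hx _ => ⟨x, hx, _, hes x⟩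
    · intro h
      obtain ⟨y, hy, k, hk⟩ := h (hei x)
      rwa [← br_uniq (hei x) (hes x) hk]
  · intro F d h
    obtain ⟨q, hq⟩ := cn_ne d
    have : spl q d.length (fun _ => false) ∈ cn d := by rw [cn_cyl hq]; exact spl_cyl _ _ _
    obtain ⟨x, -, hx⟩ := h this
    obtain ⟨m, h1, h2⟩ := hei x d.length
    rw [hx] at h2
    simp [spl, not_lt.2 h1] at h2

theorem high {X : Set Cantor} (hB : Bor X) (hX : Hom X) (hc : NowC X)
    (hd : ∀ c, (X ∩ cn c).Nonempty) (hH : ∀ j c, ¬ Ga j (X ∩ cn c)) :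
    ∃ S, IsSemifilter S ∧ SH X S := by
  have hne : X.Nonempty := (hd []).mono inter_subset_left
  rcases cat hB hX hd with ⟨F, f1, f2, f3⟩ | ⟨F, f1, f2, f3⟩
  · refine ⟨_, id_ng X, SH.trans ?_ (id_sh X)⟩
    have hId : ∀ c, (Id X ∩ cn c).Nonempty := by
      intro c
      obtain ⟨q, hq⟩ := cn_ne c
      refine ⟨spl q c.length (fun _ => false), id_zero X fun h => ?_, by
        rw [cn_cyl hq]; exact spl_cyl _ _ _⟩
      obtain ⟨m, h1, h2⟩ := h c.length
      simp [spl, not_lt.2 h1] at h2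
    refine bf hc (nowc_sh (id_sh X).symm (semi_nowc (id_ng X))) hne
      ((hId []).mono inter_subset_left) F Hk False f1 hk_closed ?_ ?_ ?_ ?_ ?_ ?_
    · intro p hp
      exact iff_of_false (fun h => by obtain ⟨k, hk⟩ := f3 p h; exact hp k hk) id
    · intro p hp
      exact iff_of_false (fun h => by obtain ⟨k, hk⟩ := id_hk h; exact hp k hk) id
    · exact fun k => nwd_sm hd (f1 k) (f2 k) inter_subset_right
    · exact fun k => nwd_sm hId (hk_closed k) (hk_nwd k) inter_subset_right
    · intro k
      refine emb_mk hId (f1 k) inter_subset_right fun c => ?_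
      obtain ⟨e, h1, h2, h3, h4, h5⟩ := br_emb X c
      exact ⟨e, h1, h2, fun x _ => h3 x, fun x hx => by
        rw [← h4 x, mem_inter_iff, and_iff_left hx], h5 _⟩
    · intro k
      refine emb_mk hd (hk_closed k) inter_subset_right fun c => ?_
      obtain ⟨R, g, hR, hg, hh⟩ := hk_struct k
      obtain ⟨e, h1, h2, h3⟩ := inj_red hB hX hd hH hR hg True c
      refine ⟨e, h1, h2, fun x _ => (h3 x).1, fun x hx => ?_, nwd_img h1 h2 (hk_nwd k)⟩
      rw [(h3 x).2, mem_inter_iff, and_iff_left hx, hh X x hx, and_true]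
  · refine ⟨_, id_compl Xᶜ, ?_⟩
    have hS := semi_dense (id_compl Xᶜ)
    refine bf hc (semi_nowc (id_compl Xᶜ)) hne
      ((hS []).mono inter_subset_left) F Hk True f1 hk_closed ?_ ?_ ?_ ?_ ?_ ?_
    · intro p hp
      refine iff_of_true (by_contra fun h => ?_) trivial
      obtain ⟨k, hk⟩ := f3 p h; exact hp k hk
    · intro p hp
      refine iff_of_true (fun h => ?_) trivial
      obtain ⟨k, hk⟩ := id_hk h; exact hp k hk
    · exact fun k => nwd_sm hd (f1 k) (f2 k) inter_subset_right
    · exact fun k => nwd_sm hS (hk_closed k) (hk_nwd k) inter_subset_right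
    · intro k
      refine emb_mk hS (f1 k) inter_subset_right fun c => ?_
      obtain ⟨e, h1, h2, h3, h4, h5⟩ := br_emb Xᶜ c
      exact ⟨e, h1, h2, fun x _ => h3 x, fun x hx => by
        rw [mem_compl_iff, ← h4 x, mem_inter_iff, and_iff_left hx, mem_compl_iff, not_not], h5 _⟩
    · intro k
      refine emb_mk hd (hk_closed k) inter_subset_right fun c => ?_
      obtain ⟨R, g, hR, hg, hh⟩ := hk_struct k
      obtain ⟨e, h1, h2, h3⟩ := inj_red hB hX hd hH hR hg False c
      refine ⟨e, h1, h2, fun x _ => (h3 x).1, fun x hx => ?_, nwd_img h1 h2 (hk_nwd k)⟩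
      rw [(h3 x).2, mem_inter_iff, and_iff_left hx, mem_compl_iff, hh Xᶜ x hx, mem_compl_iff]
      tauto

theorem hard {X : Set Cantor} (hB : Bor X) (hX : IsHomogeneous X) (hL : ¬ LocallyCompactSpace X) :
    ∃ S : Set Cantor, IsSemifilter S ∧ Nonempty (X ≃ₜ S) := by
  have hX' := (hom_iff X).1 hX
  have hne : X.Nonempty := by
    by_contra hcon
    rw [not_nonempty_iff_eq_empty] at hcon
    subst hcon
    exact hL ⟨fun x => x.2.elim⟩
  have hc := nowc_of_hom hX' hL
  obtain ⟨Y, hXY, hBY, hd⟩ := reembed hB hc hne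
  have key : ∃ S, IsSemifilter S ∧ SH Y S := by
    by_cases h : ∃ j c, Ga j (Y ∩ cn c)
    · exact low (hom_sh hXY hX') (nowc_sh hXY hc) hd h
    · push Not at h
      exact high hBY (hom_sh hXY hX') (nowc_sh hXY hc) hd h
  obtain ⟨S, hS, hYS⟩ := key
  obtain ⟨f, g, hfg⟩ := (hXY.trans hYS).ex
  obtain ⟨e, -⟩ := homeo_of_sh hfg
  exact ⟨S, hS, ⟨e⟩⟩

end BD

/-- A Borel subset of Cantor space is homeomorphic to a semifilter iff it is
homogeneous and not locally compact. -/
theorem borel_homeomorphic_semifilter_iff (X : Set Cantor)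
    (hB : @MeasurableSet Cantor (borel Cantor) X) :
    (∃ S : Set Cantor, IsSemifilter S ∧ Nonempty (X ≃ₜ S)) ↔
      (IsHomogeneous X ∧ ¬ LocallyCompactSpace X) := by
  constructor
  · rintro ⟨S, hS, ⟨h⟩⟩
    exact BD.easy hS h
  · rintro ⟨h1, h2⟩
    exact BD.hard hB h1 h2
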